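/- Let h be a smooth solution of the Hele-Shaw equation on [0,T] with Rayleigh–Taylor coefficient a > 0. Then the function v := (1/√a)·log(1/√a) satisfies ∂_t v + L(h)v + c·v = f on [0,T]×𝕋ⁿ, where c := −γ/(2a) satisfies c(t,x) ≥ 0 for all (t,x), and the resulting source term f := ∂_t v + L(h)v + c·v satisfies f(t,x) ≤ 0 for all (t,x); i.e. v is a sub-solution: ∂_t v + L(h)v − (γ/(2a))·v ≤ 0 pointwise. -/

import Mathlib

open MeasureTheory
open scoped Classical

noncomputable section

/-- ℤⁿ-periodicity for functions on ℝⁿ (model for functions on the torus 𝕋ⁿ = ℝⁿ/ℤⁿ). -/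
def ZPeriodic (n : ℕ) (f : (Fin n → ℝ) → ℝ) : Prop :=
  ∀ (x : Fin n → ℝ) (k : Fin n → ℤ), f (x + fun i => (k i : ℝ)) = f x

/-- ℤⁿ-periodicity in the horizontal variable for functions on ℝⁿ × ℝ. -/
def ZPeriodicE (n : ℕ) (φ : (Fin n → ℝ) × ℝ → ℝ) : Prop :=
  ∀ (x : Fin n → ℝ) (y : ℝ) (k : Fin n → ℤ), φ (x + fun i => (k i : ℝ), y) = φ (x, y)

/-- Fundamental cell of the torus 𝕋ⁿ. -/
def cell (n : ℕ) : Set (Fin n → ℝ) := Set.univ.pi fun _ => Set.Ico (0:ℝ) 1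

/-- i-th partial derivative of a function on ℝⁿ. -/
def pdX (n : ℕ) (f : (Fin n → ℝ) → ℝ) (i : Fin n) (x : Fin n → ℝ) : ℝ :=
  fderiv ℝ f x (Pi.single i 1)

/-- Directional derivative of a function on ℝⁿ × ℝ. -/
def pdE (n : ℕ) (φ : (Fin n → ℝ) × ℝ → ℝ) (v : (Fin n → ℝ) × ℝ)
    (p : (Fin n → ℝ) × ℝ) : ℝ := fderiv ℝ φ p v

def eX (n : ℕ) (i : Fin n) : (Fin n → ℝ) × ℝ := (Pi.single i 1, 0)
def eY (n : ℕ) : (Fin n → ℝ) × ℝ := (0, 1)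

/-- Laplacian Δ_{x,y} on ℝⁿ × ℝ. -/
def lapE (n : ℕ) (φ : (Fin n → ℝ) × ℝ → ℝ) (p : (Fin n → ℝ) × ℝ) : ℝ :=
  (∑ i, pdE n (pdE n φ (eX n i)) (eX n i) p) + pdE n (pdE n φ (eY n)) (eY n) p

/-- |∇_{x,y}φ|². -/
def gradSqE (n : ℕ) (φ : (Fin n → ℝ) × ℝ → ℝ) (p : (Fin n → ℝ) × ℝ) : ℝ :=
  (∑ i, (pdE n φ (eX n i) p)^2) + (pdE n φ (eY n) p)^2

/-- One periodic cell of the fluid domain Ω(h) = {y < h(x)}. -/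
def fluidCell (n : ℕ) (h : (Fin n → ℝ) → ℝ) : Set ((Fin n → ℝ) × ℝ) :=
  {p | p.1 ∈ cell n ∧ p.2 < h p.1}

/-- φ is the harmonic extension of ψ to Ω(h) = {y < h(x)}: it is harmonic in Ω(h),
has boundary value ψ, is periodic in x, and has square-integrable gradient. -/
structure IsHarmonicExt (n : ℕ) (h ψ : (Fin n → ℝ) → ℝ)
    (φ : (Fin n → ℝ) × ℝ → ℝ) : Prop where
  smooth : ContDiff ℝ (⊤ : ℕ∞) φ
  periodic : ZPeriodicE n φ
  harmonic : ∀ p : (Fin n → ℝ) × ℝ, p.2 < h p.1 → lapE n φ p = 0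
  boundary : ∀ x, φ (x, h x) = ψ x
  gradL2 : IntegrableOn (gradSqE n φ) (fluidCell n h)

/-- The Dirichlet-to-Neumann operator:
(G(h)ψ)(x) = ∂_yφ(x,h(x)) − ∇h(x)·∇_xφ(x,h(x)), where φ is the harmonic extension of ψ. -/
def DtN (n : ℕ) (h ψ : (Fin n → ℝ) → ℝ) : (Fin n → ℝ) → ℝ :=
  if H : ∃ φ, IsHarmonicExt n h ψ φ then
    fun x => pdE n H.choose (eY n) (x, h x)
      - ∑ i, pdX n h i x * pdE n H.choose (eX n i) (x, h x)
  else 0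

/-- (B(h)ψ)(x) = ∂_yφ(x,h(x)). -/
def Bop (n : ℕ) (h ψ : (Fin n → ℝ) → ℝ) : (Fin n → ℝ) → ℝ :=
  if H : ∃ φ, IsHarmonicExt n h ψ φ then
    fun x => pdE n H.choose (eY n) (x, h x)
  else 0

/-- (V(h)ψ)(x) = ∇_xφ(x,h(x)). -/
def Vop (n : ℕ) (h ψ : (Fin n → ℝ) → ℝ) : (Fin n → ℝ) → Fin n → ℝ :=
  if H : ∃ φ, IsHarmonicExt n h ψ φ then
    fun x i => pdE n H.choose (eX n i) (x, h x)
  else 0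

/-- Divergence of a vector field on the torus. -/
def divX (n : ℕ) (W : (Fin n → ℝ) → Fin n → ℝ) (x : Fin n → ℝ) : ℝ :=
  ∑ i, pdX n (fun z => W z i) i x

/-- h is a smooth solution of the Hele-Shaw equation ∂ₜh + G(h)h = 0 on [0,T]. -/
structure IsHeleShawSol (n : ℕ) (T : ℝ) (h : ℝ → (Fin n → ℝ) → ℝ) : Prop where
  smooth : ContDiff ℝ (⊤ : ℕ∞) (Function.uncurry h)
  periodic : ∀ t : ℝ, ZPeriodic n (h t)
  extension : ∀ t ∈ Set.Icc 0 T, ∃ φ, IsHarmonicExt n (h t) (h t) φ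
  equation : ∀ t ∈ Set.Icc 0 T, ∀ x, deriv (fun s => h s x) t + DtN n (h t) (h t) x = 0

/-- B(t,x) = (B(h(t,·))h(t,·))(x). -/
def HSB (n : ℕ) (h : ℝ → (Fin n → ℝ) → ℝ) (t : ℝ) (x : Fin n → ℝ) : ℝ :=
  Bop n (h t) (h t) x

/-- V(t,x) = (V(h(t,·))h(t,·))(x). -/
def HSV (n : ℕ) (h : ℝ → (Fin n → ℝ) → ℝ) (t : ℝ) (x : Fin n → ℝ) : Fin n → ℝ :=
  Vop n (h t) (h t) x

/-- The Rayleigh–Taylor coefficient a = 1 − B. -/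
def HSa (n : ℕ) (h : ℝ → (Fin n → ℝ) → ℝ) (t : ℝ) (x : Fin n → ℝ) : ℝ :=
  1 - HSB n h t x

/-- γ = (1+|∇h|²)⁻¹ ( G(h)(B²+|V|²) − 2B G(h)B − 2V·G(h)V ). -/
def HSgamma (n : ℕ) (h : ℝ → (Fin n → ℝ) → ℝ) (t : ℝ) (x : Fin n → ℝ) : ℝ :=
  (1 + ∑ i, (pdX n (h t) i x)^2)⁻¹ *
    ( DtN n (h t) (fun z => (HSB n h t z)^2 + ∑ i, (HSV n h t z i)^2) x
      - 2 * HSB n h t x * DtN n (h t) (fun z => HSB n h t z) x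
      - 2 * ∑ i, HSV n h t x i * DtN n (h t) (fun z => HSV n h t z i) x )

/-- L(h)f = −V·∇f − ½(div V)f + √a G(h)(√a f). -/
def Lop (n : ℕ) (h : ℝ → (Fin n → ℝ) → ℝ) (t : ℝ) (f : (Fin n → ℝ) → ℝ)
    (x : Fin n → ℝ) : ℝ :=
  - (∑ i, HSV n h t x i * pdX n f i x)
  - (1/2) * divX n (HSV n h t) x * f x
  + Real.sqrt (HSa n h t x) * DtN n (h t) (fun z => Real.sqrt (HSa n h t z) * f z) x


/-- v = (1/√a) log(1/√a). -/
noncomputable def entV (n : ℕ) (h : ℝ → (Fin n → ℝ) → ℝ) (t : ℝ) (x : Fin n → ℝ) : ℝ :=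
  (1 / Real.sqrt (HSa n h t x)) * Real.log (1 / Real.sqrt (HSa n h t x))

/-- Abstract Galerkin operators: weights `W s`, multiplication operators `H i`, derivatives `D i`. -/
structure GalOps (n : ℕ) (K : ℕ → ℝ) (X : Type) [NormedAddCommGroup X] [InnerProductSpace ℝ X] where
  H : Fin n → X →L[ℝ] X
  D : Fin n → X →L[ℝ] X
  W : ℕ → X →L[ℝ] X
  H_symm : ∀ i v w, inner ℝ (H i v) w = inner ℝ v (H i w)
  D_skew : ∀ i v w, inner ℝ (D i v) w = - inner ℝ v (D i w)
  W_symm : ∀ s v w, inner ℝ (W s v) w = inner ℝ v (W s w)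
  W_D : ∀ s i v, W s (D i v) = D i (W s v)
  W_zero : ∀ v, W 0 v = v
  W_le : ∀ s v, ‖W s v‖ ≤ ‖W (s+1) v‖
  D_le : ∀ s i v, ‖W s (D i v)‖ ≤ K 0 * ‖W (s+1) v‖
  H_le : ∀ i v, ‖H i v‖ ≤ K 0 * ‖v‖
  comm : ∀ s i v, ‖W (s+1) (H i v) - H i (W (s+1) v)‖ ≤ K (s+1) * ‖W s v‖

namespace GalOps

variable {n : ℕ} {K : ℕ → ℝ} {X : Type} [NormedAddCommGroup X] [InnerProductSpace ℝ X]

/-- the mass operator `1 + ∑ H_i²`. -/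
def M (g : GalOps n K X) (y : X) : X := y + ∑ i, g.H i (g.H i y)

/-- the `q` field. -/
def q (g : GalOps n K X) (i : Fin n) (a b : X) : X := g.D i a - g.H i b

/-- right side of the evolution. -/
def rhs (g : GalOps n K X) (a b : X) : X := ∑ i, (g.H i (g.D i b) - g.D i (g.q i a b))

/-- flux -/
def flux (g : GalOps n K X) (a b : X) : X := b - ∑ i, g.H i (g.q i a b)

/-- energy density -/
def en (g : GalOps n K X) (s : ℕ) (a b : X) : ℝ := ‖g.W s b‖^2 + ∑ i, ‖g.W s (g.q i a b)‖^2

/-- energy norm sum -/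
def nn (g : GalOps n K X) (s : ℕ) (a b : X) : ℝ := ‖g.W s b‖ + ∑ i, ‖g.W s (g.q i a b)‖

lemma en_nonneg (g : GalOps n K X) (s : ℕ) (a b : X) : 0 ≤ g.en s a b := by
  unfold en; positivity

lemma nn_nonneg (g : GalOps n K X) (s : ℕ) (a b : X) : 0 ≤ g.nn s a b := by
  unfold nn; positivity

lemma en_le (g : GalOps n K X) (s : ℕ) (a b : X) : g.en s a b ≤ (g.nn s a b)^2 := by
  unfold en nn
  have h1 : ∑ i, ‖g.W s (g.q i a b)‖^2 ≤ (∑ i, ‖g.W s (g.q i a b)‖)^2 :=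
    Finset.sum_sq_le_sq_sum_of_nonneg (fun i _ => norm_nonneg _)
  have h2 : 0 ≤ ∑ i, ‖g.W s (g.q i a b)‖ := by positivity
  nlinarith [norm_nonneg (g.W s b)]

lemma nn_le (g : GalOps n K X) (s : ℕ) (a b : X) : (g.nn s a b)^2 ≤ 2 * (n+1) * g.en s a b := by
  unfold en nn
  have h1 : (∑ i, ‖g.W s (g.q i a b)‖)^2 ≤ n * ∑ i, ‖g.W s (g.q i a b)‖^2 := by
    have := sq_sum_le_card_mul_sum_sq (s := Finset.univ) (f := fun i => ‖g.W s (g.q i a b)‖)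
    simpa using this
  have h2 : 0 ≤ ∑ i, ‖g.W s (g.q i a b)‖^2 := by positivity
  have h3 : (0:ℝ) ≤ n := by positivity
  nlinarith [sq_nonneg (‖g.W s b‖ - ∑ i, ‖g.W s (g.q i a b)‖), sq_nonneg (‖g.W s b‖)]

lemma en_mono (g : GalOps n K X) (s : ℕ) (a b : X) : g.en s a b ≤ g.en (s+1) a b := by
  unfold en
  have := g.W_le s
  gcongr <;> apply this

lemma nn_mono (g : GalOps n K X) (s : ℕ) (a b : X) : g.nn s a b ≤ g.nn (s+1) a b := by
  unfold nn
  have := g.W_le s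
  gcongr <;> apply this

/-- constants for boundedness of H in weighted norms -/
def KH (K : ℕ → ℝ) : ℕ → ℝ
  | 0 => |K 0|
  | s+1 => |K 0| + |K (s+1)|

lemma KH_nonneg (K : ℕ → ℝ) (s : ℕ) : 0 ≤ KH K s := by
  cases s <;> simp only [KH] <;> positivity

lemma H_bdd (g : GalOps n K X) (s : ℕ) (i : Fin n) (v : X) :
    ‖g.W s (g.H i v)‖ ≤ KH K s * ‖g.W s v‖ := by
  cases s with
  | zero =>
    simp only [g.W_zero, KH]
    exact (g.H_le i v).trans (by gcongr; exact le_abs_self _)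
  | succ s =>
    have h1 := g.comm s i v
    have h2 := g.H_le i (g.W (s+1) v)
    have h3 := g.W_le s v
    have h4 : ‖g.W (s+1) (g.H i v)‖ ≤ ‖g.W (s+1) (g.H i v) - g.H i (g.W (s+1) v)‖
        + ‖g.H i (g.W (s+1) v)‖ := by
      simpa using norm_add_le (g.W (s+1) (g.H i v) - g.H i (g.W (s+1) v)) (g.H i (g.W (s+1) v))
    simp only [KH]
    have h5 : K (s+1) * ‖g.W s v‖ ≤ |K (s+1)| * ‖g.W (s+1) v‖ := by
      gcongr; exact le_abs_self _
    have h6 : K 0 * ‖g.W (s+1) v‖ ≤ |K 0| * ‖g.W (s+1) v‖ := by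
      gcongr; exact le_abs_self _
    linarith

/-- constants for the inverse of M. -/
def CM (n : ℕ) (K : ℕ → ℝ) : ℕ → ℝ
  | 0 => 1
  | s+1 => 1 + n * (|K 0| * |K (s+1)| + |K (s+1)| * KH K s) * CM n K s

lemma CM_nonneg (n : ℕ) (K : ℕ → ℝ) (s : ℕ) : 0 ≤ CM n K s := by
  induction s with
  | zero => simp [CM]
  | succ s ih => simp only [CM]; have := KH_nonneg K s; positivity

lemma M_bdd (g : GalOps n K X) (s : ℕ) (y : X) : ‖g.W s y‖ ≤ CM n K s * ‖g.W s (g.M y)‖ := by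
  induction s with
  | zero =>
    simp only [g.W_zero, CM, one_mul]
    have h1 : inner ℝ (g.M y) y = ‖y‖^2 + ∑ i, ‖g.H i y‖^2 := by
      simp only [M, inner_add_left, sum_inner, g.H_symm _ (g.H _ y) y, real_inner_self_eq_norm_sq]
    have h2 := real_inner_le_norm (g.M y) y
    have h3 : 0 ≤ ∑ i, ‖g.H i y‖^2 := by positivity
    by_contra hc
    push Not at hc
    nlinarith [norm_nonneg (g.M y), norm_nonneg y]
  | succ s ih =>
    set Y := g.W (s+1) y with hY
    have hK := KH_nonneg K s
    have e1 : ∀ i, g.W (s+1) (g.H i (g.H i y)) = g.H i (g.H i Y)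
        + (g.H i (g.W (s+1) (g.H i y) - g.H i Y))
        + (g.W (s+1) (g.H i (g.H i y)) - g.H i (g.W (s+1) (g.H i y))) := by
      intro i; simp only [map_sub]; abel
    have e2 : ∀ i, ‖g.H i (g.W (s+1) (g.H i y) - g.H i Y)‖ ≤ |K 0| * |K (s+1)| * ‖g.W s y‖ := by
      intro i
      have a1 := g.H_le i (g.W (s+1) (g.H i y) - g.H i Y)
      have a2 := g.comm s i y
      calc _ ≤ K 0 * ‖g.W (s+1) (g.H i y) - g.H i Y‖ := a1
        _ ≤ |K 0| * (|K (s+1)| * ‖g.W s y‖) := by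
          gcongr
          · exact le_abs_self _
          · exact a2.trans (by gcongr; exact le_abs_self _)
        _ = _ := by ring
    have e3 : ∀ i, ‖g.W (s+1) (g.H i (g.H i y)) - g.H i (g.W (s+1) (g.H i y))‖
        ≤ |K (s+1)| * KH K s * ‖g.W s y‖ := by
      intro i
      calc _ ≤ K (s+1) * ‖g.W s (g.H i y)‖ := g.comm s i (g.H i y)
        _ ≤ |K (s+1)| * (KH K s * ‖g.W s y‖) := by
          gcongr
          · exact le_abs_self _
          · exact g.H_bdd s i y
        _ = _ := by ring
    have h1 : inner ℝ (g.W (s+1) (g.M y)) Y = ‖Y‖^2 + ∑ i, (‖g.H i Y‖^2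
        + inner ℝ (g.H i (g.W (s+1) (g.H i y) - g.H i Y)) Y
        + inner ℝ (g.W (s+1) (g.H i (g.H i y)) - g.H i (g.W (s+1) (g.H i y))) Y) := by
      simp only [M, map_add, map_sum, inner_add_left, sum_inner]
      rw [← hY, real_inner_self_eq_norm_sq]
      congr 1
      refine Finset.sum_congr rfl fun i _ => ?_
      conv_lhs => rw [e1 i]
      rw [inner_add_left, inner_add_left, g.H_symm _ (g.H _ Y) Y, real_inner_self_eq_norm_sq]
    have h2 := real_inner_le_norm (g.W (s+1) (g.M y)) Y
    set c := |K 0| * |K (s+1)| + |K (s+1)| * KH K s with hc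
    have h3 : -(n * (c * ‖g.W s y‖) * ‖Y‖) ≤ ∑ i, (‖g.H i Y‖^2
        + inner ℝ (g.H i (g.W (s+1) (g.H i y) - g.H i Y)) Y
        + inner ℝ (g.W (s+1) (g.H i (g.H i y)) - g.H i (g.W (s+1) (g.H i y))) Y) := by
      have : ∑ i : Fin n, (-(c * ‖g.W s y‖ * ‖Y‖)) = -(n * (c * ‖g.W s y‖) * ‖Y‖) := by
        simp; ring
      rw [← this]
      refine Finset.sum_le_sum fun i _ => ?_
      have b1 := neg_le_of_abs_le (abs_real_inner_le_norm (g.H i (g.W (s+1) (g.H i y) - g.H i Y)) Y)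
      have b2 := neg_le_of_abs_le (abs_real_inner_le_norm
        (g.W (s+1) (g.H i (g.H i y)) - g.H i (g.W (s+1) (g.H i y))) Y)
      have b3 := mul_le_mul_of_nonneg_right (e2 i) (norm_nonneg Y)
      have b4 := mul_le_mul_of_nonneg_right (e3 i) (norm_nonneg Y)
      have b5 := sq_nonneg ‖g.H i Y‖
      rw [hc]
      nlinarith
    have h4 : ‖Y‖^2 ≤ (‖g.W (s+1) (g.M y)‖ + n * (c * ‖g.W s y‖)) * ‖Y‖ := by nlinarith
    have h5 : ‖Y‖ ≤ ‖g.W (s+1) (g.M y)‖ + n * (c * ‖g.W s y‖) := by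
      by_contra hcon
      push Not at hcon
      have : 0 ≤ ‖g.W (s+1) (g.M y)‖ + n * (c * ‖g.W s y‖) := by positivity
      nlinarith
    have h6 : ‖g.W s y‖ ≤ CM n K s * ‖g.W (s+1) (g.M y)‖ :=
      ih.trans (mul_le_mul_of_nonneg_left (g.W_le s _) (CM_nonneg n K s))
    calc ‖Y‖ ≤ ‖g.W (s+1) (g.M y)‖ + n * (c * ‖g.W s y‖) := h5
      _ ≤ ‖g.W (s+1) (g.M y)‖ + n * (c * (CM n K s * ‖g.W (s+1) (g.M y)‖)) := by
        gcongr
      _ = _ := by simp only [CM]; rw [← hc]; ring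

/-- The evolution relation between three consecutive derivatives. -/
def Rel (g : GalOps n K X) (a b c : X) : Prop := g.M c = g.rhs a b

lemma rhs_bdd (g : GalOps n K X) (s : ℕ) (a b : X) :
    ‖g.W s (g.rhs a b)‖ ≤ (n * (KH K s * |K 0|) + |K 0|) * g.nn (s+1) a b := by
  have hk := KH_nonneg K s
  simp only [rhs, map_sum, map_sub]
  refine (norm_sum_le _ _).trans ?_
  have h1 : ∀ i, ‖g.W s (g.H i (g.D i b)) - g.W s (g.D i (g.q i a b))‖ ≤
      KH K s * |K 0| * ‖g.W (s+1) b‖ + |K 0| * ‖g.W (s+1) (g.q i a b)‖ := by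
    intro i
    refine (norm_sub_le _ _).trans ?_
    have a1 := (g.D_le s i b).trans (mul_le_mul_of_nonneg_right (le_abs_self (K 0)) (norm_nonneg _))
    have a2 := (g.D_le s i (g.q i a b)).trans
      (mul_le_mul_of_nonneg_right (le_abs_self (K 0)) (norm_nonneg _))
    have a3 := (g.H_bdd s i (g.D i b)).trans (mul_le_mul_of_nonneg_left a1 hk)
    linarith
  refine (Finset.sum_le_sum fun i _ => h1 i).trans ?_
  rw [Finset.sum_add_distrib, ← Finset.mul_sum, ← Finset.mul_sum]
  simp only [Finset.sum_const, Finset.card_univ, Fintype.card_fin, nsmul_eq_mul, nn]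
  have h2 : 0 ≤ ∑ i, ‖g.W (s+1) (g.q i a b)‖ := by positivity
  have h3 := norm_nonneg (g.W (s+1) b)
  have h4 : (0:ℝ) ≤ n * (KH K s * |K 0|) := by positivity
  have h5 := abs_nonneg (K 0)
  nlinarith [mul_nonneg h4 h2, mul_nonneg h5 h3]

/-- step constant -/
def CS (n : ℕ) (K : ℕ → ℝ) (s : ℕ) : ℝ :=
  (1 + n * KH K s) * (CM n K s * (n * (KH K s * |K 0|) + |K 0|)) + n * |K 0|

lemma CS_nonneg (n : ℕ) (K : ℕ → ℝ) (s : ℕ) : 0 ≤ CS n K s := by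
  unfold CS; have := KH_nonneg K s; have := CM_nonneg n K s; positivity

lemma nn_step (g : GalOps n K X) (s : ℕ) {a b c : X} (h : g.Rel a b c) :
    g.nn s b c ≤ CS n K s * g.nn (s+1) a b := by
  have hk := KH_nonneg K s
  have hc : ‖g.W s c‖ ≤ (CM n K s * (n * (KH K s * |K 0|) + |K 0|)) * g.nn (s+1) a b := by
    have h1 := g.M_bdd s c
    rw [h] at h1
    refine h1.trans ?_
    rw [mul_assoc]
    exact mul_le_mul_of_nonneg_left (g.rhs_bdd s a b) (CM_nonneg n K s)
  have hq : ∀ i, ‖g.W s (g.q i b c)‖ ≤ |K 0| * g.nn (s+1) a b + KH K s * ‖g.W s c‖ := by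
    intro i
    simp only [q, map_sub]
    refine (norm_sub_le _ _).trans (add_le_add ?_ (g.H_bdd s i c))
    refine (g.D_le s i b).trans ?_
    have : ‖g.W (s+1) b‖ ≤ g.nn (s+1) a b := by
      unfold nn; exact le_add_of_nonneg_right (by positivity)
    exact mul_le_mul (le_abs_self _) this (norm_nonneg _) (abs_nonneg _)
  have hs : ∑ i, ‖g.W s (g.q i b c)‖ ≤ n * (|K 0| * g.nn (s+1) a b + KH K s * ‖g.W s c‖) := by
    refine (Finset.sum_le_sum fun i _ => hq i).trans ?_
    simp [mul_add]
  have : g.nn s b c ≤ (1 + n * KH K s) * ‖g.W s c‖ + n * |K 0| * g.nn (s+1) a b := by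
    unfold nn at hs ⊢; linarith
  refine this.trans ?_
  unfold CS
  have := mul_le_mul_of_nonneg_left hc (show (0:ℝ) ≤ 1 + n * KH K s by positivity)
  linarith

end GalOps

namespace GalOps

variable {n : ℕ} {K : ℕ → ℝ} {X : Type} [NormedAddCommGroup X] [InnerProductSpace ℝ X]

/-- derivative of the flux pairing. -/
lemma flux_deriv (g : GalOps n K X) {u p p' : ℝ → X} {z : ℝ} (hu : HasDerivAt u (p z) z)
    (hp : HasDerivAt p (p' z) z) (hrel : g.Rel (u z) (p z) (p' z)) {η η' : ℝ → X}
    (hη : HasDerivAt η (η' z) z) :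
    HasDerivAt (fun z => inner ℝ (g.flux (u z) (p z)) (η z))
      (inner ℝ (p z) (η' z) + ∑ i, inner ℝ (g.q i (u z) (p z)) (g.D i (η z) - g.H i (η' z))) z := by
  have hq : ∀ i, HasDerivAt (fun z => g.q i (u z) (p z)) (g.q i (p z) (p' z)) z := by
    intro i
    exact ((g.D i).hasFDerivAt.comp_hasDerivAt z hu).sub ((g.H i).hasFDerivAt.comp_hasDerivAt z hp)
  have hf : HasDerivAt (fun z => g.flux (u z) (p z)) (p' z - ∑ i, g.H i (g.q i (p z) (p' z))) z := by
    unfold flux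
    refine hp.sub ?_
    have := HasDerivAt.sum (u := Finset.univ) (x := z)
      (A := fun i z => g.H i (g.q i (u z) (p z))) (A' := fun i => g.H i (g.q i (p z) (p' z)))
      (fun i _ => (g.H i).hasFDerivAt.comp_hasDerivAt z (hq i))
    convert this using 1
    ext z; simp
  have hJ := hf.inner ℝ hη
  refine hJ.congr_deriv ?_
  symm
  have e1 : p' z - ∑ i, g.H i (g.q i (p z) (p' z)) = - ∑ i, g.D i (g.q i (u z) (p z)) := by
    have h := hrel
    unfold Rel M rhs at h
    simp only [q, map_sub, Finset.sum_sub_distrib] at h ⊢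
    have h2 : p' z = (∑ i, (g.H i) ((g.D i) (p z)) - (∑ i, (g.D i) ((g.D i) (u z)) -
      ∑ i, (g.D i) ((g.H i) (p z)))) - ∑ i, g.H i (g.H i (p' z)) := by
      rw [← h]; abel
    nth_rewrite 1 [h2]
    abel
  rw [e1]
  simp only [flux, inner_sub_left, sum_inner, inner_neg_left, g.D_skew, g.H_symm,
    inner_sub_right, Finset.sum_sub_distrib, Finset.sum_neg_distrib]
  ring

lemma young (κ a b δ : ℝ) (hδ : 0 < δ) : κ * a * b ≤ δ * b^2 + κ^2/(4*δ) * a^2 := by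
  have : δ * b^2 + κ^2/(4*δ) * a^2 - κ * a * b = δ * (b - κ * a/(2*δ))^2 := by
    field_simp; ring
  nlinarith [mul_nonneg hδ.le (sq_nonneg (b - κ * a/(2*δ)))]

set_option maxHeartbeats 1000000 in
/-- Pointwise lower bound of the derivative of the flux pairing with `W W (u - v)`. -/
lemma energy_pointwise (g : GalOps n K X) (W V : X →L[ℝ] X) (κ : ℝ) (hκ : 0 ≤ κ)
    (Wsymm : ∀ v w, inner ℝ (W v) w = inner ℝ v (W w))
    (WD : ∀ i v, W (g.D i v) = g.D i (W v))
    (hcomm : ∀ i v, ‖W (g.H i v) - g.H i (W v)‖ ≤ κ * ‖V v‖) (u p v : X) :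
    (1/2) * (‖W p‖^2 + ∑ i, ‖W (g.q i u p)‖^2)
      - (8 + 8 * (n+1) * κ^2) * ((‖W v‖^2 + ∑ i, ‖W (g.q i v v)‖^2 + ‖V v‖^2)
        + (‖V p‖^2 + ∑ i, ‖V (g.q i u p)‖^2)) * (n+1) ≤
    inner ℝ p (W (W (p - v))) + ∑ i, inner ℝ (g.q i u p)
      (g.D i (W (W (u - v))) - g.H i (W (W (p - v)))) := by
  have hn : (0:ℝ) ≤ n := by positivity
  have t1 : inner ℝ p (W (W (p - v))) ≥ 3/4 * ‖W p‖^2 - ‖W v‖^2 := by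
    rw [← Wsymm, map_sub, inner_sub_right, real_inner_self_eq_norm_sq]
    have := real_inner_le_norm (W p) (W v)
    nlinarith [sq_nonneg (‖W p‖ / 2 - ‖W v‖)]
  have t2 : ∀ i, inner ℝ (g.q i u p) (g.D i (W (W (u - v))) - g.H i (W (W (p - v)))) ≥
      1/2 * ‖W (g.q i u p)‖^2 - 2 * ‖W (g.q i v v)‖^2 - 4 * κ^2 * (‖V p‖^2 + ‖V v‖^2)
      - (1/(8*(n+1)) * (‖W p‖^2 + ‖W v‖^2) + 4 * (n+1) * κ^2 * ‖V (g.q i u p)‖^2) := by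
    intro i
    set Q := g.q i u p with hQ
    set w' := p - v with hw'
    have e0 : g.D i (W (W (u - v))) - g.H i (W (W w')) =
        W (W (Q - g.q i v v)) + (W (W (g.H i w')) - g.H i (W (W w'))) := by
      rw [← WD, ← WD, hQ, hw']
      simp only [q, map_sub]; abel
    have e1 : inner ℝ Q (g.D i (W (W (u - v))) - g.H i (W (W w'))) =
        ‖W Q‖^2 - inner ℝ (W Q) (W (g.q i v v)) + inner ℝ (W Q) (W (g.H i w') - g.H i (W w'))
        - inner ℝ (W (g.H i Q) - g.H i (W Q)) (W w') := by
      rw [e0, inner_add_right, ← Wsymm Q, map_sub, inner_sub_right, inner_sub_right,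
        real_inner_self_eq_norm_sq, inner_sub_right, inner_sub_left, ← Wsymm Q, ← g.H_symm i Q,
        ← Wsymm (g.H i Q), g.H_symm i (W Q)]
      ring
    rw [e1]
    have b1 := real_inner_le_norm (W Q) (W (g.q i v v))
    have b2 := neg_le_of_abs_le (abs_real_inner_le_norm (W Q) (W (g.H i w') - g.H i (W w')))
    have b3 := real_inner_le_norm (W (g.H i Q) - g.H i (W Q)) (W w')
    have c2 := mul_le_mul_of_nonneg_left (hcomm i w') (norm_nonneg (W Q))
    have c3 := mul_le_mul_of_nonneg_right (hcomm i Q) (norm_nonneg (W w'))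
    have d2 : ‖V w'‖ ≤ ‖V p‖ + ‖V v‖ := by rw [hw', map_sub]; exact norm_sub_le _ _
    have d3 : ‖W w'‖ ≤ ‖W p‖ + ‖W v‖ := by rw [hw', map_sub]; exact norm_sub_le _ _
    have y1 := young κ (‖V w'‖) (‖W Q‖) (1/8) (by norm_num)
    have y2 := young κ (‖V Q‖) (‖W w'‖) (1/(16*(n+1))) (by positivity)
    have y3 := young 1 (‖W (g.q i v v)‖) (‖W Q‖) (1/4) (by norm_num)
    have s1 : ‖V w'‖^2 ≤ 2 * (‖V p‖^2 + ‖V v‖^2) := by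
      nlinarith [norm_nonneg (V w'), sq_nonneg (‖V p‖ - ‖V v‖)]
    have s2 : ‖W w'‖^2 ≤ 2 * (‖W p‖^2 + ‖W v‖^2) := by
      nlinarith [norm_nonneg (W w'), sq_nonneg (‖W p‖ - ‖W v‖)]
    have s3 : (1/(16*((n:ℝ)+1))) * ‖W w'‖^2 ≤ 1/(8*(n+1)) * (‖W p‖^2 + ‖W v‖^2) := by
      have : (1/(8*((n:ℝ)+1))) * (‖W p‖^2 + ‖W v‖^2) = (1/(16*((n:ℝ)+1))) *
        (2 * (‖W p‖^2 + ‖W v‖^2)) := by field_simp; ring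
      rw [this]; gcongr
    have s4 : κ^2/(4*(1/(16*((n:ℝ)+1)))) * ‖V Q‖^2 = 4 * (n+1) * κ^2 * ‖V Q‖^2 := by
      field_simp; ring
    rw [s4] at y2
    have s5 : κ^2/(4*(1/8)) * ‖V w'‖^2 ≤ 4 * κ^2 * (‖V p‖^2 + ‖V v‖^2) := by
      have : κ^2/(4*(1/8)) * ‖V w'‖^2 = 2 * κ^2 * ‖V w'‖^2 := by ring
      rw [this]; nlinarith [sq_nonneg κ]
    have y3' : ‖W (g.q i v v)‖ * ‖W Q‖ ≤ 1/4 * ‖W Q‖^2 + ‖W (g.q i v v)‖^2 := by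
      have : (1:ℝ)^2/(4*(1/4)) = 1 := by norm_num
      rw [this] at y3; linarith
    have c2' : ‖W Q‖ * (κ * ‖V w'‖) = κ * ‖V w'‖ * ‖W Q‖ := by ring
    have c3' : (κ * ‖V Q‖) * ‖W w'‖ = κ * ‖V Q‖ * ‖W w'‖ := by ring
    have b1' : ‖W Q‖ * ‖W (g.q i v v)‖ = ‖W (g.q i v v)‖ * ‖W Q‖ := by ring
    have z1 : 0 ≤ ‖W (g.q i v v)‖^2 := by positivity
    have z2 : 0 ≤ ‖W Q‖^2 := by positivity
    clear_value Q w'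
    rw [c2'] at c2
    rw [b1'] at b1
    linarith
  have t3 := Finset.sum_le_sum (fun i (_ : i ∈ Finset.univ) => t2 i)
  simp only [Finset.sum_sub_distrib, Finset.sum_add_distrib, ← Finset.mul_sum, Finset.sum_const,
    Finset.card_univ, Fintype.card_fin, nsmul_eq_mul] at t3
  simp only [ge_iff_le, Finset.sum_sub_distrib] at t3 t1 ⊢
  have f1 : (n:ℝ) * (1/(8*(n+1)) * (‖W p‖^2 + ‖W v‖^2)) ≤ 1/8 * (‖W p‖^2 + ‖W v‖^2) := by
    have : (n:ℝ) * (1/(8*(n+1))) ≤ 1/8 := by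
      rw [mul_one_div, div_le_div_iff₀ (by positivity) (by norm_num)]; linarith
    rw [← mul_assoc]; gcongr
  set a := ‖W p‖^2
  set b := ∑ i, ‖W (g.q i u p)‖^2
  set c := ‖W v‖^2 with hc
  set d := ∑ i, ‖W (g.q i v v)‖^2
  set e := ‖V p‖^2
  set f := ‖V v‖^2
  set k := ∑ i, ‖V (g.q i u p)‖^2
  have ha : 0 ≤ a := by positivity
  have hc0 : 0 ≤ c := by positivity
  have hd0 : 0 ≤ d := by positivity
  have he0 : 0 ≤ e := by positivity
  have hf0 : 0 ≤ f := by positivity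
  have hk0 : 0 ≤ k := by positivity
  set m := κ^2
  have hm : 0 ≤ m := by positivity
  have key : 4 * m * (n * (e + f)) + 4 * (n+1) * m * k + 2 * d + 2 * c ≤
      (8 + 8 * (n+1) * m) * ((c + d + f) + (e + k)) * (n+1) := by
    have k1 : 0 ≤ m * n := by positivity
    have k2 : 0 ≤ m * n * n := by positivity
    have q1 := mul_nonneg hm he0
    have q2 := mul_nonneg hm hf0
    have q3 := mul_nonneg hm hk0
    have : (8 + 8 * (n+1) * m) * ((c + d + f) + (e + k)) * (n+1) = 8 * (c+d+f+e+k)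
      + 8 * n * (c+d+f+e+k) + 8 * m * (1 + 2 * n + n*n) * (c+d) 
      + 8 * m * (1 + 2 * n + n*n) * (e + f) + 8 * m * (1 + 2*n + n*n) * k := by ring
    rw [this]
    have r1 : 0 ≤ n * (c+d+f+e+k) := by positivity
    have r2 : 0 ≤ m * (1 + 2 * n + n*n) * (c+d) := by positivity
    have r3 : 0 ≤ m * (1 + n*n) * (e+f) := by positivity
    have r4 : 0 ≤ m * (n*n) * k := by positivity
    have r5 : 0 ≤ m * n * (e+f) := by positivity
    have r6 : 0 ≤ m * n * k := by positivity
    nlinarith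
  linarith

end GalOps

namespace GalOps

variable {n : ℕ} {K : ℕ → ℝ} {X : Type} [NormedAddCommGroup X] [InnerProductSpace ℝ X]

/-- a trajectory with all its derivatives -/
structure Traj (g : GalOps n K X) (u : ℕ → ℝ → X) : Prop where
  der : ∀ j z, HasDerivAt (u j) (u (j+1) z) z
  rel : ∀ j z, g.Rel (u j z) (u (j+1) z) (u (j+2) z)

lemma Traj.cont {g : GalOps n K X} {u : ℕ → ℝ → X} (h : g.Traj u) (j : ℕ) : Continuous (u j) :=
  continuous_iff_continuousAt.2 fun z => (h.der j z).continuousAt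

lemma en_cont {g : GalOps n K X} {a b : ℝ → X} (ha : Continuous a) (hb : Continuous b) (s : ℕ) :
    Continuous fun z => g.en s (a z) (b z) := by
  unfold en q
  fun_prop

lemma J_deriv {g : GalOps n K X} {u : ℕ → ℝ → X} (h : g.Traj u) (z : ℝ) :
    HasDerivAt (fun z => inner ℝ (g.flux (u 0 z) (u 1 z)) (u 0 z)) (g.en 0 (u 0 z) (u 1 z)) z := by
  have := g.flux_deriv (p' := u 2) (η := u 0) (η' := u 1) (h.der 0 z) (h.der 1 z) (h.rel 0 z)
    (h.der 0 z)
  refine this.congr_deriv ?_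
  simp only [en, q, W_zero, real_inner_self_eq_norm_sq]

/-- M as a linear map. -/
def Ml (g : GalOps n K X) : X →ₗ[ℝ] X := LinearMap.id + ∑ i, (g.H i).toLinearMap ∘ₗ (g.H i).toLinearMap

lemma Ml_apply (g : GalOps n K X) (y : X) : g.Ml y = g.M y := by
  simp [Ml, M]

lemma Ml_inj (g : GalOps n K X) : Function.Injective g.Ml := by
  rw [injective_iff_map_eq_zero]
  intro y hy
  have := g.M_bdd 0 y
  rw [← Ml_apply, hy] at this
  simpa [W_zero] using this

/-- rhs as linear map -/
def rhsl (g : GalOps n K X) : X × X →ₗ[ℝ] X where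
  toFun w := g.rhs w.1 w.2
  map_add' a b := by
    simp only [rhs, q, Prod.fst_add, Prod.snd_add, map_add, map_sub, ← Finset.sum_add_distrib]
    refine Finset.sum_congr rfl fun i _ => by abel
  map_smul' c a := by
    simp only [rhs, q, Prod.smul_fst, Prod.smul_snd, map_smul, map_sub, Finset.smul_sum, smul_sub,
      RingHom.id_apply]

/-- flux as linear map -/
def fluxl (g : GalOps n K X) : X × X →ₗ[ℝ] X where
  toFun w := g.flux w.1 w.2
  map_add' a b := by
    have : ∀ i, g.H i (g.q i (a+b).1 (a+b).2) = g.H i (g.q i a.1 a.2) + g.H i (g.q i b.1 b.2) := by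
      intro i; simp only [q, Prod.fst_add, Prod.snd_add, map_add, map_sub]; abel
    simp only [flux, this, Finset.sum_add_distrib]
    rw [Prod.snd_add]; abel
  map_smul' c a := by
    simp only [flux, q, Prod.smul_fst, Prod.smul_snd, map_smul, map_sub, Finset.smul_sum, smul_sub,
      RingHom.id_apply]

lemma exists_expflow {Y : Type*} [NormedAddCommGroup Y] [NormedSpace ℝ Y] [CompleteSpace Y]
    (A : Y →L[ℝ] Y) : ∃ E : ℝ → (Y →L[ℝ] Y), (∀ (j : ℕ) z w, HasDerivAt (fun z => (A^j * E z) w)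
      ((A^j * (A * E z)) w) z) ∧ E 0 = 1 := by
  refine ⟨fun z => NormedSpace.exp (z • A), fun j z w => ?_, by simp [NormedSpace.exp_zero]⟩
  have h0 := hasDerivAt_exp_smul_const' A z
  have h1 := (ContinuousLinearMap.apply ℝ Y w).hasFDerivAt.comp_hasDerivAt z h0
  exact (A^j).hasFDerivAt.comp_hasDerivAt z h1

lemma exists_flow [FiniteDimensional ℝ X] (g : GalOps n K X) :
    ∃ F : X × X →ₗ[ℝ] (ℕ → ℝ → X), (∀ w, g.Traj (F w)) ∧ (∀ w, F w 0 0 = w.1 ∧ F w 1 0 = w.2) := by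
  let Me := LinearEquiv.ofInjectiveEndo g.Ml g.Ml_inj
  let Al : X × X →ₗ[ℝ] X × X := LinearMap.prod (LinearMap.snd ℝ X X) (Me.symm.toLinearMap ∘ₗ g.rhsl)
  let A : X × X →L[ℝ] X × X := LinearMap.toContinuousLinearMap Al
  have hA : ∀ w, A w = (w.2, Me.symm (g.rhs w.1 w.2)) := fun w => rfl
  have hMe : ∀ y, g.M (Me.symm y) = y := by
    intro y
    rw [← Ml_apply]
    exact Me.apply_symm_apply y
  obtain ⟨E, hE, hE0⟩ := exists_expflow A
  let F : X × X →ₗ[ℝ] (ℕ → ℝ → X) :=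
    { toFun := fun w j z => ((A^j * E z) w).1
      map_add' := by intro a b; ext j z; simp
      map_smul' := by intro c a; ext j z; simp }
  have hF : ∀ w j z, F w j z = ((A^j * E z) w).1 := fun _ _ _ => rfl
  have hs : ∀ w j z, F w (j+1) z = ((A^j * E z) w).2 := by
    intro w j z
    rw [hF, pow_succ', mul_assoc, mul_apply_eq_comp, hA]
  refine ⟨F, fun w => ⟨?_, ?_⟩, fun w => ⟨?_, ?_⟩⟩
  · intro j z
    have h2 := hE j z w
    have h3 := (ContinuousLinearMap.fst ℝ X X).hasFDerivAt.comp_hasDerivAt z h2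
    refine h3.congr_deriv ?_
    rw [hF, pow_succ, mul_assoc]
    simp
  · intro j z
    rw [hs w (j+1), hs w j, hF w j]
    unfold Rel
    rw [pow_succ', mul_assoc, mul_apply_eq_comp, hA]
    exact hMe _
  · rw [hF, hE0]; simp
  · rw [hs, hE0]; simp

lemma exists_bvp [FiniteDimensional ℝ X] (g : GalOps n K X) (ψ : X) (R : ℝ) (hR : 0 < R) :
    ∃ u, g.Traj u ∧ u 0 0 = ψ ∧ g.flux (u 0 (-R)) (u 1 (-R)) = 0 := by
  obtain ⟨F, hF, hF0⟩ := g.exists_flow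
  let Φ : X × X →ₗ[ℝ] X × X :=
    { toFun := fun w => (w.1, g.fluxl (F w 0 (-R), F w 1 (-R)))
      map_add' := by
        intro a b
        have : (F (a+b) 0 (-R), F (a+b) 1 (-R)) = (F a 0 (-R), F a 1 (-R)) + (F b 0 (-R), F b 1 (-R)) := by
          simp
        rw [this, map_add]; simp
      map_smul' := by
        intro c a
        have : (F (c • a) 0 (-R), F (c • a) 1 (-R)) = c • (F a 0 (-R), F a 1 (-R)) := by
          simp
        rw [this, map_smul]; simp }
  have hinj : Function.Injective Φ := by
    rw [injective_iff_map_eq_zero]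
    intro w hw
    have h1 : w.1 = 0 := congrArg Prod.fst hw
    have h2 : g.flux (F w 0 (-R)) (F w 1 (-R)) = 0 := congrArg Prod.snd hw
    have hc : Continuous fun z => g.en 0 (F w 0 z) (F w 1 z) := en_cont ((hF w).cont 0) ((hF w).cont 1) 0
    have h3 := intervalIntegral.integral_eq_sub_of_hasDerivAt (a := -R) (b := 0)
      (fun z _ => J_deriv (hF w) z) (hc.intervalIntegrable _ _)
    rw [h2, (hF0 w).1, h1] at h3
    simp only [inner_zero_left, inner_zero_right, sub_zero] at h3
    have h4 : ¬ 0 < g.en 0 (F w 0 0) (F w 1 0) := by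
      intro h
      have := intervalIntegral.integral_pos (a := -R) (b := 0) (by linarith) hc.continuousOn
        (fun z _ => g.en_nonneg 0 _ _) ⟨0, ⟨by linarith, le_refl _⟩, h⟩
      linarith
    rw [(hF0 w).1, (hF0 w).2] at h4
    have h5 : ‖w.2‖^2 ≤ g.en 0 w.1 w.2 := by
      unfold en; rw [W_zero]
      have : 0 ≤ ∑ i, ‖g.W 0 (g.q i w.1 w.2)‖^2 := by positivity
      linarith
    have h6 : ‖w.2‖ = 0 := by nlinarith [norm_nonneg w.2]
    exact Prod.ext h1 (norm_eq_zero.1 h6)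
  obtain ⟨w, hw⟩ := (LinearMap.injective_iff_surjective.1 hinj) (ψ, 0)
  have h1 : w.1 = ψ := congrArg Prod.fst hw
  refine ⟨F w, hF w, (hF0 w).1.trans h1, congrArg Prod.snd hw⟩

end GalOps

namespace GalOps

variable {n : ℕ} {K : ℕ → ℝ} {X : Type} [NormedAddCommGroup X] [InnerProductSpace ℝ X]

lemma energy_int (g : GalOps n K X) (W V : X →L[ℝ] X) (κ : ℝ) (hκ : 0 ≤ κ)
    (Wsymm : ∀ v w, inner ℝ (W v) w = inner ℝ v (W w))
    (WD : ∀ i v, W (g.D i v) = g.D i (W v))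
    (hcomm : ∀ i v, ‖W (g.H i v) - g.H i (W v)‖ ≤ κ * ‖V v‖) {u : ℕ → ℝ → X} (hu : g.Traj u)
    (ψ : X) (R : ℝ) (hR : 0 < R) (h0 : u 0 0 = ψ) (hfl : g.flux (u 0 (-R)) (u 1 (-R)) = 0)
    (P : ℝ) (hP : ‖W ψ‖^2 + ∑ i, ‖W (g.q i ψ ψ)‖^2 + ‖V ψ‖^2 ≤ P) :
    (∫ z in (-R)..0, (‖W (u 1 z)‖^2 + ∑ i, ‖W (g.q i (u 0 z) (u 1 z))‖^2)) ≤
      2 * ((8 + 8 * (n+1) * κ^2) * (P + ∫ z in (-R)..0,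
        (‖V (u 1 z)‖^2 + ∑ i, ‖V (g.q i (u 0 z) (u 1 z))‖^2)) * (n+1)) := by
  have c0 := hu.cont 0
  have c1 := hu.cont 1
  have hv : ∀ z, HasDerivAt (fun z => Real.exp z • ψ) (Real.exp z • ψ) z := fun z =>
    (Real.hasDerivAt_exp z).smul_const ψ
  have hη : ∀ z, HasDerivAt (fun z => W (W (u 0 z - Real.exp z • ψ)))
      (W (W (u 1 z - Real.exp z • ψ))) z := fun z =>
    W.hasFDerivAt.comp_hasDerivAt z (W.hasFDerivAt.comp_hasDerivAt z ((hu.der 0 z).sub (hv z)))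
  have hJ := fun z => g.flux_deriv (p' := u 2) (η := fun z => W (W (u 0 z - Real.exp z • ψ)))
    (η' := fun z => W (W (u 1 z - Real.exp z • ψ))) (hu.der 0 z) (hu.der 1 z) (hu.rel 0 z) (hη z)
  have hGc : Continuous fun z => inner ℝ (u 1 z) (W (W (u 1 z - Real.exp z • ψ))) +
      ∑ i, inner ℝ (g.q i (u 0 z) (u 1 z)) (g.D i (W (W (u 0 z - Real.exp z • ψ)))
        - g.H i (W (W (u 1 z - Real.exp z • ψ)))) := by
    unfold q; fun_prop
  have hI := intervalIntegral.integral_eq_sub_of_hasDerivAt (a := -R) (b := 0)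
      (fun z _ => hJ z) (hGc.intervalIntegrable _ _)
  simp only [zero_add, hfl, h0, Real.exp_zero, one_smul, sub_self, map_zero, inner_zero_right,
    inner_zero_left] at hI
  have cW : Continuous fun z => ‖W (u 1 z)‖^2 + ∑ i, ‖W (g.q i (u 0 z) (u 1 z))‖^2 := by
    unfold q; fun_prop
  have cV : Continuous fun z => ‖V (u 1 z)‖^2 + ∑ i, ‖V (g.q i (u 0 z) (u 1 z))‖^2 := by
    unfold q; fun_prop
  have key : ∀ z ∈ Set.Icc (-R) 0, (1/2) * (‖W (u 1 z)‖^2 + ∑ i, ‖W (g.q i (u 0 z) (u 1 z))‖^2)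
      - (8 + 8 * (n+1) * κ^2) * (Real.exp z * P + (‖V (u 1 z)‖^2 + ∑ i, ‖V (g.q i (u 0 z) (u 1 z))‖^2))
        * (n+1) ≤ inner ℝ (u 1 z) (W (W (u 1 z - Real.exp z • ψ))) +
      ∑ i, inner ℝ (g.q i (u 0 z) (u 1 z)) (g.D i (W (W (u 0 z - Real.exp z • ψ)))
        - g.H i (W (W (u 1 z - Real.exp z • ψ)))) := by
    intro z hz
    refine le_trans ?_ (g.energy_pointwise W V κ hκ Wsymm WD hcomm (u 0 z) (u 1 z) (Real.exp z • ψ))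
    have e1 : ∀ i, g.q i (Real.exp z • ψ) (Real.exp z • ψ) = Real.exp z • g.q i ψ ψ := by
      intro i; simp only [q, map_smul, smul_sub]
    have hez : Real.exp z ≤ 1 := Real.exp_le_one_iff.2 hz.2
    have hep := Real.exp_pos z
    have e2 : ‖W (Real.exp z • ψ)‖^2 + ∑ i, ‖W (g.q i (Real.exp z • ψ) (Real.exp z • ψ))‖^2
        + ‖V (Real.exp z • ψ)‖^2 ≤ Real.exp z * P := by
      simp only [e1, map_smul, norm_smul, mul_pow, ← Finset.mul_sum, Real.norm_eq_abs, abs_of_pos hep]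
      rw [← mul_add, ← mul_add]
      have : Real.exp z ^ 2 ≤ Real.exp z := by nlinarith
      gcongr
    gcongr
  have hmono := intervalIntegral.integral_mono_on (μ := volume) (a := -R) (b := 0) (by linarith)
    (by apply Continuous.intervalIntegrable; fun_prop) (hGc.intervalIntegrable _ _) key
  rw [hI] at hmono
  rw [intervalIntegral.integral_sub (by apply Continuous.intervalIntegrable; fun_prop)
    (by apply Continuous.intervalIntegrable; fun_prop), intervalIntegral.integral_const_mul,
    intervalIntegral.integral_mul_const, intervalIntegral.integral_const_mul,
    intervalIntegral.integral_add (by apply Continuous.intervalIntegrable; fun_prop)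
    (cV.intervalIntegrable _ _), intervalIntegral.integral_mul_const, integral_exp] at hmono
  have hP0 : 0 ≤ P := le_trans (by positivity) hP
  have h1 : (Real.exp 0 - Real.exp (-R)) * P ≤ P := by
    rw [Real.exp_zero]
    have := Real.exp_pos (-R)
    nlinarith
  have h2 : (8 + 8 * (n+1) * κ^2) * ((Real.exp 0 - Real.exp (-R)) * P + ∫ z in (-R)..0,
        (‖V (u 1 z)‖^2 + ∑ i, ‖V (g.q i (u 0 z) (u 1 z))‖^2)) * (n+1) ≤
        (8 + 8 * (n+1) * κ^2) * (P + ∫ z in (-R)..0,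
        (‖V (u 1 z)‖^2 + ∑ i, ‖V (g.q i (u 0 z) (u 1 z))‖^2)) * (n+1) := by
    gcongr
  linarith

/-- data bound -/
def PP (n : ℕ) (K P : ℕ → ℝ) (s : ℕ) : ℝ :=
  (P s)^2 + n * (|K 0| * P (s+1) + KH K s * P s)^2 + (P s)^2

lemma PP_bound (g : GalOps n K X) (P : ℕ → ℝ) (ψ : X) (hP : ∀ s, ‖g.W s ψ‖ ≤ P s) (s : ℕ) (V : X →L[ℝ] X)
    (hV : ‖V ψ‖ ≤ P s) :
    ‖g.W s ψ‖^2 + ∑ i, ‖g.W s (g.q i ψ ψ)‖^2 + ‖V ψ‖^2 ≤ PP n K P s := by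
  unfold PP
  have hP0 : ∀ s, 0 ≤ P s := fun s => (norm_nonneg _).trans (hP s)
  have hk := KH_nonneg K s
  have h1 : ∀ i, ‖g.W s (g.q i ψ ψ)‖ ≤ |K 0| * P (s+1) + KH K s * P s := by
    intro i
    unfold q
    rw [map_sub]
    refine (norm_sub_le _ _).trans ?_
    gcongr
    · refine (g.D_le s i ψ).trans ?_
      gcongr
      · exact le_abs_self _
      · exact hP _
    · refine (g.H_bdd s i ψ).trans ?_
      gcongr; exact hP _
  have h2 : ∑ i, ‖g.W s (g.q i ψ ψ)‖^2 ≤ n * (|K 0| * P (s+1) + KH K s * P s)^2 := by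
    refine (Finset.sum_le_sum fun i _ => pow_le_pow_left₀ (norm_nonneg _) (h1 i) 2).trans ?_
    simp
  gcongr
  exact hP s

/-- energy integral constants -/
def CI (n : ℕ) (K P : ℕ → ℝ) : ℕ → ℝ
  | 0 => 2 * (8 * PP n K P 0 * (n+1))
  | s+1 => 2 * ((8 + 8 * (n+1) * |K (s+1)|^2) * (PP n K P (s+1) + CI n K P s) * (n+1))

lemma CI_bound (g : GalOps n K X) (P : ℕ → ℝ) (ψ : X) (hP : ∀ s, ‖g.W s ψ‖ ≤ P s)
    {u : ℕ → ℝ → X} (hu : g.Traj u)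
    (R : ℝ) (hR : 0 < R) (h0 : u 0 0 = ψ) (hfl : g.flux (u 0 (-R)) (u 1 (-R)) = 0) (s : ℕ) :
    (∫ z in (-R)..0, g.en s (u 0 z) (u 1 z)) ≤ CI n K P s := by
  have hP0 : ∀ s, 0 ≤ P s := fun s => (norm_nonneg _).trans (hP s)
  induction s with
  | zero =>
    have := g.energy_int (g.W 0) 0 0 le_rfl (g.W_symm 0) (g.W_D 0) (by intro i v; simp [g.W_zero])
      hu ψ R hR h0 hfl _ (g.PP_bound P ψ hP 0 0 (by simpa using hP0 0))
    simpa [CI, en] using this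
  | succ s ih =>
    have := g.energy_int (g.W (s+1)) (g.W s) |K (s+1)| (abs_nonneg _) (g.W_symm _) (g.W_D _)
      (by
        intro i v
        refine (g.comm s i v).trans ?_
        gcongr; exact le_abs_self _)
      hu ψ R hR h0 hfl _ (g.PP_bound P ψ hP (s+1) (g.W s) ((g.W_le s ψ).trans (hP _)))
    unfold en
    refine this.trans ?_
    unfold CI
    unfold en at ih
    gcongr

lemma CI_nonneg (g : GalOps n K X) (P : ℕ → ℝ) (ψ : X) (hP : ∀ s, ‖g.W s ψ‖ ≤ P s)
    {u : ℕ → ℝ → X} (hu : g.Traj u)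
    (R : ℝ) (hR : 0 < R) (h0 : u 0 0 = ψ) (hfl : g.flux (u 0 (-R)) (u 1 (-R)) = 0) (s : ℕ) :
    0 ≤ CI n K P s := by
  refine le_trans ?_ (g.CI_bound P ψ hP hu R hR h0 hfl s)
  exact intervalIntegral.integral_nonneg (by linarith) fun z _ => g.en_nonneg _ _ _

lemma en_deriv (g : GalOps n K X) {u : ℕ → ℝ → X} (hu : g.Traj u) (s : ℕ) (z : ℝ) :
    ∃ e', HasDerivAt (fun z => g.en s (u 0 z) (u 1 z)) e' z ∧
      |e'| ≤ 4 * (n+1) * CS n K s * g.en (s+1) (u 0 z) (u 1 z) := by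
  have hq : ∀ i, HasDerivAt (fun z => g.W s (g.q i (u 0 z) (u 1 z))) (g.W s (g.q i (u 1 z) (u 2 z))) z := by
    intro i
    exact (g.W s).hasFDerivAt.comp_hasDerivAt z
      (((g.D i).hasFDerivAt.comp_hasDerivAt z (hu.der 0 z)).sub
      ((g.H i).hasFDerivAt.comp_hasDerivAt z (hu.der 1 z)))
  have h1 : HasDerivAt (fun z => g.W s (u 1 z)) (g.W s (u 2 z)) z :=
    (g.W s).hasFDerivAt.comp_hasDerivAt z (hu.der 1 z)
  have hd := h1.norm_sq.add (HasDerivAt.fun_sum (u := Finset.univ) (fun i _ => (hq i).norm_sq))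
  refine ⟨_, hd, ?_⟩
  have hb : |2 * inner ℝ (g.W s (u 1 z)) (g.W s (u 2 z)) +
      ∑ i, 2 * inner ℝ (g.W s (g.q i (u 0 z) (u 1 z))) (g.W s (g.q i (u 1 z) (u 2 z)))| ≤
      2 * (g.nn s (u 0 z) (u 1 z) * g.nn s (u 1 z) (u 2 z)) := by
    refine (abs_add_le _ _).trans ?_
    have a1 := abs_real_inner_le_norm (g.W s (u 1 z)) (g.W s (u 2 z))
    have a2 : |∑ i, 2 * inner ℝ (g.W s (g.q i (u 0 z) (u 1 z))) (g.W s (g.q i (u 1 z) (u 2 z)))| ≤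
        2 * ((∑ i, ‖g.W s (g.q i (u 0 z) (u 1 z))‖) * ∑ i, ‖g.W s (g.q i (u 1 z) (u 2 z))‖) := by
      refine (Finset.abs_sum_le_sum_abs _ _).trans ?_
      rw [Finset.sum_mul, Finset.mul_sum]
      refine Finset.sum_le_sum fun i _ => ?_
      rw [abs_mul, abs_two]
      have := abs_real_inner_le_norm (g.W s (g.q i (u 0 z) (u 1 z))) (g.W s (g.q i (u 1 z) (u 2 z)))
      refine mul_le_mul_of_nonneg_left (this.trans ?_) (by norm_num)
      gcongr
      exact Finset.single_le_sum (f := fun i => ‖g.W s (g.q i (u 1 z) (u 2 z))‖)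
        (fun i _ => norm_nonneg _) (Finset.mem_univ i)
    rw [abs_mul, abs_two]
    unfold nn
    have b1 : 0 ≤ ‖g.W s (u 1 z)‖ * ∑ i, ‖g.W s (g.q i (u 1 z) (u 2 z))‖ := by positivity
    have b2 : 0 ≤ (∑ i, ‖g.W s (g.q i (u 0 z) (u 1 z))‖) * ‖g.W s (u 2 z)‖ := by positivity
    nlinarith
  refine hb.trans ?_
  have c1 := g.nn_step s (hu.rel 0 z)
  have c2 := g.nn_mono s (u 0 z) (u 1 z)
  have c3 := g.nn_le (s+1) (u 0 z) (u 1 z)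
  have c4 := CS_nonneg n K s
  calc 2 * (g.nn s (u 0 z) (u 1 z) * g.nn s (u 1 z) (u 2 z))
      ≤ 2 * (g.nn (s+1) (u 0 z) (u 1 z) * (CS n K s * g.nn (s+1) (u 0 z) (u 1 z))) := by
        gcongr
        · exact g.nn_nonneg _ _ _
        · exact g.nn_nonneg _ _ _
    _ = 2 * CS n K s * (g.nn (s+1) (u 0 z) (u 1 z))^2 := by ring
    _ ≤ 2 * CS n K s * (2 * (n+1) * g.en (s+1) (u 0 z) (u 1 z)) := by gcongr
    _ = _ := by ring

/-- sup constants -/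
def CE (n : ℕ) (K P : ℕ → ℝ) (s : ℕ) : ℝ := CI n K P s + 4 * (n+1) * CS n K s * CI n K P (s+1)

lemma CE_bound (g : GalOps n K X) (P : ℕ → ℝ) (ψ : X) (hP : ∀ s, ‖g.W s ψ‖ ≤ P s)
    {u : ℕ → ℝ → X} (hu : g.Traj u)
    (R : ℝ) (hR : 1 ≤ R) (h0 : u 0 0 = ψ) (hfl : g.flux (u 0 (-R)) (u 1 (-R)) = 0) (s : ℕ)
    (z : ℝ) (hz : z ∈ Set.Icc (-R) 0) : g.en s (u 0 z) (u 1 z) ≤ CE n K P s := by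
  have hc := fun s => en_cont (g := g) (hu.cont 0) (hu.cont 1) s
  set L := 4 * (n+1) * CS n K s with hL
  have hL0 : 0 ≤ L := by have := CS_nonneg n K s; positivity
  have hI := g.CI_bound P ψ hP hu R (by linarith) h0 hfl
  have hI0 := g.CI_nonneg P ψ hP hu R (by linarith) h0 hfl
  choose e' he' hb using fun z => g.en_deriv hu s z
  have hlip : ∀ a ∈ Set.Icc (-R) 0, ∀ b ∈ Set.Icc (-R) 0, a ≤ b →
      |g.en s (u 0 b) (u 1 b) - g.en s (u 0 a) (u 1 a)| ≤ L * CI n K P (s+1) := by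
    intro a ha b hb' hab
    have hle : ∫ w in a..b, L * g.en (s+1) (u 0 w) (u 1 w) ≤ L * CI n K P (s+1) := by
      rw [intervalIntegral.integral_const_mul]
      refine mul_le_mul_of_nonneg_left (le_trans ?_ (hI (s+1))) hL0
      exact intervalIntegral.integral_mono_interval ha.1 hab hb'.2
        (Filter.Eventually.of_forall fun z => g.en_nonneg _ _ _) ((hc (s+1)).intervalIntegrable _ _)
    have cont2 : Continuous fun w => L * g.en (s+1) (u 0 w) (u 1 w) := (hc (s+1)).const_mul L |>.congr (fun _ => rfl)
    have h1 : ‖g.en s (u 0 b) (u 1 b) - g.en s (u 0 a) (u 1 a)‖ ≤ ∫ w in a..b, L * g.en (s+1) (u 0 w) (u 1 w) := by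
      have hprim : ∀ x, HasDerivAt (fun x => ∫ w in a..x, L * g.en (s+1) (u 0 w) (u 1 w))
          (L * g.en (s+1) (u 0 x) (u 1 x)) x := fun x =>
        intervalIntegral.integral_hasDerivAt_right (cont2.intervalIntegrable _ _)
          (cont2.stronglyMeasurableAtFilter _ _) cont2.continuousAt
      have := image_norm_le_of_norm_deriv_right_le_deriv_boundary (a := a) (b := b)
        (f := fun x => g.en s (u 0 x) (u 1 x) - g.en s (u 0 a) (u 1 a)) (f' := e')
        (((hc s).sub continuous_const).continuousOn)
        (fun x _ => ((he' x).sub_const _).hasDerivWithinAt)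
        (B := fun x => ∫ w in a..x, L * g.en (s+1) (u 0 w) (u 1 w))
        (B' := fun x => L * g.en (s+1) (u 0 x) (u 1 x))
        (by simp) hprim (fun x _ => hb x)
      exact this ⟨hab, le_rfl⟩
    exact h1.trans hle
  have hall : ∀ w ∈ Set.Icc (-R) 0, g.en s (u 0 z) (u 1 z) - L * CI n K P (s+1) ≤ g.en s (u 0 w) (u 1 w) := by
    intro w hw
    rcases le_total w z with h | h
    · have := (abs_le.1 (hlip w hw z hz h)).2; linarith
    · have := (abs_le.1 (hlip z hz w hw h)).1; linarith
  have := intervalIntegral.integral_mono_on (μ := volume) (a := -R) (b := 0) (by linarith)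
    (continuous_const.intervalIntegrable _ _) ((hc s).intervalIntegrable _ _) hall
  rw [intervalIntegral.integral_const, smul_eq_mul] at this
  have h2 := hI s
  unfold CE
  rw [← hL]
  by_contra hcon
  push Not at hcon
  nlinarith [hI0 s]

/-- bounds for all derivatives -/
def CN (n : ℕ) (K P : ℕ → ℝ) : ℕ → ℕ → ℝ
  | 0, s => Real.sqrt (2 * (n+1) * CE n K P s)
  | j+1, s => CS n K s * CN n K P j (s+1)

lemma CN_bound (g : GalOps n K X) (P : ℕ → ℝ) (ψ : X) (hP : ∀ s, ‖g.W s ψ‖ ≤ P s)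
    {u : ℕ → ℝ → X} (hu : g.Traj u)
    (R : ℝ) (hR : 1 ≤ R) (h0 : u 0 0 = ψ) (hfl : g.flux (u 0 (-R)) (u 1 (-R)) = 0) (j s : ℕ)
    (z : ℝ) (hz : z ∈ Set.Icc (-R) 0) : g.nn s (u j z) (u (j+1) z) ≤ CN n K P j s := by
  induction j generalizing s with
  | zero =>
    apply Real.le_sqrt_of_sq_le
    refine (g.nn_le s _ _).trans ?_
    gcongr
    exact g.CE_bound P ψ hP hu R hR h0 hfl s z hz
  | succ j ih =>
    refine (g.nn_step s (hu.rel j z)).trans ?_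
    unfold CN
    have := CS_nonneg n K s
    gcongr
    exact ih _

lemma growth_bound [CompleteSpace X] (g : GalOps n K X) (P : ℕ → ℝ) (ψ : X) (hP : ∀ s, ‖g.W s ψ‖ ≤ P s)
    {u : ℕ → ℝ → X} (hu : g.Traj u)
    (R : ℝ) (hR : 1 ≤ R) (h0 : u 0 0 = ψ) (hfl : g.flux (u 0 (-R)) (u 1 (-R)) = 0) (s : ℕ)
    (z : ℝ) (hz : z ∈ Set.Icc (-R) 0) :
    ‖g.W s (u 0 z)‖ ≤ (P s + 1 + CI n K P s) * Real.sqrt (1 + |z|) := by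
  set r := Real.sqrt (1 + |z|) with hr
  have hr1 : 1 ≤ r := by
    rw [hr]; apply Real.le_sqrt_of_sq_le; have := abs_nonneg z; linarith
  have hrr : r * r = 1 + |z| := Real.mul_self_sqrt (by positivity)
  have hc := fun s => en_cont (g := g) (hu.cont 0) (hu.cont 1) s
  have hI := g.CI_bound P ψ hP hu R (by linarith) h0 hfl s
  have hI0 := g.CI_nonneg P ψ hP hu R (by linarith) h0 hfl s
  have hd : ∀ z, HasDerivAt (fun z => g.W s (u 0 z)) (g.W s (u 1 z)) z := fun z =>
    (g.W s).hasFDerivAt.comp_hasDerivAt z (hu.der 0 z)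
  have cont1 : Continuous fun z => g.W s (u 1 z) := (g.W s).continuous.comp (hu.cont 1)
  have h1 := intervalIntegral.integral_eq_sub_of_hasDerivAt (a := z) (b := 0)
      (fun z _ => hd z) (cont1.intervalIntegrable _ _)
  have h2 := intervalIntegral.norm_integral_le_integral_norm (μ := volume) (f := fun z => g.W s (u 1 z)) hz.2
  rw [h1, h0] at h2
  have h3 : ∫ w in z..0, ‖g.W s (u 1 w)‖ ≤ ∫ w in z..0, (r⁻¹ + r * g.en s (u 0 w) (u 1 w)) := by
    apply intervalIntegral.integral_mono_on hz.2 (cont1.norm.intervalIntegrable _ _)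
    · exact (continuous_const.add ((hc s).const_mul r)).intervalIntegrable _ _
    · intro w _
      have : ‖g.W s (u 1 w)‖^2 ≤ g.en s (u 0 w) (u 1 w) := by
        unfold en
        have : 0 ≤ ∑ i, ‖g.W s (g.q i (u 0 w) (u 1 w))‖^2 := by positivity
        linarith
      have hri : 0 < r⁻¹ := by positivity
      have e : r * r⁻¹ = 1 := by field_simp
      nlinarith [mul_nonneg (show 0 ≤ r by linarith) (sq_nonneg (‖g.W s (u 1 w)‖ - r⁻¹)),
        norm_nonneg (g.W s (u 1 w)), mul_le_mul_of_nonneg_left this (show 0 ≤ r by linarith)]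
  rw [intervalIntegral.integral_add (continuous_const.intervalIntegrable _ _)
    (((hc s).const_mul r).intervalIntegrable _ _), intervalIntegral.integral_const,
    intervalIntegral.integral_const_mul, smul_eq_mul] at h3
  have h4 : ∫ w in z..0, g.en s (u 0 w) (u 1 w) ≤ CI n K P s := by
    refine le_trans ?_ hI
    exact intervalIntegral.integral_mono_interval hz.1 hz.2 le_rfl
        (Filter.Eventually.of_forall fun z => g.en_nonneg _ _ _) ((hc s).intervalIntegrable _ _)
  have h5 : (0 - z) * r⁻¹ ≤ r := by
    rw [← div_eq_mul_inv, div_le_iff₀ (by linarith), hrr]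
    have := neg_abs_le z; linarith
  have h6 : ‖g.W s (u 0 z)‖ ≤ ‖g.W s ψ‖ + ‖g.W s ψ - g.W s (u 0 z)‖ := by
    have := norm_sub_le (g.W s ψ) (g.W s ψ - g.W s (u 0 z)); simpa using this
  have h7 := hP s
  have hP0 := (norm_nonneg _).trans (hP s)
  nlinarith

end GalOps

namespace Gal

/-- weight on ℤⁿ -/
def lam {n : ℕ} (k : Fin n → ℤ) : ℝ := 1 + ∑ i, |(k i : ℝ)|

variable {n : ℕ}

lemma one_le_lam (k : Fin n → ℤ) : 1 ≤ lam k := by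
  unfold lam; have : 0 ≤ ∑ i, |(k i : ℝ)| := by positivity
  linarith

lemma lam_pos (k : Fin n → ℤ) : 0 < lam k := lt_of_lt_of_le one_pos (one_le_lam k)

lemma abs_le_lam (k : Fin n → ℤ) (i : Fin n) : |(k i : ℝ)| ≤ lam k := by
  unfold lam
  have := Finset.single_le_sum (f := fun i => |(k i : ℝ)|) (fun i _ => abs_nonneg _) (Finset.mem_univ i)
  linarith

lemma lam_neg (k : Fin n → ℤ) : lam (-k) = lam k := by
  simp [lam]

lemma lam_add_le (k l : Fin n → ℤ) : lam (k + l) ≤ lam k + lam l - 1 := by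
  unfold lam
  have : ∑ i, |((k + l) i : ℝ)| ≤ ∑ i, |(k i : ℝ)| + ∑ i, |(l i : ℝ)| := by
    rw [← Finset.sum_add_distrib]
    refine Finset.sum_le_sum fun i _ => ?_
    simp only [Pi.add_apply, Int.cast_add]
    exact abs_add_le _ _
  linarith

lemma lam_le_mul (k l : Fin n → ℤ) : lam k ≤ lam (k - l) * lam l := by
  have h := lam_add_le (k - l) l
  rw [sub_add_cancel] at h
  nlinarith [one_le_lam (k-l), one_le_lam l]

lemma lam_sub_abs (k l : Fin n → ℤ) : |lam k - lam l| ≤ lam (k - l) := by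
  have h := lam_add_le (k - l) l
  have h2 := lam_add_le (l - k) k
  rw [sub_add_cancel] at h h2
  rw [← neg_sub k l, lam_neg] at h2
  rw [abs_le]; constructor <;> linarith

lemma pow_lam_sub (k l : Fin n → ℤ) (s : ℕ) :
    |lam k ^ (s+1) - lam l ^ (s+1)| ≤ (s+1) * (lam (k-l) ^ (s+1) * lam l ^ s) := by
  have hk := lam_pos k
  have hl := lam_pos l
  have hm := lam_pos (k-l)
  rw [← (Commute.all (lam k) (lam l)).mul_geom_sum₂ (s+1), abs_mul]
  have h2 : |∑ i ∈ Finset.range (s+1), lam k ^ i * lam l ^ (s + 1 - 1 - i)| ≤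
      (s+1) * (lam (k-l) ^ s * lam l ^ s) := by
    refine (Finset.abs_sum_le_sum_abs _ _).trans ?_
    have : ∀ i ∈ Finset.range (s+1), |lam k ^ i * lam l ^ (s + 1 - 1 - i)| ≤ lam (k-l) ^ s * lam l ^ s := by
      intro i hi
      have hi' : i ≤ s := by simpa [Nat.lt_succ_iff] using hi
      rw [abs_of_pos (by positivity), ← mul_pow]
      have a1 := lam_le_mul k l
      have a2 : lam l ≤ lam (k-l) * lam l := by nlinarith [one_le_lam (k-l)]
      calc lam k ^ i * lam l ^ (s + 1 - 1 - i) ≤ (lam (k-l) * lam l)^i * (lam (k-l) * lam l)^(s-i) := by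
            rw [Nat.add_sub_cancel]
            gcongr
        _ = _ := by rw [← pow_add]; congr 1; omega
    refine (Finset.sum_le_sum this).trans ?_
    simp
  calc |lam k - lam l| * |∑ i ∈ Finset.range (s+1), lam k ^ i * lam l ^ (s + 1 - 1 - i)|
      ≤ lam (k-l) * ((s+1) * (lam (k-l) ^ s * lam l ^ s)) := by
        gcongr; exact lam_sub_abs k l
    _ = _ := by ring

/-- data for the Fourier coefficients of `∂_i h` -/
structure FData (n : ℕ) where
  g : Fin n → (Fin n → ℤ) → ℂ
  sym : ∀ i k, g i (-k) = (starRingEnd ℂ) (g i k)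
  decay : ∀ i s, Summable fun k => lam k ^ s * ‖g i k‖

namespace FData

/-- weighted ℓ¹ norms -/
def S (F : FData n) (i : Fin n) (s : ℕ) : ℝ := ∑' k, lam k ^ s * ‖F.g i k‖

lemma S_nonneg (F : FData n) (i : Fin n) (s : ℕ) : 0 ≤ F.S i s :=
  tsum_nonneg fun k => by have := lam_pos k; positivity

/-- constants -/
def K (F : FData n) (s : ℕ) : ℝ := 2 * Real.pi + (s+1) * ∑ i, F.S i s

abbrev XB (B : Finset (Fin n → ℤ)) := EuclideanSpace ℂ ↥B

lemma norm_le_of_coord {B : Finset (Fin n → ℤ)} (x y : XB B) (c : ℝ) (hc : 0 ≤ c)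
    (h : ∀ k, ‖x k‖ ≤ c * ‖y k‖) : ‖x‖ ≤ c * ‖y‖ := by
  rw [EuclideanSpace.norm_eq, EuclideanSpace.norm_eq]
  apply Real.sqrt_le_iff.2
  refine ⟨by positivity, ?_⟩
  rw [mul_pow, Real.sq_sqrt (by positivity), Finset.mul_sum]
  refine Finset.sum_le_sum fun k _ => ?_
  rw [← mul_pow]
  exact pow_le_pow_left₀ (norm_nonneg _) (h k) 2

lemma schur {B : Finset (Fin n → ℤ)} (G : (Fin n → ℤ) → ℝ) (hG : Summable G) (hG0 : ∀ k, 0 ≤ G k)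
    (x y : XB B) (h : ∀ k : B, ‖x k‖ ≤ ∑ l : B, G (k.1 - l.1) * ‖y l‖) : ‖x‖ ≤ (∑' k, G k) * ‖y‖ := by
  have hS : 0 ≤ ∑' k, G k := tsum_nonneg hG0
  rw [EuclideanSpace.norm_eq, EuclideanSpace.norm_eq]
  apply Real.sqrt_le_iff.2
  refine ⟨by positivity, ?_⟩
  rw [mul_pow, Real.sq_sqrt (by positivity)]
  have r1 : ∀ k : B, ∑ l : B, G (k.1 - l.1) ≤ ∑' k, G k := by
    intro k
    rw [← Finset.sum_image (s := Finset.univ) (f := G) (g := fun l : B => k.1 - l.1)]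
    · exact hG.sum_le_tsum _ (fun _ _ => hG0 _)
    · intro a _ b _ hab
      exact Subtype.ext (sub_right_injective hab)
  have r2 : ∀ l : B, ∑ k : B, G (k.1 - l.1) ≤ ∑' k, G k := by
    intro k
    rw [← Finset.sum_image (s := Finset.univ) (f := G) (g := fun l : B => l.1 - k.1)]
    · exact hG.sum_le_tsum _ (fun _ _ => hG0 _)
    · intro a _ b _ hab
      exact Subtype.ext (sub_left_injective hab)
  have key : ∀ k : B, ‖x k‖^2 ≤ (∑' k, G k) * ∑ l : B, G (k.1 - l.1) * ‖y l‖^2 := by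
    intro k
    calc ‖x k‖^2 ≤ (∑ l : B, G (k.1 - l.1) * ‖y l‖)^2 := pow_le_pow_left₀ (norm_nonneg _) (h k) 2
      _ ≤ (∑ l : B, G (k.1 - l.1)) * ∑ l : B, G (k.1 - l.1) * ‖y l‖^2 := by
        apply Finset.sum_sq_le_sum_mul_sum_of_sq_le_mul
        · intro l _; exact hG0 _
        · intro l _; exact mul_nonneg (hG0 _) (by positivity)
        · intro l _; apply le_of_eq; ring
      _ ≤ _ := by
        have : 0 ≤ ∑ l : B, G (k.1 - l.1) * ‖y l‖^2 :=
          Finset.sum_nonneg fun l _ => mul_nonneg (hG0 _) (by positivity)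
        gcongr
        exact r1 k
  calc ∑ k, ‖x k‖^2 ≤ ∑ k : B, (∑' k, G k) * ∑ l : B, G (k.1 - l.1) * ‖y l‖^2 :=
        Finset.sum_le_sum fun k _ => key k
    _ = (∑' k, G k) * ∑ l : B, (∑ k : B, G (k.1 - l.1)) * ‖y l‖^2 := by
        rw [← Finset.mul_sum, Finset.sum_comm]
        simp only [Finset.sum_mul]
    _ ≤ (∑' k, G k) * ∑ l : B, (∑' k, G k) * ‖y l‖^2 := by
        gcongr with l _
        exact r2 l
    _ = _ := by rw [← Finset.mul_sum]; ring

/-- matrix operator -/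
def matOp {B : Finset (Fin n → ℤ)} (A : B → B → ℂ) : XB B →L[ℝ] XB B :=
  LinearMap.toContinuousLinearMap
    { toFun := fun v => WithLp.toLp 2 (fun k => ∑ l, A k l * v l)
      map_add' := by
        intro a b; ext k; simp [mul_add, Finset.sum_add_distrib]
      map_smul' := by
        intro c a; ext k
        simp only [PiLp.smul_apply, RingHom.id_apply, Finset.smul_sum, mul_smul_comm] }

lemma matOp_apply {B : Finset (Fin n → ℤ)} (A : B → B → ℂ) (v : XB B) (k : B) :
    matOp A v k = ∑ l, A k l * v l := rfl

/-- diagonal operator -/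
def diagOp {B : Finset (Fin n → ℤ)} (A : B → ℂ) : XB B →L[ℝ] XB B :=
  LinearMap.toContinuousLinearMap
    { toFun := fun v => WithLp.toLp 2 (fun k => A k * v k)
      map_add' := by
        intro a b; ext k; simp [mul_add]
      map_smul' := by
        intro c a; ext k
        simp only [PiLp.smul_apply, RingHom.id_apply, mul_smul_comm] }

lemma diagOp_apply {B : Finset (Fin n → ℤ)} (A : B → ℂ) (v : XB B) (k : B) :
    diagOp A v k = A k * v k := rfl

lemma inner_def {B : Finset (Fin n → ℤ)} (v w : XB B) :
    inner ℝ v w = ∑ k, ((starRingEnd ℂ) (v k) * w k).re := by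
  rw [PiLp.inner_apply]
  refine Finset.sum_congr rfl fun k _ => ?_
  rw [Complex.inner, mul_comm]

/-- The Galerkin operators -/
def ops (F : FData n) (B : Finset (Fin n → ℤ)) : GalOps n F.K (XB B) where
  H i := matOp fun k l => F.g i (k.1 - l.1)
  D i := diagOp fun k => 2 * Real.pi * Complex.I * (k.1 i : ℂ)
  W s := diagOp fun k => ((lam k.1 ^ s : ℝ) : ℂ)
  H_symm := by
    intro i v w
    simp only [inner_def, matOp_apply, map_sum, map_mul, Finset.sum_mul, Finset.mul_sum, Complex.re_sum]
    rw [Finset.sum_comm]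
    refine Finset.sum_congr rfl fun l _ => Finset.sum_congr rfl fun k _ => ?_
    rw [← F.sym i, neg_sub]
    congr 1; ring
  D_skew := by
    intro i v w
    simp only [inner_def, diagOp_apply, map_mul, Complex.conj_I, Complex.conj_ofReal, map_intCast, map_ofNat]
    rw [← Finset.sum_neg_distrib]
    refine Finset.sum_congr rfl fun l _ => ?_
    rw [← Complex.neg_re]
    congr 1; ring
  W_symm := by
    intro s v w
    simp only [inner_def, diagOp_apply, map_mul, Complex.conj_ofReal]
    refine Finset.sum_congr rfl fun l _ => ?_
    congr 1; ring
  W_D := by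
    intro s i v
    ext k
    simp only [diagOp_apply]; ring
  W_zero := by
    intro v; ext k
    simp [diagOp_apply]
  W_le := by
    intro s v
    rw [← one_mul ‖(diagOp fun k : B => ((lam k.1 ^ (s+1) : ℝ) : ℂ)) v‖]
    apply norm_le_of_coord _ _ _ zero_le_one
    intro k
    simp only [diagOp_apply, norm_mul, Complex.norm_real, Real.norm_eq_abs]
    have := lam_pos k.1
    have h1 := one_le_lam k.1
    rw [abs_of_pos (by positivity), abs_of_pos (by positivity), one_mul]
    gcongr
    omega
  D_le := by
    intro s i v
    have hK : 2 * Real.pi ≤ F.K 0 := by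
      unfold K
      have : 0 ≤ ∑ i, F.S i 0 := Finset.sum_nonneg fun i _ => F.S_nonneg i 0
      simp; exact this
    have hpi := Real.pi_pos
    refine (norm_le_of_coord _ ((diagOp fun k : B => ((lam k.1 ^ (s+1) : ℝ) : ℂ)) v) (2 * Real.pi) (by positivity) ?_).trans ?_
    · intro k
      simp only [diagOp_apply, norm_mul, Complex.norm_real, Real.norm_eq_abs, Complex.norm_I,
        Complex.norm_intCast, Complex.norm_ofNat, mul_one]
      have := lam_pos k.1
      have h1 := abs_le_lam k.1 i
      rw [abs_of_pos (by positivity), abs_of_pos hpi, abs_of_pos (show 0 < lam k.1 ^ (s+1) by positivity)]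
      calc lam k.1 ^ s * (2 * Real.pi * |(k.1 i : ℝ)| * ‖v k‖)
          ≤ lam k.1 ^ s * (2 * Real.pi * lam k.1 * ‖v k‖) := by gcongr
        _ = _ := by ring
    · gcongr
  H_le := by
    intro i v
    have hK : F.S i 0 ≤ F.K 0 := by
      unfold K
      have := Finset.single_le_sum (f := fun i => F.S i 0) (fun i _ => F.S_nonneg i 0) (Finset.mem_univ i)
      have hpi := Real.pi_pos
      simp; linarith
    have hd := F.decay i 0
    simp only [pow_zero, one_mul] at hd
    refine (schur (fun k => ‖F.g i k‖) hd (fun _ => norm_nonneg _) _ v ?_).trans ?_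
    · intro k
      rw [matOp_apply]
      refine (norm_sum_le _ _).trans (le_of_eq ?_)
      simp
    · gcongr
      simpa [S] using hK
  comm := by
    intro s i v
    have hK : (s+1) * F.S i (s+1) ≤ F.K (s+1) := by
      unfold K
      have := Finset.single_le_sum (f := fun i => F.S i (s+1)) (fun i _ => F.S_nonneg i (s+1)) (Finset.mem_univ i)
      have hpi := Real.pi_pos
      have h0 := F.S_nonneg i (s+1)
      push_cast
      nlinarith
    have hd := (F.decay i (s+1)).mul_left ((s:ℝ)+1)
    refine (schur (fun k => ((s:ℝ)+1) * (lam k ^ (s+1) * ‖F.g i k‖)) hd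
      (fun k => by have := lam_pos k; positivity) _ ((diagOp fun k : B => ((lam k.1 ^ s : ℝ) : ℂ)) v) ?_).trans ?_
    · intro k
      simp only [PiLp.sub_apply, matOp_apply, diagOp_apply, Finset.mul_sum]
      rw [← Finset.sum_sub_distrib]
      refine (norm_sum_le _ _).trans (Finset.sum_le_sum fun l _ => ?_)
      have e : ((lam k.1 ^ (s+1) : ℝ) : ℂ) * (F.g i (k.1 - l.1) * v l) -
          F.g i (k.1 - l.1) * (((lam l.1 ^ (s+1) : ℝ) : ℂ) * v l) =
          ((lam k.1 ^ (s+1) - lam l.1 ^ (s+1) : ℝ) : ℂ) * (F.g i (k.1 - l.1) * v l) := by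
        push_cast; ring
      rw [e, norm_mul, norm_mul, norm_mul, Complex.norm_real, Complex.norm_real, Real.norm_eq_abs, Real.norm_eq_abs]
      have := lam_pos l.1
      rw [abs_of_pos (show 0 < lam l.1 ^ s by positivity)]
      calc |lam k.1 ^ (s+1) - lam l.1 ^ (s+1)| * (‖F.g i (k.1 - l.1)‖ * ‖v l‖)
          ≤ ((s+1) * (lam (k.1-l.1) ^ (s+1) * lam l.1 ^ s)) * (‖F.g i (k.1 - l.1)‖ * ‖v l‖) := by
            gcongr; exact pow_lam_sub k.1 l.1 s
        _ = _ := by ring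
    · rw [tsum_mul_left]
      gcongr
      exact hK

end FData
end Gal

namespace Gal

variable {n : ℕ}

/-- convolution on ℤⁿ -/
def conv (g b : (Fin n → ℤ) → ℂ) (k : Fin n → ℤ) : ℂ := ∑' l, g (k - l) * b l

/-- extension by zero -/
def zext {B : Finset (Fin n → ℤ)} (v : EuclideanSpace ℂ ↥B) (k : Fin n → ℤ) : ℂ :=
  if hk : k ∈ B then v ⟨k, hk⟩ else 0

lemma zext_mem {B : Finset (Fin n → ℤ)} (v : EuclideanSpace ℂ ↥B) (k : B) : zext v k.1 = v k := by
  unfold zext; rw [dif_pos k.2]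

lemma zext_mem' {B : Finset (Fin n → ℤ)} (v : EuclideanSpace ℂ ↥B) {k : Fin n → ℤ} (hk : k ∈ B) :
    zext v k = v ⟨k, hk⟩ := by
  unfold zext; rw [dif_pos hk]

lemma zext_not_mem {B : Finset (Fin n → ℤ)} (v : EuclideanSpace ℂ ↥B) {k : Fin n → ℤ} (hk : k ∉ B) :
    zext v k = 0 := by
  unfold zext; rw [dif_neg hk]

lemma conv_zext {B : Finset (Fin n → ℤ)} (g : (Fin n → ℤ) → ℂ) (v : EuclideanSpace ℂ ↥B) (k : Fin n → ℤ) :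
    conv g (zext v) k = ∑ l : B, g (k - l.1) * v l := by
  unfold conv
  rw [tsum_eq_sum (s := B)]
  · rw [← Finset.sum_coe_sort B (fun l => g (k - l) * zext v l)]
    refine Finset.sum_congr rfl fun l _ => ?_
    rw [zext_mem]
  · intro l hl
    rw [zext_not_mem v hl, mul_zero]

lemma conv_summable {g : (Fin n → ℤ) → ℂ} (hg : Summable fun k => ‖g k‖) {b : (Fin n → ℤ) → ℂ} {C : ℝ}
    (hb : ∀ l, ‖b l‖ ≤ C) (k : Fin n → ℤ) : Summable fun l => ‖g (k - l) * b l‖ := by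
  have h1 : Summable fun l => ‖g (k - l)‖ * C := by
    apply Summable.mul_right
    exact (Equiv.subLeft k).summable_iff.2 hg
  refine Summable.of_nonneg_of_le (fun _ => norm_nonneg _) (fun l => ?_) h1
  rw [norm_mul]; gcongr; exact hb l

lemma conv_bound {g : (Fin n → ℤ) → ℂ} (hg : Summable fun k => ‖g k‖) {b : (Fin n → ℤ) → ℂ} {C : ℝ}
    (hb : ∀ l, ‖b l‖ ≤ C) (k : Fin n → ℤ) : ‖conv g b k‖ ≤ (∑' k, ‖g k‖) * C := by
  have h0 := conv_summable hg hb k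
  refine (norm_tsum_le_tsum_norm h0).trans ?_
  have hs : Summable fun l => ‖g (k - l)‖ := (Equiv.subLeft k).summable_iff.2 hg
  have h1 : Summable fun l => ‖g (k - l)‖ * C := hs.mul_right _
  refine (h0.tsum_le_tsum (fun l => ?_) h1).trans (le_of_eq ?_)
  · rw [norm_mul]; gcongr; exact hb l
  · rw [tsum_mul_right]
    congr 1
    exact (Equiv.subLeft k).tsum_eq (fun l => ‖g l‖)

lemma conv_tendsto {ι : Type*} {L : Filter ι} {g : (Fin n → ℤ) → ℂ} (hg : Summable fun k => ‖g k‖)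
    {b : ι → (Fin n → ℤ) → ℂ} {β : (Fin n → ℤ) → ℂ} {C : ℝ} (hb : ∀ᶠ N in L, ∀ l, ‖b N l‖ ≤ C)
    (hl : ∀ l, Filter.Tendsto (fun N => b N l) L (nhds (β l))) (k : Fin n → ℤ) :
    Filter.Tendsto (fun N => conv g (b N) k) L (nhds (conv g β k)) := by
  unfold conv
  have hs : Summable fun l => ‖g (k - l)‖ * C := by
    apply Summable.mul_right
    exact (Equiv.subLeft k).summable_iff.2 hg
  apply tendsto_tsum_of_dominated_convergence hs
  · intro l; exact (hl l).const_mul _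
  · filter_upwards [hb] with N hN l
    rw [norm_mul]; gcongr; exact hN l

lemma taylor2 {Y : Type*} [NormedAddCommGroup Y] [NormedSpace ℝ Y] {f f' f'' : ℝ → Y} {a b C : ℝ}
    (h1 : ∀ z, HasDerivAt f (f' z) z) (h2 : ∀ z, HasDerivAt f' (f'' z) z)
    (hC : ∀ z ∈ Set.Icc a b, ‖f'' z‖ ≤ C) {z w : ℝ} (hz : z ∈ Set.Icc a b) (hw : w ∈ Set.Icc a b) :
    ‖f z - f w - (z - w) • f' w‖ ≤ C * (z - w)^2 := by
  have hC0 : 0 ≤ C := (norm_nonneg _).trans (hC z hz)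
  have s1 : Set.uIcc w z ⊆ Set.Icc a b := Set.uIcc_subset_Icc hw hz
  have e1 : ∀ y ∈ Set.uIcc w z, ‖f' y - f' w‖ ≤ C * |z - w| := by
    intro y hy
    have := (convex_Icc a b).norm_image_sub_le_of_norm_hasDerivWithin_le
      (fun x _ => (h2 x).hasDerivWithinAt) hC hw (s1 hy)
    refine this.trans ?_
    gcongr
    rw [Real.norm_eq_abs]
    exact Set.abs_sub_left_of_mem_uIcc hy
  have := (convex_uIcc w z).norm_image_sub_le_of_norm_hasDerivWithin_le
      (f := fun x => f x - x • f' w) (f' := fun x => f' x - (1:ℝ) • f' w)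
      (fun x _ => ((h1 x).sub ((hasDerivAt_id x).smul_const (f' w))).hasDerivWithinAt)
      (C := C * |z - w|) (fun x hx => by simpa using e1 x hx) Set.left_mem_uIcc Set.right_mem_uIcc
  have e2 : f z - z • f' w - (f w - w • f' w) = f z - f w - (z - w) • f' w := by
    rw [sub_smul]; abel
  rw [e2, Real.norm_eq_abs] at this
  calc _ ≤ _ := this
    _ = C * |z-w|^2 := by ring
    _ = _ := by rw [sq_abs]

lemma hasDerivWithinAt_of_sq {Y : Type*} [NormedAddCommGroup Y] [NormedSpace ℝ Y] {f : ℝ → Y} {f' : Y}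
    {s : Set ℝ} {w C : ℝ} (h : ∀ z ∈ s, ‖f z - f w - (z - w) • f'‖ ≤ C * (z - w)^2) :
    HasDerivWithinAt f f' s w := by
  rw [hasDerivWithinAt_iff_isLittleO]
  have h1 : (fun z => f z - f w - (z - w) • f') =O[nhdsWithin w s] fun z => (z - w)^2 := by
    refine Asymptotics.IsBigO.of_bound C ?_
    filter_upwards [self_mem_nhdsWithin] with z hz
    rw [norm_pow, Real.norm_eq_abs, sq_abs]
    exact h z hz
  refine h1.trans_isLittleO ?_
  have h2 : (fun z : ℝ => (z - w)^2) =o[nhds w] fun z => z - w := by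
    have : Filter.Tendsto (fun z : ℝ => z - w) (nhds w) (nhds 0) := by
      have : Continuous fun z : ℝ => z - w := by fun_prop
      have := this.tendsto w
      simpa only [sub_self] using this
    have h3 := (Asymptotics.isLittleO_pow_id (𝕜 := ℝ) (n := 2) (by norm_num)).comp_tendsto this
    exact h3
  exact h2.mono nhdsWithin_le_nhds

/-- the ultrafilter -/
abbrev 𝓤 : Ultrafilter ℕ := Filter.hyperfilter ℕ

lemma exists_ulim {Y : Type*} [NormedAddCommGroup Y] [ProperSpace Y] {x : ℕ → Y} {C : ℝ}
    (h : ∀ᶠ N in (𝓤 : Filter ℕ), ‖x N‖ ≤ C) : ∃ l, Filter.Tendsto x 𝓤 (nhds l) := by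
  have hc := isCompact_closedBall (0:Y) C
  obtain ⟨l, _, hl⟩ := (isCompact_iff_ultrafilter_le_nhds.1 hc) (𝓤.map x) (by
    rw [Ultrafilter.coe_map, Filter.le_principal_iff, Filter.mem_map]
    filter_upwards [h] with N hN
    simpa using hN)
  exact ⟨l, hl⟩

lemma ev_of_atTop {p : ℕ → Prop} (h : ∀ᶠ N in Filter.atTop, p N) : ∀ᶠ N in (𝓤 : Filter ℕ), p N := by
  have : (𝓤 : Filter ℕ) ≤ Filter.atTop := by
    rw [← Nat.cofinite_eq_atTop]; exact Filter.hyperfilter_le_cofinite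
  exact this h

/-- exhausting boxes -/
def box (n N : ℕ) : Finset (Fin n → ℤ) := Fintype.piFinset fun _ => Finset.Icc (-(N:ℤ)) N

lemma ev_mem_box (k : Fin n → ℤ) : ∀ᶠ N in (𝓤 : Filter ℕ), k ∈ box n N := by
  apply ev_of_atTop
  have : ∀ i, ∀ᶠ N : ℕ in Filter.atTop, k i ∈ Finset.Icc (-(N:ℤ)) N := by
    intro i
    filter_upwards [Filter.eventually_ge_atTop (k i).natAbs] with N hN
    rw [Finset.mem_Icc]; omega
  filter_upwards [Filter.eventually_all.2 this] with N hN
  exact Fintype.mem_piFinset.2 hN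

lemma ev_mem_Icc {z : ℝ} (hz : z ≤ 0) : ∀ᶠ N : ℕ in (𝓤 : Filter ℕ), z ∈ Set.Icc (-((N:ℝ)+1)) 0 := by
  apply ev_of_atTop
  obtain ⟨M, hM⟩ := exists_nat_ge (-z)
  filter_upwards [Filter.eventually_ge_atTop M] with N hN
  have : (M:ℝ) ≤ N := by exact_mod_cast hN
  constructor <;> linarith

lemma norm_le_sum {B : Finset (Fin n → ℤ)} (x : EuclideanSpace ℂ ↥B) : ‖x‖ ≤ ∑ k, ‖x k‖ := by
  rw [EuclideanSpace.norm_eq]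
  apply Real.sqrt_le_iff.2
  exact ⟨by positivity, Finset.sum_sq_le_sq_sum_of_nonneg fun _ _ => norm_nonneg _⟩

lemma zext_le {B : Finset (Fin n → ℤ)} (F : FData n) (v : EuclideanSpace ℂ ↥B) (s : ℕ) (k : Fin n → ℤ) :
    lam k ^ s * ‖zext v k‖ ≤ ‖(F.ops B).W s v‖ := by
  have hl := lam_pos k
  by_cases hk : k ∈ B
  · rw [zext_mem' v hk]
    have := PiLp.norm_apply_le ((F.ops B).W s v) ⟨k, hk⟩
    refine le_trans (le_of_eq ?_) this
    change _ = ‖((lam k ^ s : ℝ) : ℂ) * v ⟨k, hk⟩‖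
    rw [norm_mul, Complex.norm_real, Real.norm_eq_abs, abs_of_pos (by positivity)]
  · rw [zext_not_mem v hk]; simp

end Gal

namespace Gal

variable {n : ℕ}

/-- symbol of the derivative -/
def dsym (i : Fin n) (k : Fin n → ℤ) : ℂ := 2 * Real.pi * Complex.I * (k i : ℂ)

lemma dsym_norm (i : Fin n) (k : Fin n → ℤ) : ‖dsym i k‖ ≤ 2 * Real.pi * lam k := by
  have hpi := Real.pi_pos
  simp only [dsym, norm_mul, Complex.norm_real, Real.norm_eq_abs, Complex.norm_I,
        Complex.norm_intCast, Complex.norm_ofNat, mul_one, abs_of_pos hpi]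
  gcongr
  exact abs_le_lam k i

/-- coefficients of the limit solution -/
structure LimSol (F : FData n) (c : (Fin n → ℤ) → ℂ) (a : ℕ → ℝ → (Fin n → ℤ) → ℂ)
    (C : ℕ → ℕ → ℝ) (E : ℕ → ℝ → ℝ) : Prop where
  b0 : ∀ s k z, z ≤ 0 → lam k ^ s * ‖a 0 z k‖ ≤ C 0 s * Real.sqrt (1 + |z|)
  b1 : ∀ j s k z, z ≤ 0 → lam k ^ s * ‖a (j+1) z k‖ ≤ C (j+1) s
  der : ∀ j k z, z ≤ 0 → HasDerivWithinAt (fun z => a j z k) (a (j+1) z k) (Set.Iic 0) z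
  ini : ∀ k, a 0 0 k = c k
  eqn : ∀ k z, z ≤ 0 → a 2 z k + ∑ i, conv (F.g i) (conv (F.g i) (a 2 z)) k =
    ∑ i, (conv (F.g i) (fun k => dsym i k * a 1 z k) k -
      dsym i k * (dsym i k * a 0 z k - conv (F.g i) (a 1 z) k))
  E_int : ∀ s, IntegrableOn (E s) (Set.Iic 0)
  E_nonneg : ∀ s z, z ≤ 0 → 0 ≤ E s z
  E_bdd : ∀ s, ∃ D, ∀ z, z ≤ 0 → E s z ≤ D
  E1 : ∀ s k z, z ≤ 0 → (lam k ^ s * ‖a 1 z k‖)^2 ≤ E s z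
  E2 : ∀ s i k z, z ≤ 0 → (lam k ^ s * ‖dsym i k * a 0 z k - conv (F.g i) (a 1 z) k‖)^2 ≤ E s z

lemma energy_limit {e e' : ℕ → ℝ → ℝ} {L C D : ℝ} (hd : ∀ N z, HasDerivAt (e N) (e' N z) z)
    (he' : ∀ N : ℕ, ∀ z ∈ Set.Icc (-((N:ℝ)+1)) 0, |e' N z| ≤ L) (h0 : ∀ N z, 0 ≤ e N z)
    (hD : ∀ N : ℕ, ∀ z ∈ Set.Icc (-((N:ℝ)+1)) 0, e N z ≤ D)
    (hI : ∀ N : ℕ, ∫ z in (-((N:ℝ)+1))..0, e N z ≤ C) :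
    ∃ E : ℝ → ℝ, IntegrableOn E (Set.Iic 0) ∧
      ∀ z ≤ 0, Filter.Tendsto (fun N => e N z) 𝓤 (nhds (E z)) := by
  have hc : ∀ N, Continuous (e N) := fun N =>
    continuous_iff_continuousAt.2 fun z => (hd N z).continuousAt
  have hlim : ∀ z : ℝ, ∃ l, z ≤ 0 → Filter.Tendsto (fun N => e N z) 𝓤 (nhds l) := by
    intro z
    by_cases hz : z ≤ 0
    · obtain ⟨l, hl⟩ := exists_ulim (x := fun N => e N z) (C := D) (by
        filter_upwards [ev_mem_Icc hz] with N hN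
        rw [Real.norm_eq_abs, abs_of_nonneg (h0 N z)]; exact hD N z hN)
      exact ⟨l, fun _ => hl⟩
    · exact ⟨0, fun h => absurd h hz⟩
  choose E hE using hlim
  have hFle : ∀ z ≤ 0, ∀ᶠ N : ℕ in (𝓤 : Filter ℕ), 0 ≤ ∫ w in z..0, e N w ∧ ∫ w in z..0, e N w ≤ C := by
    intro z hz
    filter_upwards [ev_mem_Icc hz] with N hN
    refine ⟨intervalIntegral.integral_nonneg hz fun w _ => h0 N w, le_trans ?_ (hI N)⟩
    exact intervalIntegral.integral_mono_interval hN.1 hN.2 le_rfl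
        (Filter.Eventually.of_forall fun z => h0 N z) ((hc N).intervalIntegrable _ _)
  have hlimF : ∀ z : ℝ, ∃ l, z ≤ 0 → Filter.Tendsto (fun N => ∫ w in z..0, e N w) 𝓤 (nhds l) := by
    intro z
    by_cases hz : z ≤ 0
    · obtain ⟨l, hl⟩ := exists_ulim (x := fun N => ∫ w in z..0, e N w) (C := C) (by
        filter_upwards [hFle z hz] with N hN
        rw [Real.norm_eq_abs, abs_of_nonneg hN.1]; exact hN.2)
      exact ⟨l, fun _ => hl⟩
    · exact ⟨0, fun h => absurd h hz⟩
  choose Φ hΦ using hlimF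
  have hE0 : ∀ z ≤ 0, 0 ≤ E z := fun z hz => ge_of_tendsto' (hE z hz) fun N => h0 N z
  have hΦle : ∀ z ≤ 0, Φ z ≤ C := fun z hz =>
    le_of_tendsto (hΦ z hz) ((hFle z hz).mono fun N hN => hN.2)
  have hΦ0 : Φ 0 = 0 := tendsto_nhds_unique (hΦ 0 le_rfl) (by simp)
  have hlip : ∀ z ≤ 0, ∀ w ≤ 0, ‖E z - E w‖ ≤ L * ‖z - w‖ := by
    intro z hz w hw
    have ht := ((hE z hz).sub (hE w hw)).norm
    refine le_of_tendsto ht ?_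
    filter_upwards [ev_mem_Icc hz, ev_mem_Icc hw] with N hN hN2
    exact (convex_Icc _ _).norm_image_sub_le_of_norm_hasDerivWithin_le
      (fun x _ => (hd N x).hasDerivWithinAt) (he' N) hN2 hN
  have hcont : ContinuousOn E (Set.Iic 0) := by
    have hL : 0 ≤ L := (abs_nonneg _).trans (he' 0 0 (by constructor <;> norm_num))
    have : LipschitzOnWith ⟨L, hL⟩ E (Set.Iic 0) := by
      apply LipschitzOnWith.of_dist_le_mul
      intro z hz w hw
      rw [dist_eq_norm, dist_eq_norm]
      exact hlip z hz w hw
    exact this.continuousOn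
  have hder : ∀ z ≤ 0, HasDerivWithinAt Φ (-E z) (Set.Iic 0) z := by
    intro w hw
    apply hasDerivWithinAt_of_sq (C := L)
    intro z hz
    have ht := (((hΦ z hz).sub (hΦ w hw)).sub (((hE w hw).neg).const_smul (z - w))).norm
    refine le_of_tendsto ht ?_
    filter_upwards [ev_mem_Icc hz, ev_mem_Icc hw] with N hN hN2
    refine taylor2 (f := fun z => ∫ w in z..0, e N w) (f' := fun z => - e N z) (f'' := fun z => - e' N z)
      (fun z => ?_) (fun z => (hd N z).neg) (fun z hz => by
        rw [norm_neg]; exact he' N z hz) hN hN2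
    exact intervalIntegral.integral_hasDerivAt_left ((hc N).intervalIntegrable _ _)
          ((hc N).stronglyMeasurableAtFilter _ _) (hc N).continuousAt
  refine ⟨E, ?_, fun z hz => hE z hz⟩
  have hInt : ∀ m ≤ (0:ℝ), IntervalIntegrable E volume m 0 := by
    intro m hm
    apply ContinuousOn.intervalIntegrable
    refine hcont.mono ?_
    rw [Set.uIcc_of_le hm]; exact fun x hx => hx.2
  refine integrableOn_Iic_of_intervalIntegral_norm_bounded (l := Filter.atTop) (a := fun m : ℕ => -(m:ℝ)) C 0 ?_
    (Filter.tendsto_neg_atTop_atBot.comp tendsto_natCast_atTop_atTop) ?_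
  · intro m
    have hm : -(m:ℝ) ≤ 0 := by simp
    exact (intervalIntegrable_iff_integrableOn_Ioc_of_le hm).1 (hInt _ hm)
  · refine Filter.Eventually.of_forall fun m => ?_
    have hm : -(m:ℝ) ≤ 0 := by simp
    have e1 : ∫ x in (-(m:ℝ))..0, ‖E x‖ = ∫ x in (-(m:ℝ))..0, E x := by
      apply intervalIntegral.integral_congr
      intro x hx
      rw [Set.uIcc_of_le hm] at hx
      simp only [Real.norm_eq_abs]
      exact abs_of_nonneg (hE0 x hx.2)
    have e2 := intervalIntegral.integral_eq_sub_of_hasDerivAt_of_le (a := -(m:ℝ)) (b := 0) (f := Φ) (f' := fun x => - E x) hm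
      (fun x hx => ((hder x hx.2).continuousWithinAt).mono (fun y hy => hy.2))
      (fun x hx => (hder x hx.2.le).hasDerivAt (Iic_mem_nhds hx.2)) (hInt _ hm).neg
    rw [intervalIntegral.integral_neg] at e2
    rw [e1]
    have := hΦle _ hm
    linarith

end Gal

namespace Gal

variable {n : ℕ}

lemma ops_H_apply (F : FData n) (B : Finset (Fin n → ℤ)) (i : Fin n) (v : EuclideanSpace ℂ ↥B) {k : Fin n → ℤ} (hk : k ∈ B) :
    zext ((F.ops B).H i v) k = conv (F.g i) (zext v) k := by
  rw [conv_zext, zext_mem' _ hk]; rfl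

lemma ops_D_apply (F : FData n) (B : Finset (Fin n → ℤ)) (i : Fin n) (v : EuclideanSpace ℂ ↥B) (k : Fin n → ℤ) :
    zext ((F.ops B).D i v) k = dsym i k * zext v k := by
  by_cases hk : k ∈ B
  · rw [zext_mem' _ hk, zext_mem' _ hk]; rfl
  · rw [zext_not_mem _ hk, zext_not_mem _ hk, mul_zero]

lemma zext_add {B : Finset (Fin n → ℤ)} (v w : EuclideanSpace ℂ ↥B) (k : Fin n → ℤ) :
    zext (v + w) k = zext v k + zext w k := by
  by_cases hk : k ∈ B
  · simp only [zext_mem' _ hk]; rfl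
  · simp only [zext_not_mem _ hk, add_zero]

lemma zext_sub {B : Finset (Fin n → ℤ)} (v w : EuclideanSpace ℂ ↥B) (k : Fin n → ℤ) :
    zext (v - w) k = zext v k - zext w k := by
  by_cases hk : k ∈ B
  · simp only [zext_mem' _ hk]; rfl
  · simp only [zext_not_mem _ hk, sub_zero]

lemma zext_sum {B : Finset (Fin n → ℤ)} {ι : Type*} (s : Finset ι) (v : ι → EuclideanSpace ℂ ↥B) (k : Fin n → ℤ) :
    zext (∑ i ∈ s, v i) k = ∑ i ∈ s, zext (v i) k := by
  induction s using Finset.induction_on with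
  | empty => simp only [Finset.sum_empty]; unfold zext; split_ifs <;> rfl
  | insert a s ha ih => rw [Finset.sum_insert ha, Finset.sum_insert ha, zext_add, ih]

lemma zext_hasDerivAt {B : Finset (Fin n → ℤ)} {f : ℝ → EuclideanSpace ℂ ↥B} {f' : EuclideanSpace ℂ ↥B} {z : ℝ}
    (h : HasDerivAt f f' z) (k : Fin n → ℤ) : HasDerivAt (fun z => zext (f z) k) (zext f' k) z := by
  by_cases hk : k ∈ B
  · simp only [zext_mem' _ hk]
    exact (((EuclideanSpace.proj (⟨k, hk⟩ : B) : EuclideanSpace ℂ ↥B →L[ℂ] ℂ).restrictScalars ℝ)).hasFDerivAt.comp_hasDerivAt z h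
  · simp only [zext_not_mem _ hk]; exact hasDerivAt_const _ _

lemma en_ge1 (F : FData n) (B : Finset (Fin n → ℤ)) (s : ℕ) (v w : EuclideanSpace ℂ ↥B) (k : Fin n → ℤ) :
    (lam k ^ s * ‖zext w k‖) ^ 2 ≤ (F.ops B).en s v w := by
  have h1 := pow_le_pow_left₀ (by have := lam_pos k; positivity) (zext_le F w s k) 2
  refine h1.trans ?_
  unfold GalOps.en
  exact le_add_of_nonneg_right (Finset.sum_nonneg fun i _ => sq_nonneg _)

lemma en_ge2 (F : FData n) (B : Finset (Fin n → ℤ)) (s : ℕ) (i : Fin n) (v w : EuclideanSpace ℂ ↥B) (k : Fin n → ℤ) :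
    (lam k ^ s * ‖zext ((F.ops B).q i v w) k‖) ^ 2 ≤ (F.ops B).en s v w := by
  have h1 := pow_le_pow_left₀ (by have := lam_pos k; positivity) (zext_le F ((F.ops B).q i v w) s k) 2
  refine h1.trans ?_
  unfold GalOps.en
  have := Finset.single_le_sum (f := fun i => ‖(F.ops B).W s ((F.ops B).q i v w)‖^2)
      (fun i _ => sq_nonneg _) (Finset.mem_univ i)
  exact this.trans (le_add_of_nonneg_left (sq_nonneg _))

lemma rel_zext (F : FData n) (B : Finset (Fin n → ℤ)) {u : ℕ → ℝ → EuclideanSpace ℂ ↥B} (hu : (F.ops B).Traj u) (z : ℝ) (k : Fin n → ℤ) :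
    zext (u 2 z) k + ∑ i, zext ((F.ops B).H i ((F.ops B).H i (u 2 z))) k =
    ∑ i, (zext ((F.ops B).H i ((F.ops B).D i (u 1 z))) k - dsym i k * zext ((F.ops B).q i (u 0 z) (u 1 z)) k) := by
  have hrel := hu.rel 0 z
  unfold GalOps.Rel GalOps.M GalOps.rhs at hrel
  have := congrArg (fun v => zext v k) hrel
  simp only [zext_add, zext_sum, zext_sub] at this
  simp only [ops_D_apply F _ _ ((F.ops B).q _ _ _)] at this
  exact this

set_option maxHeartbeats 2000000 in
theorem exists_limsol (F : FData n) (c : (Fin n → ℤ) → ℂ) (hc : ∀ s : ℕ, Summable fun k => lam k ^ s * ‖c k‖) :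
    ∃ a C E, LimSol F c a C E := by
  set P : ℕ → ℝ := fun s => ∑' k, lam k ^ s * ‖c k‖ with hPdef
  set K := F.K
  let g := fun N : ℕ => F.ops (box n N)
  let ψ : ∀ N : ℕ, EuclideanSpace ℂ ↥(box n N) := fun N => WithLp.toLp 2 fun k => c k.1
  have hP : ∀ N s, ‖(g N).W s (ψ N)‖ ≤ P s := by
    intro N s
    refine (norm_le_sum _).trans ?_
    have e : ∀ k : box n N, ‖((g N).W s (ψ N)) k‖ = lam k.1 ^ s * ‖c k.1‖ := by
      intro k
      change ‖((lam k.1 ^ s : ℝ) : ℂ) * c k.1‖ = _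
      have := lam_pos k.1
      rw [norm_mul, Complex.norm_real, Real.norm_eq_abs, abs_of_pos (by positivity)]
    simp only [e]
    rw [Finset.sum_coe_sort (box n N) (fun k => lam k ^ s * ‖c k‖)]
    exact (hc s).sum_le_tsum _ fun k _ => by have := lam_pos k; positivity
  have hbvp := fun N : ℕ => (g N).exists_bvp (ψ N) ((N:ℝ)+1) (by positivity)
  choose u hu hu0 hufl using hbvp
  have hR : ∀ N : ℕ, (1:ℝ) ≤ (N:ℝ)+1 := fun N => by simp
  have hCN := fun N j s z hz => (g N).CN_bound P (ψ N) (hP N) (hu N) ((N:ℝ)+1) (hR N) (hu0 N) (hufl N) j s z hz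
  have hgr := fun N s z hz => (g N).growth_bound P (ψ N) (hP N) (hu N) ((N:ℝ)+1) (hR N) (hu0 N) (hufl N) s z hz
  have hCE := fun N s z hz => (g N).CE_bound P (ψ N) (hP N) (hu N) ((N:ℝ)+1) (hR N) (hu0 N) (hufl N) s z hz
  have hCI := fun (N : ℕ) s => (g N).CI_bound P (ψ N) (hP N) (hu N) ((N:ℝ)+1) (by positivity) (hu0 N) (hufl N) s
  let C : ℕ → ℕ → ℝ := fun j s => if j = 0 then P s + 1 + GalOps.CI n K P s else GalOps.CN n K P (j-1) s
  have B0 : ∀ N : ℕ, ∀ s k, ∀ z ∈ Set.Icc (-((N:ℝ)+1)) 0, lam k ^ s * ‖zext (u N 0 z) k‖ ≤ C 0 s * Real.sqrt (1 + |z|) := by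
    intro N s k z hz
    exact (zext_le F _ s k).trans (hgr N s z hz)
  have B1 : ∀ N : ℕ, ∀ j s k, ∀ z ∈ Set.Icc (-((N:ℝ)+1)) 0, lam k ^ s * ‖zext (u N (j+1) z) k‖ ≤ C (j+1) s := by
    intro N j s k z hz
    refine (zext_le F _ s k).trans (le_trans ?_ (hCN N j s z hz))
    unfold GalOps.nn
    have : 0 ≤ ∑ i, ‖(g N).W s ((g N).q i (u N j z) (u N (j+1) z))‖ := by positivity
    linarith
  -- limits of coefficients
  have hlim : ∀ j (z : ℝ) k, ∃ l, z ≤ 0 → Filter.Tendsto (fun N => zext (u N j z) k) 𝓤 (nhds l) := by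
    intro j z k
    by_cases hz : z ≤ 0
    · cases j with
      | zero =>
        obtain ⟨l, hl⟩ := exists_ulim (x := fun N => zext (u N 0 z) k) (C := C 0 0 * Real.sqrt (1 + |z|)) (by
          filter_upwards [ev_mem_Icc hz] with N hN
          simpa using B0 N 0 k z hN)
        exact ⟨l, fun _ => hl⟩
      | succ j =>
        obtain ⟨l, hl⟩ := exists_ulim (x := fun N => zext (u N (j+1) z) k) (C := C (j+1) 0) (by
          filter_upwards [ev_mem_Icc hz] with N hN
          simpa using B1 N j 0 k z hN)
        exact ⟨l, fun _ => hl⟩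
    · exact ⟨0, fun h => absurd h hz⟩
  choose a ha using hlim
  -- energies
  have hE : ∀ s, ∃ E : ℝ → ℝ, IntegrableOn E (Set.Iic 0) ∧
      ∀ z ≤ 0, Filter.Tendsto (fun N => (g N).en s (u N 0 z) (u N 1 z)) 𝓤 (nhds (E z)) := by
    intro s
    choose e' he' hb using fun N z => (g N).en_deriv (hu N) s z
    refine energy_limit (e' := e') (L := 4 * (n+1) * GalOps.CS n K s * GalOps.CE n K P (s+1)) he' ?_
      (fun N z => (g N).en_nonneg _ _ _) (fun N z hz => hCE N s z hz) (fun N => hCI N s)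
    intro N z hz
    refine (hb N z).trans ?_
    have := GalOps.CS_nonneg n K s
    gcongr
    exact hCE N (s+1) z hz
  choose E hEint hElim using hE
  have hg0 : ∀ i, Summable fun k => ‖F.g i k‖ := fun i => by simpa using F.decay i 0
  -- limit of conv
  have hconv1 : ∀ j i k (z : ℝ), z ≤ 0 → Filter.Tendsto (fun N => conv (F.g i) (zext (u N (j+1) z)) k) 𝓤
      (nhds (conv (F.g i) (a (j+1) z) k)) := by
    intro j i k z hz
    apply conv_tendsto (C := C (j+1) 0) (hg0 i)
    · filter_upwards [ev_mem_Icc hz] with N hN l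
      simpa using B1 N j 0 l z hN
    · intro l; exact ha _ z l hz
  have hq : ∀ i k (z : ℝ), z ≤ 0 → Filter.Tendsto (fun N => zext ((g N).q i (u N 0 z) (u N 1 z)) k) 𝓤
      (nhds (dsym i k * a 0 z k - conv (F.g i) (a 1 z) k)) := by
    intro i k z hz
    have h1 := ((ha 0 z k hz).const_mul (dsym i k)).sub (hconv1 0 i k z hz)
    refine h1.congr' ?_
    filter_upwards [ev_mem_box k] with N hN
    unfold GalOps.q
    rw [zext_sub, ops_D_apply, ops_H_apply F _ i _ hN]
  refine ⟨a, C, E, ?_, ?_, ?_, ?_, ?_, hEint, ?_, ?_, ?_, ?_⟩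
  · intro s k z hz
    refine le_of_tendsto ((ha 0 z k hz).norm.const_mul _) ?_
    filter_upwards [ev_mem_Icc hz] with N hN
    exact B0 N s k z hN
  · intro j s k z hz
    refine le_of_tendsto ((ha (j+1) z k hz).norm.const_mul _) ?_
    filter_upwards [ev_mem_Icc hz] with N hN
    exact B1 N j s k z hN
  · intro j k w hw
    apply hasDerivWithinAt_of_sq (C := C (j+2) 0)
    intro z hz
    have ht := (((ha j z k hz).sub (ha j w k hw)).sub ((ha (j+1) w k hw).const_smul (z - w))).norm
    refine le_of_tendsto ht ?_
    filter_upwards [ev_mem_Icc hz, ev_mem_Icc hw] with N hN hN2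
    exact taylor2 (fun z => zext_hasDerivAt ((hu N).der j z) k) (fun z => zext_hasDerivAt ((hu N).der (j+1) z) k)
      (fun z hz => by simpa using B1 N (j+1) 0 k z hz) hN hN2
  · intro k
    refine tendsto_nhds_unique (ha 0 0 k le_rfl) ?_
    refine tendsto_const_nhds.congr' ?_
    filter_upwards [ev_mem_box k] with N hN
    rw [hu0 N, zext_mem' _ hN]
  · intro k z hz
    have hHH : ∀ i, Filter.Tendsto (fun N => zext ((g N).H i ((g N).H i (u N 2 z))) k) 𝓤
        (nhds (conv (F.g i) (conv (F.g i) (a 2 z)) k)) := by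
      intro i
      have h1 : Filter.Tendsto (fun N => conv (F.g i) (zext ((g N).H i (u N 2 z))) k) 𝓤
          (nhds (conv (F.g i) (conv (F.g i) (a 2 z)) k)) := by
        apply conv_tendsto (C := (∑' k, ‖F.g i k‖) * C 2 0) (hg0 i)
        · filter_upwards [ev_mem_Icc hz] with N hN l
          have hb : ∀ l, ‖zext (u N 2 z) l‖ ≤ C 2 0 := fun l => by simpa using B1 N 1 0 l z hN
          by_cases hl : l ∈ box n N
          · rw [ops_H_apply F _ i _ hl]
            exact conv_bound (hg0 i) hb l
          · rw [zext_not_mem _ hl, norm_zero]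
            have : 0 ≤ C 2 0 := (norm_nonneg _).trans (hb 0)
            have : 0 ≤ ∑' k, ‖F.g i k‖ := tsum_nonneg fun _ => norm_nonneg _
            positivity
        · intro l
          refine (hconv1 1 i l z hz).congr' ?_
          filter_upwards [ev_mem_box l] with N hN
          rw [ops_H_apply F _ i _ hN]
      refine h1.congr' ?_
      filter_upwards [ev_mem_box k] with N hN
      rw [ops_H_apply F _ i _ hN]
    have hHD : ∀ i, Filter.Tendsto (fun N => zext ((g N).H i ((g N).D i (u N 1 z))) k) 𝓤
        (nhds (conv (F.g i) (fun k => dsym i k * a 1 z k) k)) := by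
      intro i
      have h1 : Filter.Tendsto (fun N => conv (F.g i) (zext ((g N).D i (u N 1 z))) k) 𝓤
          (nhds (conv (F.g i) (fun k => dsym i k * a 1 z k) k)) := by
        apply conv_tendsto (C := 2 * Real.pi * C 1 1) (hg0 i)
        · filter_upwards [ev_mem_Icc hz] with N hN l
          rw [ops_D_apply, norm_mul]
          have h1 := B1 N 0 1 l z hN
          have h2 := dsym_norm i l
          have hpi := Real.pi_pos
          calc ‖dsym i l‖ * ‖zext (u N 1 z) l‖ ≤ 2 * Real.pi * lam l * ‖zext (u N 1 z) l‖ := by gcongr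
            _ = 2 * Real.pi * (lam l ^ 1 * ‖zext (u N 1 z) l‖) := by ring
            _ ≤ _ := by gcongr
        · intro l
          refine ((ha 1 z l hz).const_mul (dsym i l)).congr ?_
          intro N
          rw [ops_D_apply]
      refine h1.congr' ?_
      filter_upwards [ev_mem_box k] with N hN
      rw [ops_H_apply F _ i _ hN]
    have hL := (ha 2 z k hz).add (tendsto_finsetSum Finset.univ fun i _ => hHH i)
    have hRt := tendsto_finsetSum Finset.univ fun i (_ : i ∈ Finset.univ) => (hHD i).sub ((hq i k z hz).const_mul (dsym i k))
    refine tendsto_nhds_unique hL (hRt.congr ?_)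
    intro N
    exact (rel_zext F _ (hu N) z k).symm
  · intro s z hz
    exact ge_of_tendsto' (hElim s z hz) fun N => (g N).en_nonneg _ _ _
  · intro s
    refine ⟨GalOps.CE n K P s, fun z hz => le_of_tendsto (hElim s z hz) ?_⟩
    filter_upwards [ev_mem_Icc hz] with N hN
    exact hCE N s z hN
  · intro s k z hz
    refine le_of_tendsto_of_tendsto' (((ha 1 z k hz).norm.const_mul (lam k ^ s)).pow 2) (hElim s z hz) ?_
    intro N
    exact en_ge1 F _ s _ _ k
  · intro s i k z hz
    refine le_of_tendsto_of_tendsto' (((hq i k z hz).norm.const_mul (lam k ^ s)).pow 2) (hElim s z hz) ?_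
    intro N
    exact en_ge2 F _ s i _ _ k

end Gal

namespace Gal

variable {n : ℕ}

/-- summability of negative powers of the weight -/
lemma summable_lam : Summable fun k : Fin n → ℤ => (lam k ^ (2 * n))⁻¹ := by
  let f : ℤ → ℝ := fun m => ((1 + |(m:ℝ)|)^2)⁻¹
  have hf0 : ∀ m, 0 ≤ f m := fun m => by positivity
  have hf : Summable f := by
    have h1 : Summable fun m : ℤ => 1 / |(m:ℝ)| ^ (2:ℝ) := (Real.summable_one_div_int_add_rpow 0 2).2 (by norm_num) |>.congr (by intro m; simp)
    refine Summable.of_norm_bounded_eventually (g := fun m : ℤ => 1 / |(m:ℝ)| ^ (2:ℝ)) h1 ?_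
    refine (Set.finite_singleton (0:ℤ)).subset ?_
    intro m hm
    by_contra h0
    apply hm
    have : 0 < |(m:ℝ)| := abs_pos.2 (by exact_mod_cast h0)
    change ‖f m‖ ≤ 1 / |(m:ℝ)| ^ (2:ℝ)
    rw [Real.norm_eq_abs, abs_of_nonneg (hf0 m), one_div, Real.rpow_two]
    apply inv_anti₀ (by positivity)
    gcongr; linarith
  have hp : Summable fun k : Fin n → ℤ => ∏ i, f (k i) := by
    refine summable_of_sum_le (c := ∏ _i : Fin n, ∑' m, f m) (fun k => Finset.prod_nonneg fun i _ => hf0 _) ?_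
    intro u
    let s : Finset ℤ := u.biUnion fun k => Finset.univ.image k
    have hu : u ⊆ Fintype.piFinset fun _ => s := by
      intro k hk
      rw [Fintype.mem_piFinset]
      intro i
      exact Finset.mem_biUnion.2 ⟨k, hk, Finset.mem_image.2 ⟨i, Finset.mem_univ _, rfl⟩⟩
    refine (Finset.sum_le_sum_of_subset_of_nonneg hu fun k _ _ => Finset.prod_nonneg fun i _ => hf0 _).trans ?_
    rw [← Finset.prod_univ_sum (fun _ => s) (fun _ m => f m)]
    exact Finset.prod_le_prod (fun i _ => Finset.sum_nonneg fun m _ => hf0 m) fun i _ => hf.sum_le_tsum _ fun m _ => hf0 m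
  refine hp.of_nonneg_of_le (fun k => by have := lam_pos k; positivity) fun k => ?_
  simp only [f, Finset.prod_inv_distrib]
  apply inv_anti₀ (Finset.prod_pos fun i _ => by positivity)
  rw [pow_mul]
  calc ∏ i, (1 + |(k i:ℝ)|)^2 ≤ ∏ _i : Fin n, lam k ^ 2 := by
        refine Finset.prod_le_prod (fun i _ => by positivity) fun i _ => ?_
        have : 1 + |(k i:ℝ)| ≤ lam k := by
          unfold lam
          have := Finset.single_le_sum (f := fun i => |(k i : ℝ)|) (fun i _ => abs_nonneg _) (Finset.mem_univ i)
          linarith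
        gcongr
    _ = _ := by rw [Finset.prod_const]; simp

/-- integration by parts on the cell -/
lemma ibp {E : Type*} [NormedAddCommGroup E] [NormedSpace ℝ E] [CompleteSpace E]
    {F : (Fin n → ℝ) → E} (hF : ContDiff ℝ 1 F)
    (hper : ∀ x (k : Fin n → ℤ), F (x + fun i => (k i : ℝ)) = F x) (i : Fin n) :
    ∫ x in cell n, fderiv ℝ F x (Pi.single i 1) = 0 := by
  obtain _ | m := n
  · exact i.elim0
  have hc : cell (m+1) =ᵐ[volume] Set.Icc (0 : Fin (m+1) → ℝ) 1 :=
    Measure.univ_pi_Ico_ae_eq_Icc (f := (0 : Fin (m+1) → ℝ)) (g := 1)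
  rw [setIntegral_congr_set hc]
  have hcd : Continuous fun x => fderiv ℝ F x := hF.continuous_fderiv (by norm_num)
  have key := integral_divergence_of_hasFDerivAt_off_countable' (0 : Fin (m+1) → ℝ) 1 (fun _ => zero_le_one)
    (fun j => if j = i then F else 0) (fun j x => if j = i then fderiv ℝ F x else 0) ∅ Set.countable_empty
    (by intro j; split_ifs
        · exact hF.continuous.continuousOn
        · exact continuousOn_const)
    (by intro x _ j; split_ifs
        · exact (hF.differentiable (by norm_num) x).hasFDerivAt
        · exact hasFDerivAt_const _ _)
    (by
      apply Continuous.integrableOn_Icc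
      apply continuous_finsetSum
      intro j _
      split_ifs
      · exact hcd.clm_apply continuous_const
      · simp only [zero_apply]; exact continuous_const)
  have e1 : ∀ x, ∑ j, (if j = i then fderiv ℝ F x else 0) (Pi.single j 1) = fderiv ℝ F x (Pi.single i 1) := by
    intro x
    rw [Finset.sum_eq_single i]
    · simp
    · intro j _ hj; simp [hj]
    · simp
  simp only [e1] at key
  rw [key]
  apply Finset.sum_eq_zero
  intro j _
  by_cases hj : j = i
  · simp only [hj, if_true]
    rw [sub_eq_zero]
    congr 1
    ext x
    have := hper (i.insertNth 0 x) (Pi.single i 1)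
    simp only [Pi.zero_apply, Pi.one_apply]
    rw [← this]
    congr 1
    ext l
    refine Fin.succAboveCases i ?_ (fun l => ?_) l
    · simp
    · simp [Fin.succAbove_ne]
  · simp [hj]

/-- characters -/
def ek (k : Fin n → ℤ) (x : Fin n → ℝ) : ℂ := Complex.exp (∑ i, dsym i k * (x i : ℂ))

lemma dsym_add (i : Fin n) (k l : Fin n → ℤ) : dsym i (k + l) = dsym i k + dsym i l := by
  simp [dsym]; ring

lemma ek_add (k l : Fin n → ℤ) (x : Fin n → ℝ) : ek (k + l) x = ek k x * ek l x := by
  simp only [ek, dsym_add, add_mul, Finset.sum_add_distrib, Complex.exp_add]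

lemma ek_norm (k : Fin n → ℤ) (x : Fin n → ℝ) : ‖ek k x‖ = 1 := by
  have : ∑ i, dsym i k * (x i : ℂ) = ((∑ i, 2 * Real.pi * k i * x i : ℝ) : ℂ) * Complex.I := by
    simp only [dsym]; push_cast; rw [Finset.sum_mul]; congr 1; ext i; ring
  rw [ek, this, Complex.norm_exp_ofReal_mul_I]

lemma ek_zero (x : Fin n → ℝ) : ek (0 : Fin n → ℤ) x = 1 := by simp [ek, dsym]

lemma ek_per (k l : Fin n → ℤ) (x : Fin n → ℝ) : ek k (x + fun i => (l i : ℝ)) = ek k x := by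
  have h : ∑ i, dsym i k * ((x i + l i : ℝ) : ℂ) = ∑ i, dsym i k * (x i : ℂ) + ((∑ i, k i * l i : ℤ) : ℂ) * (2 * Real.pi * Complex.I) := by
    simp only [dsym]; push_cast; rw [Finset.sum_mul, ← Finset.sum_add_distrib]; congr 1; ext i; ring
  simp only [ek, Pi.add_apply]
  rw [h, Complex.exp_add, Complex.exp_int_mul_two_pi_mul_I, mul_one]

lemma ek_hasFDerivAt (k : Fin n → ℤ) (x : Fin n → ℝ) :
    HasFDerivAt (ek k) (∑ i, (dsym i k * ek k x) • (Complex.ofRealCLM.comp (ContinuousLinearMap.proj i : (Fin n → ℝ) →L[ℝ] ℝ))) x := by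
  have h : HasFDerivAt (fun x : Fin n → ℝ => ∑ i, dsym i k * (x i : ℂ))
      (∑ i, (dsym i k) • (Complex.ofRealCLM.comp (ContinuousLinearMap.proj i : (Fin n → ℝ) →L[ℝ] ℝ))) x := by
    apply HasFDerivAt.fun_sum
    intro i _
    exact ((Complex.ofRealCLM.comp (ContinuousLinearMap.proj i : (Fin n → ℝ) →L[ℝ] ℝ)).hasFDerivAt).const_mul (dsym i k)
  have := h.cexp
  refine this.congr_fderiv ?_
  rw [Finset.smul_sum]
  congr 1; ext i : 1
  rw [smul_smul, mul_comm]; rfl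

lemma ek_contDiff (k : Fin n → ℤ) : ContDiff ℝ (⊤:ℕ∞) (ek k) := by
  unfold ek
  apply ContDiff.cexp
  apply ContDiff.sum
  intro i _
  apply contDiff_const.mul
  exact (Complex.ofRealCLM.comp (ContinuousLinearMap.proj i : (Fin n → ℝ) →L[ℝ] ℝ)).contDiff

end Gal

namespace Gal

variable {n : ℕ}

lemma pdX_per {f : (Fin n → ℝ) → ℝ} (hf : ZPeriodic n f) (i : Fin n) : ZPeriodic n (pdX n f i) := by
  intro x k
  unfold pdX
  have : f = fun x => f (x + fun i => (k i : ℝ)) := by ext y; exact (hf y k).symm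
  conv_rhs => rw [this]
  rw [fderiv_comp_add_right]

lemma pdX_smooth {f : (Fin n → ℝ) → ℝ} (hf : ContDiff ℝ (⊤:ℕ∞) f) (i : Fin n) : ContDiff ℝ (⊤:ℕ∞) (pdX n f i) := by
  unfold pdX
  exact (hf.fderiv_right (m := (⊤:ℕ∞)) (by simp)).clm_apply contDiff_const

/-- reduction to the cell -/
lemma exists_cell (x : Fin n → ℝ) : ∃ k : Fin n → ℤ, (x + fun i => (k i : ℝ)) ∈ cell n := by
  refine ⟨fun i => -⌊x i⌋, ?_⟩
  intro i _
  simp only [Pi.add_apply, Int.cast_neg, Set.mem_Ico]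
  have h1 := Int.floor_le (x i)
  have h2 := Int.lt_floor_add_one (x i)
  constructor <;> linarith

lemma cell_subset : cell n ⊆ Set.Icc (0 : Fin n → ℝ) 1 := by
  intro x hx
  exact ⟨fun i => (hx i trivial).1, fun i => (hx i trivial).2.le⟩

lemma per_bdd {f : (Fin n → ℝ) → ℝ} (hc : Continuous f) (hf : ZPeriodic n f) : ∃ C, ∀ x, |f x| ≤ C := by
  obtain ⟨C, hC⟩ := (isCompact_Icc (a := (0 : Fin n → ℝ)) (b := 1)).exists_bound_of_continuousOn hc.continuousOn
  refine ⟨C, fun x => ?_⟩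
  obtain ⟨k, hk⟩ := exists_cell x
  rw [← hf x k]
  exact hC _ (cell_subset hk)

/-- Fourier coefficients -/
def cf (f : (Fin n → ℝ) → ℝ) (k : Fin n → ℤ) : ℂ := ∫ x in cell n, ek (-k) x * (f x : ℂ)

lemma vol_cell : volume (cell n) = 1 := by
  unfold cell
  rw [volume_pi_pi]; simp

lemma ek_neg (k : Fin n → ℤ) (x : Fin n → ℝ) : ek (-k) x = (starRingEnd ℂ) (ek k x) := by
  unfold ek
  rw [← Complex.exp_conj, map_sum]
  congr 1
  congr 1; ext i
  rw [map_mul, Complex.conj_ofReal]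
  congr 1
  simp only [dsym, map_mul, Complex.conj_ofReal, Complex.conj_I, map_ofNat, map_intCast, Pi.neg_apply, Int.cast_neg]
  ring

lemma dsym_neg (i : Fin n) (k : Fin n → ℤ) : dsym i (-k) = - dsym i k := by simp [dsym]

lemma cf_neg (f : (Fin n → ℝ) → ℝ) (k : Fin n → ℤ) : cf f (-k) = (starRingEnd ℂ) (cf f k) := by
  unfold cf
  rw [← integral_conj]
  congr 1; ext x
  rw [map_mul, ← ek_neg, Complex.conj_ofReal]

lemma cf_bound {f : (Fin n → ℝ) → ℝ} {C : ℝ} (hC : ∀ x, |f x| ≤ C) (k : Fin n → ℤ) : ‖cf f k‖ ≤ C := by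
  unfold cf
  have := norm_setIntegral_le_of_norm_le_const (μ := volume) (s := cell n) (C := C) (f := fun x => ek (-k) x * (f x : ℂ)) (by rw [vol_cell]; simp)
    (fun x _ => by rw [norm_mul, ek_norm, one_mul, Complex.norm_real]; exact hC x)
  simpa [Measure.real, vol_cell] using this

lemma measurableSet_cell : MeasurableSet (cell n) := MeasurableSet.univ_pi fun _ => measurableSet_Ico

lemma integrableOn_cell {E : Type*} [NormedAddCommGroup E] {f : (Fin n → ℝ) → E} (hf : Continuous f) :
    IntegrableOn f (cell n) :=
  (hf.integrableOn_Icc (a := 0) (b := 1)).mono_set cell_subset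

lemma cf_pd {f : (Fin n → ℝ) → ℝ} (hf : ContDiff ℝ (⊤:ℕ∞) f) (hp : ZPeriodic n f) (i : Fin n) (k : Fin n → ℤ) :
    cf (pdX n f i) k = dsym i k * cf f k := by
  have hfc : ContDiff ℝ (⊤:ℕ∞) fun x => (f x : ℂ) := Complex.ofRealCLM.contDiff.comp hf
  have h := ibp (F := fun x => ek (-k) x * (f x : ℂ)) (((ek_contDiff (-k)).mul hfc).of_le (by simp)) (by
    intro x l
    simp only [ek_per, hp x l]) i
  have e : ∀ x, fderiv ℝ (fun x => ek (-k) x * (f x : ℂ)) x (Pi.single i 1) =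
      ek (-k) x * (pdX n f i x : ℂ) - dsym i k * (ek (-k) x * (f x : ℂ)) := by
    intro x
    have h1 := ek_hasFDerivAt (-k) x
    have h2 : HasFDerivAt (fun x => (f x : ℂ)) (Complex.ofRealCLM.comp (fderiv ℝ f x)) x :=
      Complex.ofRealCLM.hasFDerivAt.comp x (hf.differentiable (by simp) x).hasFDerivAt
    rw [(h1.fun_mul h2).fderiv]
    simp only [add_apply, smul_apply, ContinuousLinearMap.comp_apply, Complex.ofRealCLM_apply,
      sum_apply, ContinuousLinearMap.proj_apply, smul_eq_mul, pdX]
    rw [Finset.sum_eq_single i]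
    · simp [dsym_neg]; ring
    · intro j _ hj; simp [hj]
    · simp
  simp only [e] at h
  rw [integral_sub, sub_eq_zero, integral_const_mul] at h
  · exact h
  · apply integrableOn_cell
    exact (ek_contDiff _).continuous.mul (Complex.continuous_ofReal.comp (pdX_smooth hf i).continuous)
  · apply integrableOn_cell
    exact continuous_const.mul ((ek_contDiff _).continuous.mul hfc.continuous)

lemma cf_decay (s : ℕ) : ∀ {f : (Fin n → ℝ) → ℝ}, ContDiff ℝ (⊤:ℕ∞) f → ZPeriodic n f →
    ∃ C, ∀ k, lam k ^ s * ‖cf f k‖ ≤ C := by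
  induction s with
  | zero =>
    intro f hf hp
    obtain ⟨C, hC⟩ := per_bdd hf.continuous hp
    exact ⟨C, fun k => by simpa using cf_bound hC k⟩
  | succ s ih =>
    intro f hf hp
    obtain ⟨C, hC⟩ := ih hf hp
    choose D hD using fun i => ih (pdX_smooth hf i) (pdX_per hp i)
    refine ⟨C + ∑ i, D i, fun k => ?_⟩
    have hl := lam_pos k
    have h1 : ∀ i, |(k i : ℝ)| * ‖cf f k‖ ≤ ‖cf (pdX n f i) k‖ := by
      intro i
      rw [cf_pd hf hp, norm_mul]
      gcongr
      simp only [dsym, norm_mul, Complex.norm_real, Real.norm_eq_abs, Complex.norm_I,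
        Complex.norm_intCast, Complex.norm_ofNat, mul_one, abs_of_pos Real.pi_pos]
      have := Real.pi_gt_three
      have h0 := abs_nonneg (k i : ℝ)
      nlinarith
    calc lam k ^ (s+1) * ‖cf f k‖ = lam k ^ s * ‖cf f k‖ + ∑ i, lam k ^ s * (|(k i : ℝ)| * ‖cf f k‖) := by
          rw [← Finset.mul_sum, ← Finset.sum_mul, pow_succ]
          nth_rewrite 2 [lam]
          ring
      _ ≤ C + ∑ i, D i := by
          gcongr with i
          · exact hC k
          · exact (mul_le_mul_of_nonneg_left (h1 i) (by positivity)).trans (hD i k)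

/-- polynomial bounds imply summability -/
lemma summable_of_bound {c : (Fin n → ℤ) → ℂ} {C : ℝ} (s : ℕ) (h : ∀ k, lam k ^ (s + 2 * n) * ‖c k‖ ≤ C) :
    Summable fun k => lam k ^ s * ‖c k‖ := by
  refine (summable_lam.mul_left C).of_nonneg_of_le (fun k => by have := lam_pos k; positivity) fun k => ?_
  have := lam_pos k
  have h2 := h k
  rw [pow_add] at h2
  rw [← div_eq_mul_inv, le_div_iff₀ (by positivity)]
  linarith

lemma cf_summable {f : (Fin n → ℝ) → ℝ} (hf : ContDiff ℝ (⊤:ℕ∞) f) (hp : ZPeriodic n f) (s : ℕ) :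
    Summable fun k => lam k ^ s * ‖cf f k‖ := by
  obtain ⟨C, hC⟩ := cf_decay (s + 2*n) hf hp
  exact summable_of_bound s hC

lemma mFourier_ek (k : Fin n → ℤ) (x : Fin n → ℝ) :
    UnitAddTorus.mFourier k (fun i => (x i : UnitAddCircle)) = ek k x := by
  change ∏ i, fourier (k i) (x i : UnitAddCircle) = _
  unfold ek
  rw [Complex.exp_sum]
  congr 1; ext i
  rw [fourier_coe_apply]
  simp [dsym]

lemma cf_hasSum {f : (Fin n → ℝ) → ℝ} (hf : ContDiff ℝ (⊤:ℕ∞) f) (hp : ZPeriodic n f) (x : Fin n → ℝ) :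
    HasSum (fun k => cf f k * ek k x) (f x : ℂ) := by
  let π : C((Fin n → ℝ), UnitAddTorus (Fin n)) := ⟨fun x i => (x i : UnitAddCircle), by
    apply continuous_pi; intro i
    exact (AddCircle.continuous_mk' 1).comp (continuous_apply i)⟩
  have hπ : IsOpenQuotientMap π := IsOpenQuotientMap.piMap fun i => QuotientAddGroup.isOpenQuotientMap_mk
  have hfac : ∀ a b, π a = π b → (f a : ℂ) = f b := by
    intro a b hab
    have : ∀ i, ∃ m : ℤ, b i - a i = m := by
      intro i
      have := congrFun hab i
      change ((a i : ℝ) : UnitAddCircle) = (b i : UnitAddCircle) at this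
      rw [QuotientAddGroup.eq] at this
      obtain ⟨m, hm⟩ := AddSubgroup.mem_zmultiples_iff.1 this
      exact ⟨m, by simp at hm; linarith⟩
    choose m hm using this
    have e : b = a + fun i => (m i : ℝ) := by ext i; simp [← hm i]
    rw [e, hp a m]
  let F : C(UnitAddTorus (Fin n), ℂ) := hπ.isQuotientMap.lift ⟨fun x => (f x : ℂ), Complex.continuous_ofReal.comp hf.continuous⟩ (fun a b hab => hfac a b hab)
  have hF : ∀ x, F (π x) = f x := by
    intro x
    exact congrArg (fun g => g x) (hπ.isQuotientMap.lift_comp ⟨fun x => (f x : ℂ), Complex.continuous_ofReal.comp hf.continuous⟩ (fun a b hab => hfac a b hab))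
  have hcf : ∀ k, UnitAddTorus.mFourierCoeff F k = cf f k := by
    intro k
    rw [UnitAddTorus.mFourierCoeff_eq_integral F k 0]
    unfold cf
    have hs : {x : Fin n → ℝ | ∀ i, x i ∈ Set.Ioc ((0 : Fin n → ℝ) i) ((0 : Fin n → ℝ) i + 1)} =ᵐ[volume] cell n := by
      have h1 : {x : Fin n → ℝ | ∀ i, x i ∈ Set.Ioc ((0 : Fin n → ℝ) i) ((0 : Fin n → ℝ) i + 1)} = Set.univ.pi fun i => Set.Ioc ((0 : Fin n → ℝ) i) ((1 : Fin n → ℝ) i) := by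
        ext x; simp [Set.mem_pi]
      rw [h1]
      exact (Measure.univ_pi_Ioc_ae_eq_Icc (f := (0 : Fin n → ℝ)) (g := 1)).trans
        (Measure.univ_pi_Ico_ae_eq_Icc (f := (0 : Fin n → ℝ)) (g := 1)).symm
    rw [setIntegral_congr_set hs]
    congr 1; ext x
    rw [mFourier_ek, smul_eq_mul]
    exact congrArg _ (hF x)
  have hsum : Summable (UnitAddTorus.mFourierCoeff F) := by
    apply Summable.of_norm
    simp only [hcf]
    simpa using cf_summable hf hp 0
  have := UnitAddTorus.hasSum_mFourier_series_apply_of_summable hsum (π x)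
  simp only [hcf, hF] at this
  refine this.congr_fun fun k => ?_
  rw [smul_eq_mul]
  exact congrArg _ (mFourier_ek k x).symm

end Gal

namespace Gal

variable {n : ℕ}

structure Fam (A : ℕ → ℝ → (Fin n → ℤ) → ℂ) : Prop where
  der : ∀ j k z, HasDerivAt (fun z => A j z k) (A (j+1) z k) z
  bd : ∀ (j s : ℕ) (M : ℝ), ∃ C, ∀ k z, |z| ≤ M → lam k ^ s * ‖A j z k‖ ≤ C

def ser (A : ℕ → ℝ → (Fin n → ℤ) → ℂ) (p : (Fin n → ℝ) × ℝ) : ℂ := ∑' k, A 0 p.2 k * ek k p.1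

def sh (A : ℕ → ℝ → (Fin n → ℤ) → ℂ) : ℕ → ℝ → (Fin n → ℤ) → ℂ := fun j => A (j+1)

def dm (i : Fin n) (A : ℕ → ℝ → (Fin n → ℤ) → ℂ) : ℕ → ℝ → (Fin n → ℤ) → ℂ := fun j z k => dsym i k * A j z k

lemma Fam.shift {A : ℕ → ℝ → (Fin n → ℤ) → ℂ} (h : Fam A) : Fam (sh A) :=
  ⟨fun j k z => h.der (j+1) k z, fun j s M => h.bd (j+1) s M⟩

lemma Fam.dmul {A : ℕ → ℝ → (Fin n → ℤ) → ℂ} (h : Fam A) (i : Fin n) : Fam (dm i A) := by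
  refine ⟨fun j k z => (h.der j k z).const_mul _, fun j s M => ?_⟩
  obtain ⟨C, hC⟩ := h.bd j (s+1) M
  refine ⟨2 * Real.pi * C, fun k z hz => ?_⟩
  have hl := lam_pos k
  have hpi := Real.pi_pos
  unfold dm
  rw [norm_mul]
  calc lam k ^ s * (‖dsym i k‖ * ‖A j z k‖) ≤ lam k ^ s * ((2 * Real.pi * lam k) * ‖A j z k‖) := by
        gcongr; exact dsym_norm i k
    _ = 2 * Real.pi * (lam k ^ (s+1) * ‖A j z k‖) := by ring
    _ ≤ _ := by gcongr; exact hC k z hz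

/-- the vertical covector -/
def lz : (Fin n → ℝ) × ℝ →L[ℝ] ℂ := Complex.ofRealCLM.comp (ContinuousLinearMap.snd ℝ (Fin n → ℝ) ℝ)
/-- the horizontal covectors -/
def lx (i : Fin n) : (Fin n → ℝ) × ℝ →L[ℝ] ℂ :=
  (Complex.ofRealCLM.comp (ContinuousLinearMap.proj i)).comp (ContinuousLinearMap.fst ℝ (Fin n → ℝ) ℝ)

lemma Fam.summable {A : ℕ → ℝ → (Fin n → ℤ) → ℂ} (h : Fam A) (p : (Fin n → ℝ) × ℝ) :
    Summable fun k => A 0 p.2 k * ek k p.1 := by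
  obtain ⟨C, hC⟩ := h.bd 0 (0 + 2 * n) |p.2|
  have := summable_of_bound (c := fun k => A 0 p.2 k) 0 (fun k => hC k p.2 le_rfl)
  apply Summable.of_norm
  simpa [ek_norm] using this

lemma Fam.term {A : ℕ → ℝ → (Fin n → ℤ) → ℂ} (h : Fam A) (k : Fin n → ℤ) (p : (Fin n → ℝ) × ℝ) :
    HasFDerivAt (fun p : (Fin n → ℝ) × ℝ => A 0 p.2 k * ek k p.1)
      ((A 1 p.2 k * ek k p.1) • lz + ∑ i, ((dsym i k * A 0 p.2 k) * ek k p.1) • lx i) p := by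
  have h1 : HasFDerivAt (fun p : (Fin n → ℝ) × ℝ => A 0 p.2 k) (A 1 p.2 k • lz) p := by
    have := (h.der 0 k p.2).hasFDerivAt.comp p (ContinuousLinearMap.snd ℝ (Fin n → ℝ) ℝ).hasFDerivAt
    refine this.congr_fderiv ?_
    ext v <;> simp [lz]
  have h2 := (ek_hasFDerivAt k p.1).comp p (ContinuousLinearMap.fst ℝ (Fin n → ℝ) ℝ).hasFDerivAt
  refine (h1.fun_mul h2).congr_fderiv ?_
  refine ContinuousLinearMap.ext fun v => ?_
  simp only [add_apply, smul_apply, ContinuousLinearMap.comp_apply, sum_apply, lz, lx, smul_eq_mul,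
    Function.comp_apply, ContinuousLinearMap.coe_fst']
  rw [Finset.mul_sum, add_comm]
  congr 1
  · ring
  · congr 1; ext i; ring

lemma Fam.hasFDerivAt {A : ℕ → ℝ → (Fin n → ℤ) → ℂ} (h : Fam A) (p : (Fin n → ℝ) × ℝ) :
    HasFDerivAt (ser A) (ser (sh A) p • lz + ∑ i, ser (dm i A) p • lx i) p := by
  set M := |p.2| + 1 with hM
  obtain ⟨C1, hC1⟩ := h.bd 1 (2 * n) M
  choose C2 hC2 using fun i => (h.dmul i).bd 0 (2*n) M
  let S : Set ((Fin n → ℝ) × ℝ) := Set.univ ×ˢ Set.Ioo (-M) M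
  have hS : IsOpen S := isOpen_univ.prod isOpen_Ioo
  have hSc : IsPreconnected S := (convex_univ.prod (convex_Ioo _ _)).isPreconnected
  have hpS : p ∈ S := ⟨trivial, by
    have := abs_le.1 (le_refl |p.2|); constructor <;> rw [hM] <;> linarith [this.1, this.2]⟩
  have hb : ∀ (c : ℂ) (k : Fin n → ℤ) (C : ℝ), lam k ^ (2 * n) * ‖c‖ ≤ C → ‖c‖ ≤ C * (lam k ^ (2*n))⁻¹ := by
    intro c k C hc
    have := lam_pos k
    rw [← div_eq_mul_inv, le_div_iff₀ (by positivity)]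
    linarith
  have key := hasFDerivAt_tsum_of_isPreconnected (𝕜 := ℝ) (f := fun k (p : (Fin n → ℝ) × ℝ) => A 0 p.2 k * ek k p.1)
    (f' := fun k p => (A 1 p.2 k * ek k p.1) • lz + ∑ i, ((dsym i k * A 0 p.2 k) * ek k p.1) • lx i)
    (u := fun k => (C1 * ‖(lz : (Fin n → ℝ) × ℝ →L[ℝ] ℂ)‖ + ∑ i, C2 i * ‖(lx i : (Fin n → ℝ) × ℝ →L[ℝ] ℂ)‖) * (lam k ^ (2*n))⁻¹)
    (summable_lam.mul_left _) hS hSc (fun k q _ => h.term k q) (by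
      intro k q hq
      have hq2 : |q.2| ≤ M := (abs_lt.2 hq.2).le
      refine (norm_add_le _ _).trans ?_
      rw [add_mul]
      gcongr
      · rw [norm_smul, norm_mul, ek_norm, mul_one]
        have := hb _ k _ (hC1 k q.2 hq2)
        calc _ ≤ (C1 * (lam k ^ (2*n))⁻¹) * ‖(lz : (Fin n → ℝ) × ℝ →L[ℝ] ℂ)‖ := by gcongr
          _ = _ := by ring
      · refine (norm_sum_le _ _).trans ?_
        rw [Finset.sum_mul]
        gcongr with i
        rw [norm_smul, norm_mul, ek_norm, mul_one]
        have := hb _ k _ (hC2 i k q.2 hq2)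
        calc _ ≤ (C2 i * (lam k ^ (2*n))⁻¹) * ‖(lx i : (Fin n → ℝ) × ℝ →L[ℝ] ℂ)‖ := by gcongr; exact this
          _ = _ := by ring) hpS (h.summable p) hpS
  refine key.congr_fderiv ?_
  have s1 : HasSum (fun k => (A 1 p.2 k * ek k p.1) • (lz : (Fin n → ℝ) × ℝ →L[ℝ] ℂ)) (ser (sh A) p • lz) :=
    (h.shift.summable p).hasSum.smul_const lz
  have s2 : ∀ i, HasSum (fun k => ((dsym i k * A 0 p.2 k) * ek k p.1) • (lx i : (Fin n → ℝ) × ℝ →L[ℝ] ℂ)) (ser (dm i A) p • lx i) :=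
    fun i => ((h.dmul i).summable p).hasSum.smul_const (lx i)
  exact (s1.add (hasSum_sum fun i _ => s2 i)).tsum_eq

lemma Fam.contDiff_nat (m : ℕ) : ∀ {A : ℕ → ℝ → (Fin n → ℤ) → ℂ}, Fam A → ContDiff ℝ m (ser A) := by
  induction m with
  | zero =>
    intro A h
    rw [Nat.cast_zero, contDiff_zero]
    exact continuous_iff_continuousAt.2 fun p => (h.hasFDerivAt p).continuousAt
  | succ m ih =>
    intro A h
    push_cast
    rw [contDiff_succ_iff_fderiv]
    refine ⟨fun p => (h.hasFDerivAt p).differentiableAt, by simp, ?_⟩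
    have : fderiv ℝ (ser A) = fun p => ser (sh A) p • lz + ∑ i, ser (dm i A) p • lx i := by
      ext1 p; exact (h.hasFDerivAt p).fderiv
    rw [this]
    exact ((ih h.shift).smul contDiff_const).add (ContDiff.sum fun i _ => (ih (h.dmul i)).smul contDiff_const)

lemma Fam.contDiff {A : ℕ → ℝ → (Fin n → ℤ) → ℂ} (h : Fam A) : ContDiff ℝ (⊤:ℕ∞) (ser A) :=
  contDiff_infty.2 fun m => h.contDiff_nat m

lemma ser_per (A : ℕ → ℝ → (Fin n → ℤ) → ℂ) (x : Fin n → ℝ) (z : ℝ) (l : Fin n → ℤ) :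
    ser A (x + fun i => (l i : ℝ), z) = ser A (x, z) := by
  simp only [ser, ek_per]

end Gal

namespace Gal

variable {n : ℕ}

lemma borel_fun (j : ℕ) (ε : ℝ) (hε : 0 < ε) : ∃ θ : ℕ → ℝ → ℝ, (∀ i z, HasDerivAt (θ i) (θ (i+1) z) z) ∧
    (∀ i, θ i 0 = if i = j then 1 else 0) ∧ (∀ i, ∃ M, ∀ z, |θ i z| ≤ M) ∧ ∀ i < j, ∀ z, |θ i z| ≤ ε := by
  let b : ContDiffBump (0:ℝ) := ⟨1, 2, by norm_num, by norm_num⟩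
  let η : ℝ → ℝ := fun t => b t * (t^j / j.factorial)
  have hη : ContDiff ℝ (⊤:ℕ∞) η := b.contDiff.mul ((contDiff_id.pow j).div_const _)
  have hcs : HasCompactSupport η := b.hasCompactSupport.mul_right
  let H : ℕ → ℝ → ℝ := fun i => iteratedDeriv i η
  have hH : ∀ i z, HasDerivAt (H i) (H (i+1) z) z := by
    intro i z
    have h1 : Differentiable ℝ (iteratedDeriv i η) := hη.differentiable_iteratedDeriv i (by exact_mod_cast WithTop.coe_lt_top i)
    have := (h1 z).hasDerivAt
    simp only [H, iteratedDeriv_succ]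
    exact this
  have hHb : ∀ i, ∃ M, ∀ z, |H i z| ≤ M := by
    intro i
    have hcs' : ∀ i, HasCompactSupport (H i) := by
      intro i
      induction i with
      | zero => simpa [H] using hcs
      | succ i ih => simp only [H, iteratedDeriv_succ]; exact ih.deriv
    have hc : Continuous (H i) := continuous_iff_continuousAt.2 fun z => (hH i z).continuousAt
    exact (hcs' i).exists_bound_of_continuous hc
  choose M hM using hHb
  have hM0 : ∀ i, 0 ≤ M i := fun i => (abs_nonneg _).trans (hM i 0)
  have hH0 : ∀ i, H i 0 = if i = j then 1 else 0 := by
    intro i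
    have he : η =ᶠ[nhds 0] fun t => (j.factorial : ℝ)⁻¹ * t^j := by
      filter_upwards [b.eventuallyEq_one] with t ht
      simp only [η, ht, Pi.one_apply]; ring
    simp only [H]
    rw [he.iteratedDeriv_eq i, iteratedDeriv_const_mul_field, iteratedDeriv_pow]
    have hf : (j.factorial : ℝ) ≠ 0 := by positivity
    split_ifs with h
    · subst h; simp [Nat.descFactorial_self, hf]
    · rcases lt_or_gt_of_ne h with h | h
      · rw [zero_pow (by omega)]; simp
      · rw [Nat.descFactorial_of_lt h]; simp
  let μ : ℝ := 1 + ∑ i ∈ Finset.range j, M i / ε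
  have hS : 0 ≤ ∑ i ∈ Finset.range j, M i / ε := Finset.sum_nonneg fun i _ => div_nonneg (hM0 i) hε.le
  have hμ : 1 ≤ μ := by simp only [μ]; linarith
  have hμ0 : 0 < μ := by linarith
  refine ⟨fun i z => μ^i / μ^j * H i (μ * z), ?_, ?_, ?_, ?_⟩
  · intro i z
    have h1 : HasDerivAt (fun z => μ * z) μ z := by simpa using (hasDerivAt_id z).const_mul μ
    have := ((hH i (μ * z)).comp z h1).const_mul (μ^i / μ^j)
    refine this.congr_deriv ?_
    simp only [pow_succ]; ring
  · intro i
    simp only [mul_zero, hH0]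
    split_ifs with h
    · subst h; field_simp
    · simp
  · intro i
    refine ⟨μ^i / μ^j * M i, fun z => ?_⟩
    rw [abs_mul, abs_of_pos (by positivity)]
    gcongr
    exact hM i _
  · intro i hi z
    rw [abs_mul, abs_of_pos (by positivity)]
    have h1 : μ^i / μ^j ≤ 1 / μ := by
      rw [div_le_div_iff₀ (by positivity) hμ0, one_mul, ← pow_succ]
      exact pow_le_pow_right₀ hμ hi
    calc μ^i / μ^j * |H i (μ * z)| ≤ 1 / μ * M i := by
          gcongr
          exact hM i _
      _ ≤ ε := by
          rw [one_div, inv_mul_le_iff₀ hμ0]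
          have := Finset.single_le_sum (f := fun i => M i / ε) (fun i _ => div_nonneg (hM0 i) hε.le) (Finset.mem_range.2 hi)
          have h2 : M i / ε ≤ μ := by simp only [μ]; linarith
          rwa [div_le_iff₀ hε] at h2

lemma borel (c : ℕ → (Fin n → ℤ) → ℂ) (C : ℕ → ℕ → ℝ) (hC : ∀ j s k, lam k ^ s * ‖c j k‖ ≤ C j s) :
    ∃ f : ℕ → ℝ → (Fin n → ℤ) → ℂ, (∀ j k z, HasDerivAt (fun z => f j z k) (f (j+1) z k) z) ∧
      (∀ j k, f j 0 k = c j k) ∧ ∀ j s, ∃ D, ∀ z k, lam k ^ s * ‖f j z k‖ ≤ D := by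
  have hC0 : ∀ j s, 0 ≤ C j s := fun j s => le_trans (by have := lam_pos (0 : Fin n → ℤ); positivity) (hC j s 0)
  let ε : ℕ → ℝ := fun j => (1/2)^j * (1 + ∑ s ∈ Finset.range j, C j s)⁻¹
  have hS : ∀ j, 0 ≤ ∑ s ∈ Finset.range j, C j s := fun j => Finset.sum_nonneg fun s _ => hC0 j s
  have hε : ∀ j, 0 < ε j := fun j => by
    have := hS j
    positivity
  choose θ hθd hθ0 hθb hθs using fun j => borel_fun j (ε j) (hε j)
  choose M hM using hθb
  have hM0 : ∀ j i, 0 ≤ M j i := fun j i => (abs_nonneg _).trans (hM j i 0)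
  let u : ℕ → ℕ → ℕ → ℝ := fun i s j => (if j ≤ i + s then M j i * C j s else 0) + (1/2)^j
  have hu : ∀ i s, Summable (u i s) := by
    intro i s
    refine Summable.add ?_ (summable_geometric_of_lt_one (by norm_num) (by norm_num))
    refine summable_of_hasFiniteSupport ((Set.finite_Iic (i+s)).subset ?_)
    intro j hj
    by_contra h
    apply hj
    exact if_neg h
  have hbd : ∀ i s j z k, lam k ^ s * ‖((θ j i z : ℝ) : ℂ) * c j k‖ ≤ u i s j := by
    intro i s j z k
    have hl := lam_pos k
    rw [norm_mul, Complex.norm_real, Real.norm_eq_abs]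
    have e : lam k ^ s * (|θ j i z| * ‖c j k‖) = |θ j i z| * (lam k ^ s * ‖c j k‖) := by ring
    rw [e]
    simp only [u]
    split_ifs with h
    · have : |θ j i z| * (lam k ^ s * ‖c j k‖) ≤ M j i * C j s := by
        gcongr
        · exact hM0 j i
        · exact hM j i z
        · exact hC j s k
      have h2 : (0:ℝ) ≤ (1/2)^j := by positivity
      linarith
    · rw [zero_add]
      calc |θ j i z| * (lam k ^ s * ‖c j k‖) ≤ ε j * C j s := by
            gcongr
            · exact (hε j).le
            · exact hθs j i (by omega) z
            · exact hC j s k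
        _ ≤ (1/2)^j := by
            simp only [ε]
            rw [mul_assoc]
            apply mul_le_of_le_one_right (by positivity)
            rw [inv_mul_le_iff₀ (by have := hS j; positivity), mul_one]
            have := Finset.single_le_sum (f := fun s => C j s) (fun s _ => hC0 j s) (Finset.mem_range.2 (show s < j by omega))
            linarith
  have hbd0 : ∀ i j z k, ‖((θ j i z : ℝ) : ℂ) * c j k‖ ≤ u i 0 j := fun i j z k => by simpa using hbd i 0 j z k
  refine ⟨fun i z k => ∑' j, ((θ j i z : ℝ) : ℂ) * c j k, ?_, ?_, ?_⟩
  · intro i k z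
    refine hasDerivAt_tsum (hu (i+1) 0) (fun j y => ?_) (fun j y => hbd0 (i+1) j y k) (y₀ := 0)
      (Summable.of_norm_bounded (hu i 0) fun j => hbd0 i j 0 k) z
    exact ((hθd j i y).ofReal_comp).mul_const _
  · intro j k
    simp only
    rw [tsum_eq_single j]
    · simp [hθ0]
    · intro l hl; simp [hθ0, Ne.symm hl]
  · intro j s
    refine ⟨∑' l, u j s l, fun z k => ?_⟩
    have hl := lam_pos k
    have hsn : Summable fun l => ‖((θ l j z : ℝ) : ℂ) * c l k‖ :=
      (hu j 0).of_nonneg_of_le (fun _ => norm_nonneg _) fun l => hbd0 j l z k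
    calc lam k ^ s * ‖∑' l, ((θ l j z : ℝ) : ℂ) * c l k‖ ≤ lam k ^ s * ∑' l, ‖((θ l j z : ℝ) : ℂ) * c l k‖ := by
          gcongr; exact norm_tsum_le_tsum_norm hsn
      _ = ∑' l, lam k ^ s * ‖((θ l j z : ℝ) : ℂ) * c l k‖ := tsum_mul_left.symm
      _ ≤ _ := Summable.tsum_le_tsum (fun l => hbd j s l z k) (hsn.mul_left _) (hu j s)

/-- extension of the limit solution to a full family -/
lemma LimSol.exists_fam {F : FData n} {c : (Fin n → ℤ) → ℂ} {a : ℕ → ℝ → (Fin n → ℤ) → ℂ}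
    {C : ℕ → ℕ → ℝ} {E : ℕ → ℝ → ℝ} (h : LimSol F c a C E) :
    ∃ A, Fam A ∧ ∀ j z k, z ≤ 0 → A j z k = a j z k := by
  have hb0 : ∀ j s k, lam k ^ s * ‖a j 0 k‖ ≤ C j s := by
    intro j s k
    cases j with
    | zero => simpa using h.b0 s k 0 le_rfl
    | succ j => exact h.b1 j s k 0 le_rfl
  obtain ⟨f, hfd, hf0, hfb⟩ := borel (fun j k => a j 0 k) C hb0
  refine ⟨fun j z k => if z ≤ 0 then a j z k else f j z k, ⟨?_, ?_⟩, fun j z k hz => if_pos hz⟩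
  · intro j k z
    rcases lt_trichotomy z 0 with hz | hz | hz
    · have h1 := (h.der j k z hz.le).hasDerivAt (Iic_mem_nhds hz)
      rw [if_pos hz.le]
      refine h1.congr_of_eventuallyEq ?_
      filter_upwards [Iic_mem_nhds hz] with w hw
      exact if_pos hw
    · subst hz
      rw [if_pos le_rfl]
      have h1 : HasDerivWithinAt (fun z => if z ≤ 0 then a j z k else f j z k) (a (j+1) 0 k) (Set.Iic 0) 0 :=
        (h.der j k 0 le_rfl).congr (fun w hw => if_pos hw) (if_pos le_rfl)
      have h2 : HasDerivWithinAt (fun z => if z ≤ 0 then a j z k else f j z k) (a (j+1) 0 k) (Set.Ici 0) 0 := by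
        have := (hfd j k 0).hasDerivWithinAt (s := Set.Ici 0)
        rw [hf0] at this
        refine this.congr (fun w hw => ?_) (by rw [if_pos le_rfl, hf0])
        rcases eq_or_lt_of_le (show (0:ℝ) ≤ w from hw) with h' | h'
        · subst h'; rw [if_pos le_rfl, hf0]
        · rw [if_neg (not_le.2 h')]
      have := h1.union h2
      rw [Set.Iic_union_Ici] at this
      exact this.hasDerivAt Filter.univ_mem
    · rw [if_neg (not_le.2 hz)]
      refine (hfd j k z).congr_of_eventuallyEq ?_
      filter_upwards [Ioi_mem_nhds hz] with w hw
      exact if_neg (not_le.2 hw)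
  · intro j s M
    obtain ⟨D, hD⟩ := hfb j s
    refine ⟨max (|C j s| * Real.sqrt (1 + M)) (max (C j s) D), fun k z hz => ?_⟩
    split_ifs with hz0
    · cases j with
      | zero =>
        refine le_trans ((h.b0 s k z hz0).trans ?_) (le_max_left _ _)
        gcongr
        exact le_abs_self _
      | succ j => exact (h.b1 j s k z hz0).trans ((le_max_left _ _).trans (le_max_right _ _))
    · exact (hD z k).trans ((le_max_right _ _).trans (le_max_right _ _))

end Gal

namespace Gal

variable {n : ℕ}

lemma conv_hasSum {g b : (Fin n → ℤ) → ℂ} {x : Fin n → ℝ} {G B : ℂ} (hg : Summable fun k => ‖g k‖) (hb : Summable fun k => ‖b k‖)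
    (hG : HasSum (fun k => g k * ek k x) G) (hB : HasSum (fun k => b k * ek k x) B) :
    HasSum (fun k => conv g b k * ek k x) (G * B) := by
  have hs : Summable fun p : (Fin n → ℤ) × (Fin n → ℤ) => (g p.1 * ek p.1 x) * (b p.2 * ek p.2 x) :=
    by
    have hg' : Summable fun k => ‖g k * ek k x‖ := by simpa [ek_norm] using hg
    have hb' : Summable fun k => ‖b k * ek k x‖ := by simpa [ek_norm] using hb
    exact (Summable.mul_norm (f := fun k => g k * ek k x) (g := fun k => b k * ek k x) hg' hb').of_norm
  have h1 := hG.mul hB hs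
  let e : ((Fin n → ℤ) × (Fin n → ℤ)) ≃ ((Fin n → ℤ) × (Fin n → ℤ)) :=
    ⟨fun p => (p.1 - p.2, p.2), fun p => (p.1 + p.2, p.2), fun p => by simp, fun p => by simp⟩
  have h2 := e.hasSum_iff.2 h1
  have h3 := h2.prod_fiberwise (g := fun k => conv g b k * ek k x) (fun k => by
    have hk := (h2.summable.prod_factor k).hasSum
    have he : ∀ l, (((fun p : (Fin n → ℤ) × (Fin n → ℤ) => (g p.1 * ek p.1 x) * (b p.2 * ek p.2 x)) ∘ e) (k, l)) = g (k - l) * b l * ek k x := by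
      intro l
      simp only [e, Function.comp_apply, Equiv.coe_fn_mk]
      have : ek k x = ek (k - l) x * ek l x := by rw [← ek_add, sub_add_cancel]
      rw [this]; ring
    have h5 : (∑' l, (((fun p : (Fin n → ℤ) × (Fin n → ℤ) => (g p.1 * ek p.1 x) * (b p.2 * ek p.2 x)) ∘ e) (k, l))) = conv g b k * ek k x := by
      rw [tsum_congr he]
      exact tsum_mul_right
    rw [← h5]
    exact hk)
  exact h3

lemma conv_norm_summable {g b : (Fin n → ℤ) → ℂ} (hg : Summable fun k => ‖g k‖) (hb : Summable fun k => ‖b k‖) :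
    Summable fun k => ‖conv g b k‖ := by
  have hs : Summable fun p : (Fin n → ℤ) × (Fin n → ℤ) => ‖g p.1 * b p.2‖ := by
    simpa using Summable.mul_norm (f := g) (g := b) (by simpa using hg) (by simpa using hb)
  let e : ((Fin n → ℤ) × (Fin n → ℤ)) ≃ ((Fin n → ℤ) × (Fin n → ℤ)) :=
    ⟨fun p => (p.1 - p.2, p.2), fun p => (p.1 + p.2, p.2), fun p => by simp, fun p => by simp⟩
  have h2 := (e.summable_iff).2 hs
  refine h2.prod.of_nonneg_of_le (fun _ => norm_nonneg _) fun k => ?_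
  exact norm_tsum_le_tsum_norm (h2.prod_factor k)

lemma conv_dsym {g b : (Fin n → ℤ) → ℂ} (i : Fin n) (hg : Summable fun k => lam k ^ 1 * ‖g k‖) (hb : Summable fun k => lam k ^ 1 * ‖b k‖) (k : Fin n → ℤ) :
    dsym i k * conv g b k = conv (fun k => dsym i k * g k) b k + conv g (fun k => dsym i k * b k) k := by
  have low : ∀ {c : (Fin n → ℤ) → ℂ}, (Summable fun k => lam k ^ 1 * ‖c k‖) → Summable fun k => ‖c k‖ := by
    intro c hc
    refine hc.of_nonneg_of_le (fun _ => norm_nonneg _) fun k => ?_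
    have := one_le_lam k
    have h2 := norm_nonneg (c k)
    nlinarith
  have hi : ∀ {c : (Fin n → ℤ) → ℂ}, (Summable fun k => lam k ^ 1 * ‖c k‖) → Summable fun k => ‖dsym i k * c k‖ := by
    intro c hc
    refine (hc.mul_left (2 * Real.pi)).of_nonneg_of_le (fun _ => norm_nonneg _) fun k => ?_
    rw [norm_mul]
    calc _ ≤ 2 * Real.pi * lam k * ‖c k‖ := by gcongr; exact dsym_norm i k
      _ = _ := by ring
  have cs : ∀ {g b : (Fin n → ℤ) → ℂ}, (Summable fun k => ‖g k‖) → (Summable fun k => ‖b k‖) → Summable fun l => g (k - l) * b l := by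
    intro g b hg hb
    exact (conv_summable hg (b := b) (C := ∑' k, ‖b k‖) (fun k => hb.le_tsum k fun _ _ => norm_nonneg _) k).of_norm
  unfold conv
  rw [← tsum_mul_left, ← Summable.tsum_add (cs (hi hg) (low hb)) (cs (low hg) (hi hb))]
  congr 1; ext l
  have : dsym i k = dsym i (k - l) + dsym i l := by rw [← dsym_add, sub_add_cancel]
  rw [this]; ring

/-- pull back of a series by the shear -/
def WW (h : (Fin n → ℝ) → ℝ) (A : ℕ → ℝ → (Fin n → ℤ) → ℂ) (p : (Fin n → ℝ) × ℝ) : ℝ :=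
  (ser A (p.1, p.2 - h p.1)).re

lemma WW_contDiff {h : (Fin n → ℝ) → ℝ} (hh : ContDiff ℝ (⊤:ℕ∞) h) {A} (hA : Fam A) : ContDiff ℝ (⊤:ℕ∞) (WW h A) := by
  unfold WW
  refine Complex.reCLM.contDiff.comp (hA.contDiff.comp ?_)
  exact contDiff_fst.prodMk (contDiff_snd.sub (hh.comp contDiff_fst))

lemma WW_hasFDerivAt {h : (Fin n → ℝ) → ℝ} (hh : ContDiff ℝ (⊤:ℕ∞) h) {A} (hA : Fam A) (p : (Fin n → ℝ) × ℝ) :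
    HasFDerivAt (WW h A) (WW h (sh A) p • (ContinuousLinearMap.snd ℝ (Fin n → ℝ) ℝ - (fderiv ℝ h p.1).comp (ContinuousLinearMap.fst ℝ (Fin n → ℝ) ℝ))
      + ∑ i, WW h (dm i A) p • ((ContinuousLinearMap.proj i).comp (ContinuousLinearMap.fst ℝ (Fin n → ℝ) ℝ))) p := by
  have h1 : HasFDerivAt (fun p : (Fin n → ℝ) × ℝ => (p.1, p.2 - h p.1))
      ((ContinuousLinearMap.fst ℝ (Fin n → ℝ) ℝ).prod (ContinuousLinearMap.snd ℝ (Fin n → ℝ) ℝ - (fderiv ℝ h p.1).comp (ContinuousLinearMap.fst ℝ (Fin n → ℝ) ℝ))) p := by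
    refine (ContinuousLinearMap.fst ℝ (Fin n → ℝ) ℝ).hasFDerivAt.prodMk ((ContinuousLinearMap.snd ℝ (Fin n → ℝ) ℝ).hasFDerivAt.sub ?_)
    exact ((hh.differentiable (by simp) p.1).hasFDerivAt).comp p (ContinuousLinearMap.fst ℝ (Fin n → ℝ) ℝ).hasFDerivAt
  have h2 := Complex.reCLM.hasFDerivAt.comp p ((hA.hasFDerivAt (p.1, p.2 - h p.1)).comp p h1)
  refine h2.congr_fderiv ?_
  refine ContinuousLinearMap.ext fun v => ?_
  simp [WW, lz, lx]

lemma WW_pdY {h : (Fin n → ℝ) → ℝ} (hh : ContDiff ℝ (⊤:ℕ∞) h) {A} (hA : Fam A) :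
    pdE n (WW h A) (eY n) = WW h (sh A) := by
  ext p
  unfold pdE
  rw [(WW_hasFDerivAt hh hA p).fderiv]
  simp [eY]

lemma WW_pdX {h : (Fin n → ℝ) → ℝ} (hh : ContDiff ℝ (⊤:ℕ∞) h) {A} (hA : Fam A) (i : Fin n) :
    pdE n (WW h A) (eX n i) = fun p => WW h (dm i A) p - pdX n h i p.1 * WW h (sh A) p := by
  ext p
  unfold pdE
  rw [(WW_hasFDerivAt hh hA p).fderiv]
  simp only [eX, add_apply, smul_apply, sum_apply, ContinuousLinearMap.comp_apply, sub_apply,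
    ContinuousLinearMap.coe_fst', ContinuousLinearMap.coe_snd', ContinuousLinearMap.proj_apply, smul_eq_mul]
  rw [Finset.sum_eq_single i]
  · simp [pdX]; ring
  · intro j _ hj; simp [hj]
  · simp

lemma WW_pdXX {h : (Fin n → ℝ) → ℝ} (hh : ContDiff ℝ (⊤:ℕ∞) h) {A} (hA : Fam A) (i : Fin n) (p) :
    pdE n (pdE n (WW h A) (eX n i)) (eX n i) p = WW h (dm i (dm i A)) p - 2 * pdX n h i p.1 * WW h (dm i (sh A)) p
      - pdX n (pdX n h i) i p.1 * WW h (sh A) p + (pdX n h i p.1)^2 * WW h (sh (sh A)) p := by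
  rw [WW_pdX hh hA]
  have d1 : HasFDerivAt (fun p : (Fin n → ℝ) × ℝ => pdX n h i p.1) ((fderiv ℝ (pdX n h i) p.1).comp (ContinuousLinearMap.fst ℝ (Fin n → ℝ) ℝ)) p :=
    (((pdX_smooth hh i).differentiable (by simp) p.1).hasFDerivAt).comp p (ContinuousLinearMap.fst ℝ (Fin n → ℝ) ℝ).hasFDerivAt
  have d2 := (WW_contDiff hh (hA.dmul i)).differentiable (by simp) p
  have d3 := (WW_contDiff hh hA.shift).differentiable (by simp) p
  have := d2.hasFDerivAt.fun_sub (d1.fun_mul d3.hasFDerivAt)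
  unfold pdE
  rw [this.fderiv]
  have e2 := congrFun (WW_pdX hh (hA.dmul i) i) p
  have e3 := congrFun (WW_pdX hh hA.shift i) p
  unfold pdE at e2 e3
  simp only [sub_apply, add_apply, smul_apply, ContinuousLinearMap.comp_apply, smul_eq_mul, e2, e3]
  have e4 : (fderiv ℝ (pdX n h i) p.1) ((ContinuousLinearMap.fst ℝ (Fin n → ℝ) ℝ) (eX n i)) = pdX n (pdX n h i) i p.1 := by
    simp [eX, pdX]
  have e5 : sh (dm i A) = dm i (sh A) := rfl
  rw [e4, e5]
  ring

end Gal

namespace Gal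

variable {n : ℕ}

lemma Fam.nsum {A : ℕ → ℝ → (Fin n → ℤ) → ℂ} (h : Fam A) (j s : ℕ) (z : ℝ) : Summable fun k => lam k ^ s * ‖A j z k‖ := by
  obtain ⟨C, hC⟩ := h.bd j (s + 2 * n) |z|
  exact summable_of_bound s (fun k => hC k z le_rfl)

lemma Fam.nsum0 {A : ℕ → ℝ → (Fin n → ℤ) → ℂ} (h : Fam A) (j : ℕ) (z : ℝ) : Summable fun k => ‖A j z k‖ := by
  simpa using h.nsum j 0 z

lemma Fam.hasSum {A : ℕ → ℝ → (Fin n → ℤ) → ℂ} (h : Fam A) (x : Fin n → ℝ) (z : ℝ) :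
    HasSum (fun k => A 0 z k * ek k x) (ser A (x, z)) := (h.summable (x, z)).hasSum

/-- Fourier data of `h`. -/
def hF (h : (Fin n → ℝ) → ℝ) (hh : ContDiff ℝ (⊤:ℕ∞) h) (hp : ZPeriodic n h) : FData n where
  g := fun i => cf (pdX n h i)
  sym := fun i k => cf_neg _ k
  decay := fun i s => cf_summable (pdX_smooth hh i) (pdX_per hp i) s

lemma eqn_sum {h : (Fin n → ℝ) → ℝ} (hh : ContDiff ℝ (⊤:ℕ∞) h) (hp : ZPeriodic n h)
    {A : ℕ → ℝ → (Fin n → ℤ) → ℂ} (hA : Fam A) (z : ℝ) (x : Fin n → ℝ)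
    (eqn : ∀ k, A 2 z k + ∑ i, conv (cf (pdX n h i)) (conv (cf (pdX n h i)) (A 2 z)) k =
    ∑ i, (conv (cf (pdX n h i)) (fun k => dsym i k * A 1 z k) k -
      dsym i k * (dsym i k * A 0 z k - conv (cf (pdX n h i)) (A 1 z) k))) :
    ser (sh (sh A)) (x, z) + ∑ i, (pdX n h i x : ℂ) * ((pdX n h i x : ℂ) * ser (sh (sh A)) (x,z)) =
     ∑ i, ((pdX n h i x : ℂ) * ser (dm i (sh A)) (x,z) - (ser (dm i (dm i A)) (x,z) -
       ((pdX n (pdX n h i) i x : ℂ) * ser (sh A) (x,z) + (pdX n h i x : ℂ) * ser (dm i (sh A)) (x,z)))) := by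
  have gs : ∀ i, HasSum (fun k => cf (pdX n h i) k * ek k x) (pdX n h i x : ℂ) := fun i =>
    cf_hasSum (pdX_smooth hh i) (pdX_per hp i) x
  have gs' : ∀ i, HasSum (fun k => (dsym i k * cf (pdX n h i) k) * ek k x) (pdX n (pdX n h i) i x : ℂ) := fun i => by
    have := cf_hasSum (pdX_smooth (pdX_smooth hh i) i) (pdX_per (pdX_per hp i) i) x
    simpa only [cf_pd (pdX_smooth hh i) (pdX_per hp i)] using this
  have gn : ∀ i, Summable fun k => ‖cf (pdX n h i) k‖ := fun i => by
    simpa using cf_summable (pdX_smooth hh i) (pdX_per hp i) 0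
  have gn1 : ∀ i, Summable fun k => lam k ^ 1 * ‖cf (pdX n h i) k‖ := fun i =>
    cf_summable (pdX_smooth hh i) (pdX_per hp i) 1
  have gn' : ∀ i, Summable fun k => ‖dsym i k * cf (pdX n h i) k‖ := fun i => by
    have := cf_summable (pdX_smooth (pdX_smooth hh i) i) (pdX_per (pdX_per hp i) i) 0
    simpa only [cf_pd (pdX_smooth hh i) (pdX_per hp i), pow_zero, one_mul] using this
  have s2 := hA.shift.shift.hasSum x z
  have s1 := hA.shift.hasSum x z
  have L : HasSum (fun k => (A 2 z k + ∑ i, conv (cf (pdX n h i)) (conv (cf (pdX n h i)) (A 2 z)) k) * ek k x)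
      (ser (sh (sh A)) (x, z) + ∑ i, (pdX n h i x : ℂ) * ((pdX n h i x : ℂ) * ser (sh (sh A)) (x,z))) := by
    have := s2.add (hasSum_sum (s := Finset.univ) fun i _ => conv_hasSum (gn i) (conv_norm_summable (gn i) (hA.nsum0 2 z)) (gs i)
      (conv_hasSum (gn i) (hA.nsum0 2 z) (gs i) s2))
    refine this.congr_fun ?_ 
    intro k
    rw [add_mul, Finset.sum_mul]; rfl
  have R : HasSum (fun k => (∑ i, (conv (cf (pdX n h i)) (fun k => dsym i k * A 1 z k) k -
      dsym i k * (dsym i k * A 0 z k - conv (cf (pdX n h i)) (A 1 z) k))) * ek k x)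
      (∑ i, ((pdX n h i x : ℂ) * ser (dm i (sh A)) (x,z) - (ser (dm i (dm i A)) (x,z) -
       ((pdX n (pdX n h i) i x : ℂ) * ser (sh A) (x,z) + (pdX n h i x : ℂ) * ser (dm i (sh A)) (x,z))))) := by
    have := (hasSum_sum (s := Finset.univ) fun i _ =>
      (conv_hasSum (gn i) ((hA.shift.dmul i).nsum0 0 z) (gs i) ((hA.shift.dmul i).hasSum x z)).sub
      (((hA.dmul i).dmul i).hasSum x z |>.sub
        ((conv_hasSum (gn' i) (hA.nsum0 1 z) (gs' i) s1).add
         (conv_hasSum (gn i) ((hA.shift.dmul i).nsum0 0 z) (gs i) ((hA.shift.dmul i).hasSum x z)))))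
    refine this.congr_fun ?_ 
    intro k
    rw [Finset.sum_mul]
    refine Finset.sum_congr rfl fun i _ => ?_
    have e := conv_dsym i (gn1 i) (hA.nsum 1 1 z) k
    have e2 : dm i (sh A) 0 z = fun k => dsym i k * A 1 z k := rfl
    rw [mul_sub, e, e2]
    simp only [dm]
    ring
  refine HasSum.unique L ?_
  simpa only [eqn] using R

lemma WW_harm {h : (Fin n → ℝ) → ℝ} (hh : ContDiff ℝ (⊤:ℕ∞) h) (hp : ZPeriodic n h)
    {A : ℕ → ℝ → (Fin n → ℤ) → ℂ} (hA : Fam A) (p : (Fin n → ℝ) × ℝ)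
    (eqn : ∀ k, A 2 (p.2 - h p.1) k + ∑ i, conv (cf (pdX n h i)) (conv (cf (pdX n h i)) (A 2 (p.2 - h p.1))) k =
    ∑ i, (conv (cf (pdX n h i)) (fun k => dsym i k * A 1 (p.2 - h p.1) k) k -
      dsym i k * (dsym i k * A 0 (p.2 - h p.1) k - conv (cf (pdX n h i)) (A 1 (p.2 - h p.1)) k))) :
    lapE n (WW h A) p = 0 := by
  have key := congrArg Complex.re (eqn_sum hh hp hA _ p.1 eqn)
  simp only [Complex.add_re, Complex.re_sum, Complex.sub_re, Complex.re_ofReal_mul] at key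
  unfold lapE
  rw [WW_pdY hh hA, WW_pdY hh hA.shift]
  simp only [WW_pdXX hh hA]
  unfold WW
  simp only [Finset.sum_sub_distrib, Finset.sum_add_distrib, mul_assoc, pow_two] at key ⊢
  have e0 : ∀ f : Fin n → ℝ, ∑ i, 2 * f i = 2 * ∑ i, f i := fun f => (Finset.mul_sum _ _ _).symm
  rw [e0]
  linarith

end Gal

namespace Gal

variable {n : ℕ}

/-- the shear -/
def shear (h : (Fin n → ℝ) → ℝ) (p : (Fin n → ℝ) × ℝ) : (Fin n → ℝ) × ℝ := (p.1, p.2 - h p.1)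

lemma shear_mp {h : (Fin n → ℝ) → ℝ} (hh : Continuous h) : MeasurePreserving (shear h) (volume : Measure ((Fin n → ℝ) × ℝ)) volume := by
  have := (MeasurePreserving.id (volume : Measure (Fin n → ℝ))).skew_product (μc := (volume : Measure ℝ)) (μd := (volume : Measure ℝ))
    (g := fun x y => y - h x) (by fun_prop) (Filter.Eventually.of_forall fun x => (measurePreserving_sub_right volume (h x)).map_eq)
  exact this

def shearH (h : (Fin n → ℝ) → ℝ) (hh : Continuous h) : ((Fin n → ℝ) × ℝ) ≃ₜ ((Fin n → ℝ) × ℝ) where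
  toFun := shear h
  invFun := fun p => (p.1, p.2 + h p.1)
  left_inv := fun p => by simp [shear]
  right_inv := fun p => by simp [shear]
  continuous_toFun := by unfold shear; fun_prop
  continuous_invFun := by fun_prop

lemma fluidCell_eq (h : (Fin n → ℝ) → ℝ) : fluidCell n h = shear h ⁻¹' (cell n ×ˢ Set.Iio 0) := by
  ext p; simp [fluidCell, shear]

lemma shear_int {h : (Fin n → ℝ) → ℝ} (hh : Continuous h) (f : (Fin n → ℝ) × ℝ → ℝ) :
    IntegrableOn (fun p => f (shear h p)) (fluidCell n h) ↔ IntegrableOn f (cell n ×ˢ Set.Iio 0) := by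
  rw [fluidCell_eq]
  exact (shear_mp hh).integrableOn_comp_preimage (shearH h hh).measurableEmbedding

lemma int_snd {E : ℝ → ℝ} (hE : IntegrableOn E (Set.Iic 0)) : IntegrableOn (fun q : (Fin n → ℝ) × ℝ => E q.2) (cell n ×ˢ Set.Iio 0) := by
  unfold IntegrableOn
  rw [Measure.volume_eq_prod, ← Measure.prod_restrict]
  haveI : IsFiniteMeasure ((volume : Measure (Fin n → ℝ)).restrict (cell n)) := ⟨by simp [vol_cell]⟩
  exact (hE.mono_set Set.Iio_subset_Iic_self).integrable.comp_snd _

lemma re_bound {b : (Fin n → ℤ) → ℂ} {x : Fin n → ℝ} {s : ℂ} (hs : HasSum (fun k => b k * ek k x) s) {C : ℝ}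
    (hb : ∀ k, lam k ^ (2 * n) * ‖b k‖ ≤ C) : |s.re| ≤ C * ∑' k : Fin n → ℤ, (lam k ^ (2*n))⁻¹ := by
  refine (Complex.abs_re_le_norm s).trans ?_
  have h1 := (summable_lam (n := n)).mul_left C
  rw [← hs.tsum_eq, ← tsum_mul_left]
  refine tsum_of_norm_bounded h1.hasSum fun k => ?_
  rw [norm_mul, ek_norm, mul_one]
  have := pow_pos (lam_pos k) (2*n)
  rw [← div_eq_mul_inv, le_div_iff₀ this, mul_comm]; exact hb k

theorem exists_ext {h ψ : (Fin n → ℝ) → ℝ} (hh : ContDiff ℝ (⊤:ℕ∞) h) (hp : ZPeriodic n h)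
    (hψ : ContDiff ℝ (⊤:ℕ∞) ψ) (hψp : ZPeriodic n ψ) :
    ∃ φ, IsHarmonicExt n h ψ φ ∧ (∃ C, ∀ p : (Fin n → ℝ) × ℝ, p.2 ≤ h p.1 → |φ p| ≤ C * Real.sqrt (1 + |p.2|)) ∧
      (∃ D, ∀ p : (Fin n → ℝ) × ℝ, p.2 ≤ h p.1 → gradSqE n φ p ≤ D) := by
  obtain ⟨a, C, E, hL⟩ := exists_limsol (hF h hh hp) (cf ψ) (cf_summable hψ hψp)
  obtain ⟨A, hA, hAa⟩ := hL.exists_fam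
  set S0 := ∑' k : Fin n → ℤ, (lam k ^ (2*n))⁻¹ with hS
  have hS0 : 0 ≤ S0 := tsum_nonneg fun k => by have := lam_pos k; positivity
  have gs : ∀ i x, HasSum (fun k => cf (pdX n h i) k * ek k x) (pdX n h i x : ℂ) := fun i x =>
    cf_hasSum (pdX_smooth hh i) (pdX_per hp i) x
  have gn : ∀ i, Summable fun k => ‖cf (pdX n h i) k‖ := fun i => by
    simpa using cf_summable (pdX_smooth hh i) (pdX_per hp i) 0
  have fa : ∀ j z, z ≤ 0 → A j z = a j z := fun j z hz => funext fun k => hAa j z k hz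
  have grad : ∀ p : (Fin n → ℝ) × ℝ, p.2 ≤ h p.1 → gradSqE n (WW h A) p ≤ ((n:ℝ)+1) * S0^2 * E (2*n) (p.2 - h p.1) := by
    intro p hpp
    have hz : p.2 - h p.1 ≤ 0 := by linarith
    have sqE := Real.sq_sqrt (hL.E_nonneg (2*n) _ hz)
    have hy : |pdE n (WW h A) (eY n) p| ≤ Real.sqrt (E (2*n) (p.2 - h p.1)) * S0 := by
      rw [WW_pdY hh hA]
      refine re_bound (hA.shift.hasSum p.1 (p.2 - h p.1)) fun k => ?_
      have : sh A 0 (p.2 - h p.1) k = a 1 (p.2 - h p.1) k := hAa 1 _ k hz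
      rw [this]
      exact Real.le_sqrt_of_sq_le (hL.E1 _ k _ hz)
    have hx : ∀ i, |pdE n (WW h A) (eX n i) p| ≤ Real.sqrt (E (2*n) (p.2 - h p.1)) * S0 := by
      intro i
      rw [WW_pdX hh hA]
      have hs := ((hA.dmul i).hasSum p.1 (p.2 - h p.1)).sub (conv_hasSum (gn i) (hA.nsum0 1 (p.2 - h p.1)) (gs i p.1) (hA.shift.hasSum p.1 (p.2 - h p.1)))
      have hs' : HasSum (fun k => (dsym i k * A 0 (p.2 - h p.1) k - conv (cf (pdX n h i)) (A 1 (p.2 - h p.1)) k) * ek k p.1)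
        (ser (dm i A) (p.1, p.2 - h p.1) - (pdX n h i p.1 : ℂ) * ser (sh A) (p.1, p.2 - h p.1)) := by
        refine hs.congr_fun fun k => ?_
        simp only [dm, sh]; ring
      have := re_bound hs' (C := Real.sqrt (E (2*n) (p.2 - h p.1))) fun k => by
        rw [fa 0 _ hz, fa 1 _ hz]
        exact Real.le_sqrt_of_sq_le (hL.E2 _ i k _ hz)
      rw [Complex.sub_re, Complex.re_ofReal_mul] at this
      exact this
    have sq : ∀ t : ℝ, |t| ≤ Real.sqrt (E (2*n) (p.2 - h p.1)) * S0 → t^2 ≤ S0^2 * E (2*n) (p.2 - h p.1) := by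
      intro t ht
      rw [← sq_abs]
      calc |t|^2 ≤ (Real.sqrt (E (2*n) (p.2 - h p.1)) * S0)^2 := by gcongr
        _ = _ := by rw [mul_pow, sqE]; ring
    unfold gradSqE
    calc _ ≤ (∑ _i : Fin n, S0^2 * E (2*n) (p.2 - h p.1)) + S0^2 * E (2*n) (p.2 - h p.1) := by
          gcongr with i
          · exact sq _ (hx i)
          · exact sq _ hy
      _ = _ := by simp; ring
  have hsm := WW_contDiff hh hA
  refine ⟨WW h A, ⟨hsm, ?_, ?_, ?_, ?_⟩, ?_, ?_⟩
  · intro x y k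
    simp only [WW, hp x k, ser_per]
  · intro p hpp
    refine WW_harm hh hp hA p fun k => ?_
    have hz : p.2 - h p.1 ≤ 0 := by linarith
    rw [fa 0 _ hz, fa 1 _ hz, fa 2 _ hz]
    exact hL.eqn k _ hz
  · intro x
    simp only [WW, sub_self]
    have h1 := hA.hasSum x 0
    rw [fa 0 0 le_rfl] at h1
    simp only [hL.ini] at h1
    rw [h1.unique (cf_hasSum hψ hψp x)]
    simp
  · have hInt : IntegrableOn (fun p => ((n:ℝ)+1) * S0^2 * E (2*n) (p.2 - h p.1)) (fluidCell n h) := by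
      have := (shear_int hh.continuous (fun q => E (2*n) q.2)).2 (int_snd (hL.E_int (2*n)))
      exact Integrable.const_mul this _
    have hm : MeasurableSet (fluidCell n h) := by
      rw [fluidCell_eq]
      exact (shear_mp hh.continuous).measurable (measurableSet_cell.prod measurableSet_Iio)
    have hcont : Continuous (gradSqE n (WW h A)) := by
      have : ∀ v, Continuous (pdE n (WW h A) v) := fun v => (hsm.continuous_fderiv (by simp)).clm_apply continuous_const
      unfold gradSqE
      exact (continuous_finsetSum _ fun i _ => (this _).pow 2).add ((this _).pow 2)
    refine Integrable.mono' hInt hcont.aestronglyMeasurable ?_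
    refine (ae_restrict_iff' hm).2 (Filter.Eventually.of_forall fun p hpp => ?_)
    have h0 : 0 ≤ gradSqE n (WW h A) p := by unfold gradSqE; positivity
    rw [Real.norm_of_nonneg h0]
    exact grad p hpp.2.le
  · obtain ⟨H, hH⟩ := per_bdd hh.continuous hp
    have hH0 : 0 ≤ H := (abs_nonneg _).trans (hH 0)
    have C0 : 0 ≤ C 0 (2*n) := by
      have := hL.b0 (2*n) 0 0 le_rfl
      simp only [abs_zero, add_zero, Real.sqrt_one, mul_one] at this
      refine le_trans ?_ this
      have := lam_pos (0 : Fin n → ℤ); positivity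
    refine ⟨C 0 (2*n) * Real.sqrt (1 + H) * S0, fun p hpp => ?_⟩
    have hz : p.2 - h p.1 ≤ 0 := by linarith
    have := re_bound (hA.hasSum p.1 (p.2 - h p.1)) fun k => by
      rw [hAa 0 _ k hz]; exact hL.b0 (2*n) k _ hz
    refine this.trans ?_
    have h2 : Real.sqrt (1 + |p.2 - h p.1|) ≤ Real.sqrt (1 + H) * Real.sqrt (1 + |p.2|) := by
      rw [← Real.sqrt_mul (by positivity)]
      apply Real.sqrt_le_sqrt
      have := abs_sub p.2 (h p.1)
      have := hH p.1
      have := abs_nonneg p.2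
      nlinarith
    calc _ ≤ C 0 (2*n) * (Real.sqrt (1 + H) * Real.sqrt (1 + |p.2|)) * S0 := by gcongr
      _ = _ := by ring
  · obtain ⟨D, hD⟩ := hL.E_bdd (2*n)
    refine ⟨((n:ℝ)+1) * S0^2 * D, fun p hpp => (grad p hpp).trans ?_⟩
    gcongr
    exact hD _ (by linarith)

end Gal

namespace Gal

variable {n : ℕ}

lemma sd_test {f f' : ℝ → ℝ} {f'' : ℝ} (h1 : ∀ᶠ t in nhds 0, HasDerivAt f (f' t) t) (h2 : HasDerivAt f' f'' 0)
    (hm : IsLocalMin f 0) : 0 ≤ f'' := by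
  by_contra hneg
  push Not at hneg
  have e : deriv f =ᶠ[nhds 0] f' := h1.mono fun t ht => ht.deriv
  have d2 : deriv (deriv f) 0 = f'' := by rw [e.deriv_eq, h2.deriv]
  have d1 : deriv f 0 = 0 := hm.deriv_eq_zero
  have hM : IsLocalMax f 0 := isLocalMax_of_deriv_deriv_neg (by rw [d2]; exact hneg) d1 h1.self_of_nhds.continuousAt
  have hc : f =ᶠ[nhds 0] fun _ => f 0 := by
    filter_upwards [hM, hm] with t h3 h4
    exact le_antisymm h3 h4
  have hc' : deriv f =ᶠ[nhds 0] fun _ => 0 := by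
    have := hc.deriv
    simpa using this
  have : deriv (deriv f) 0 = 0 := by rw [hc'.deriv_eq]; simp
  linarith

lemma line_deriv {r : (Fin n → ℝ) × ℝ → ℝ} (hr : ContDiff ℝ (⊤:ℕ∞) r) (p v : (Fin n → ℝ) × ℝ) (t : ℝ) :
    HasDerivAt (fun t : ℝ => r (p + t • v)) (pdE n r v (p + t • v)) t := by
  have h1 : HasDerivAt (fun t : ℝ => p + t • v) v t := by
    simpa using ((hasDerivAt_id t).smul_const v).const_add p
  exact ((hr.differentiable (by simp) _).hasFDerivAt).comp_hasDerivAt t h1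

lemma pdE_smooth {r : (Fin n → ℝ) × ℝ → ℝ} (hr : ContDiff ℝ (⊤:ℕ∞) r) (v) : ContDiff ℝ (⊤:ℕ∞) (pdE n r v) := by
  have : ContDiff ℝ (⊤:ℕ∞) (fderiv ℝ r) := hr.fderiv_right (by simp)
  exact this.clm_apply contDiff_const

lemma pdE_per {r : (Fin n → ℝ) × ℝ → ℝ} (hr : ZPeriodicE n r) (v) : ZPeriodicE n (pdE n r v) := by
  intro x y k
  unfold pdE
  have : r = fun p => r (p + ((fun i => (k i : ℝ)), 0)) := by
    ext ⟨x, y⟩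
    simpa using (hr x y k).symm
  conv_rhs => rw [this]
  rw [fderiv_comp_add_right]
  simp

lemma gbar {c y : ℝ} (h : y < c) : HasDerivAt (fun y : ℝ => (c - y) ^ (3/4:ℝ)) (-(3/4) * (c - y)^(-(1/4):ℝ)) y := by
  have := ((hasDerivAt_id y).const_sub c).rpow_const (p := 3/4) (Or.inl (by simp; linarith))
  convert this using 1
  simp only [id]; norm_num

lemma gbar2 {c y : ℝ} (h : y < c) : HasDerivAt (fun y : ℝ => -(3/4) * (c - y)^(-(1/4):ℝ)) (-(3/16) * (c - y)^(-(5/4):ℝ)) y := by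
  have := (((hasDerivAt_id y).const_sub c).rpow_const (p := -(1/4)) (Or.inl (by simp; linarith))).const_mul (-(3/4):ℝ)
  refine HasDerivAt.congr_deriv (f := fun y : ℝ => -(3/4) * (c - y)^(-(1/4):ℝ)) this ?_
  rw [show (-(1/4):ℝ) - 1 = -(5/4) by norm_num]
  simp only [id]; ring

theorem max_principle {h : (Fin n → ℝ) → ℝ} (hh : Continuous h) (hp : ZPeriodic n h) {r : (Fin n → ℝ) × ℝ → ℝ}
    (hr : ContDiff ℝ (⊤:ℕ∞) r) (hrp : ZPeriodicE n r) (hlap : ∀ p : (Fin n → ℝ) × ℝ, p.2 < h p.1 → lapE n r p ≤ 0)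
    (hb : ∀ x, 0 ≤ r (x, h x)) (C : ℝ) (hC : ∀ p : (Fin n → ℝ) × ℝ, p.2 ≤ h p.1 → -(C * Real.sqrt (1 + |p.2|)) ≤ r p) :
    ∀ p : (Fin n → ℝ) × ℝ, p.2 ≤ h p.1 → 0 ≤ r p := by
  intro p0 hp0
  by_contra hneg
  push Not at hneg
  obtain ⟨H, hH⟩ := per_bdd hh hp
  have hH0 : 0 ≤ H := (abs_nonneg _).trans (hH 0)
  set c := H + 1 with hc
  have hlt : ∀ p : (Fin n → ℝ) × ℝ, p.2 ≤ h p.1 → p.2 + 1 ≤ c := fun p hp => by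
    have := (abs_le.1 (hH p.1)).2; linarith
  set g : ℝ → ℝ := fun y => (c - y) ^ (3/4:ℝ) with hg
  have g0 : 0 < g p0.2 := Real.rpow_pos_of_pos (by have := hlt p0 hp0; linarith) _
  set δ := -r p0 / (2 * g p0.2) with hδ
  have hδ0 : 0 < δ := div_pos (by linarith) (by linarith)
  have hw0 : r p0 + δ * g p0.2 < 0 := by
    have : δ * g p0.2 = -r p0 / 2 := by rw [hδ]; field_simp
    linarith
  -- growth
  obtain ⟨M, hM⟩ : ∃ M : ℝ, ∀ p : (Fin n → ℝ) × ℝ, p.2 ≤ h p.1 → p.2 ≤ -M → 0 < r p + δ * g p.2 := by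
    have ht := (tendsto_rpow_atTop (show (0:ℝ) < 1/4 by norm_num)).eventually_gt_atTop (C / δ)
    obtain ⟨M, hM⟩ := Filter.eventually_atTop.1 ht
    refine ⟨max M 0, fun p hpp hpM => ?_⟩
    have y0 : p.2 ≤ 0 := by have := le_max_right M 0; linarith
    have habs : |p.2| = -p.2 := abs_of_nonpos y0
    have h1 : M ≤ 1 + |p.2| := by have := le_max_left M 0; rw [habs]; linarith
    have h2 := hM _ h1
    have pos : 0 < 1 + |p.2| := by positivity
    have h3 : (1 + |p.2|) ^ (3/4:ℝ) ≤ g p.2 := Real.rpow_le_rpow pos.le (by rw [habs, hc]; linarith) (by norm_num)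
    have h4 : (1 + |p.2|) ^ (3/4:ℝ) = (1 + |p.2|) ^ (1/4:ℝ) * Real.sqrt (1 + |p.2|) := by
      rw [Real.sqrt_eq_rpow, ← Real.rpow_add pos]; norm_num
    have h5 : 0 < Real.sqrt (1 + |p.2|) := Real.sqrt_pos.2 pos
    have h6 : C < δ * (1 + |p.2|) ^ (1/4:ℝ) := by
      rw [div_lt_iff₀ hδ0] at h2; linarith
    have h7 := hC p hpp
    have h8 : C * Real.sqrt (1 + |p.2|) < δ * ((1 + |p.2|) ^ (1/4:ℝ) * Real.sqrt (1 + |p.2|)) := by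
      rw [← mul_assoc]; gcongr
    rw [← h4] at h8
    have h9 : δ * (1 + |p.2|) ^ (3/4:ℝ) ≤ δ * g p.2 := by gcongr
    linarith
  set w : (Fin n → ℝ) × ℝ → ℝ := fun p => r p + δ * g p.2 with hw
  set K : Set ((Fin n → ℝ) × ℝ) := (Set.Icc 0 1 ×ˢ Set.Icc (-M) c) ∩ {p | p.2 ≤ h p.1} with hK
  have hKc : IsCompact K := (isCompact_Icc.prod isCompact_Icc).inter_right (isClosed_le continuous_snd (hh.comp continuous_fst))
  have hgc : Continuous fun p : (Fin n → ℝ) × ℝ => g p.2 := by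
    simp only [hg]
    exact (continuous_const.sub continuous_snd).rpow_const fun p => Or.inr (by norm_num)
  have hwc : Continuous w := hr.continuous.add (continuous_const.mul hgc)
  have red : ∀ p : (Fin n → ℝ) × ℝ, p.2 ≤ h p.1 → w p < 0 → ∃ q ∈ K, w q = w p := by
    intro p hpp hwp
    obtain ⟨k, hk⟩ := exists_cell p.1
    refine ⟨(p.1 + fun i => (k i : ℝ), p.2), ⟨⟨cell_subset hk, ?_, ?_⟩, ?_⟩, ?_⟩
    · by_contra hcon; push Not at hcon
      have := hM p hpp hcon.le
      exact absurd hwp (not_lt.2 this.le)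
    · have := hlt p hpp; show p.2 ≤ c; linarith
    · show p.2 ≤ h _
      rw [hp]; exact hpp
    · show r _ + _ = r _ + _
      rw [hrp]
  obtain ⟨q0, hq0, hq0w⟩ := red p0 hp0 hw0
  obtain ⟨q, hqK, hqm⟩ := hKc.exists_isMinOn ⟨q0, hq0⟩ hwc.continuousOn
  have hwq : w q < 0 := by have := hqm hq0; simp only [Set.mem_ofPred_eq] at this; rw [hq0w] at this; exact this.trans_lt hw0
  have gmin : ∀ p : (Fin n → ℝ) × ℝ, p.2 ≤ h p.1 → w q ≤ w p := by
    intro p hpp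
    by_cases hwp : w p < 0
    · obtain ⟨q', hq', e⟩ := red p hpp hwp
      rw [← e]; exact hqm hq'
    · push Not at hwp; linarith
  have hqh : q.2 < h q.1 := by
    refine lt_of_le_of_ne hqK.2 fun e => ?_
    have h1 := hb q.1
    rw [← e] at h1
    have h2 : 0 < g q.2 := Real.rpow_pos_of_pos (by have := hlt q hqK.2; linarith) _
    have : w q = r q + δ * g q.2 := rfl
    have h3 : 0 ≤ r q := h1
    nlinarith [mul_pos hδ0 h2]
  have hopen : IsOpen {p : (Fin n → ℝ) × ℝ | p.2 < h p.1} := isOpen_lt continuous_snd (hh.comp continuous_fst)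
  have lm : ∀ v : (Fin n → ℝ) × ℝ, IsLocalMin (fun t : ℝ => w (q + t • v)) 0 := by
    intro v
    have hcont : Continuous fun t : ℝ => q + t • v := by fun_prop
    have : ∀ᶠ t : ℝ in nhds 0, q + t • v ∈ {p : (Fin n → ℝ) × ℝ | p.2 < h p.1} :=
      hcont.continuousAt.eventually_mem (hopen.mem_nhds (by simpa using hqh))
    filter_upwards [this] with t ht
    simpa using gmin _ (le_of_lt ht)
  have hX : ∀ i, 0 ≤ pdE n (pdE n r (eX n i)) (eX n i) q := by
    intro i
    have h1 : ∀ t : ℝ, HasDerivAt (fun t : ℝ => w (q + t • eX n i)) (pdE n r (eX n i) (q + t • eX n i)) t := by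
      intro t
      have : (fun t : ℝ => w (q + t • eX n i)) = fun t : ℝ => r (q + t • eX n i) + δ * g q.2 := by
        ext t; simp [hw, eX]
      rw [this]
      exact (line_deriv hr q (eX n i) t).add_const _
    have h2 := line_deriv (pdE_smooth hr (eX n i)) q (eX n i) 0
    have := sd_test (Filter.Eventually.of_forall h1) h2 (lm _)
    simpa using this
  have hY : 0 ≤ pdE n (pdE n r (eY n)) (eY n) q + δ * (-(3/16) * (c - q.2)^(-(5/4):ℝ)) := by
    have hqc : q.2 < c := by have := hlt q hqK.2; linarith
    have hh1 : ∀ t : ℝ, HasDerivAt (fun t : ℝ => q.2 + t) 1 t := fun t => (hasDerivAt_id t).const_add _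
    have fe : (fun t : ℝ => w (q + t • eY n)) = fun t : ℝ => r (q + t • eY n) + δ * g (q.2 + t) := by
      ext t; simp [hw, eY]
    have h1 : ∀ᶠ t : ℝ in nhds 0, HasDerivAt (fun t : ℝ => w (q + t • eY n)) (pdE n r (eY n) (q + t • eY n) + δ * (-(3/4) * (c - (q.2 + t))^(-(1/4):ℝ))) t := by
      have : ∀ᶠ t : ℝ in nhds 0, t < c - q.2 := gt_mem_nhds (by linarith)
      filter_upwards [this] with t ht
      rw [fe]
      refine (line_deriv hr q (eY n) t).add (HasDerivAt.const_mul δ ?_)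
      have := (gbar (c := c) (y := q.2 + t) (by linarith)).comp t (hh1 t)
      rw [mul_one] at this
      exact this
    have h2 : HasDerivAt (fun t : ℝ => pdE n r (eY n) (q + t • eY n) + δ * (-(3/4) * (c - (q.2 + t))^(-(1/4):ℝ)))
        (pdE n (pdE n r (eY n)) (eY n) (q + (0:ℝ) • eY n) + δ * (-(3/16) * (c - (q.2 + 0))^(-(5/4):ℝ))) 0 := by
      refine (line_deriv (pdE_smooth hr (eY n)) q (eY n) 0).add (HasDerivAt.const_mul δ ?_)
      have := (gbar2 (c := c) (y := q.2 + 0) (by linarith)).comp 0 (hh1 0)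
      rw [mul_one] at this
      exact this
    have := sd_test h1 h2 (lm _)
    simpa using this
  have hl := hlap q hqh
  unfold lapE at hl
  have hs : 0 ≤ ∑ i, pdE n (pdE n r (eX n i)) (eX n i) q := Finset.sum_nonneg fun i _ => hX i
  have : 0 < (c - q.2)^(-(5/4):ℝ) := Real.rpow_pos_of_pos (by have := hlt q hqK.2; linarith) _
  nlinarith [mul_pos hδ0 this]

end Gal

namespace Gal

variable {n : ℕ}

instance cell_finite : IsFiniteMeasure ((volume : Measure (Fin n → ℝ)).restrict (cell n)) := ⟨by simp [vol_cell]⟩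

lemma cell_deriv {f f' : (Fin n → ℝ) → ℝ → ℝ} (hf : Continuous fun q : (Fin n → ℝ) × ℝ => f q.1 q.2)
    (hf' : Continuous fun q : (Fin n → ℝ) × ℝ => f' q.1 q.2) (hd : ∀ x z, HasDerivAt (f x) (f' x z) z) (z : ℝ) :
    HasDerivAt (fun z => ∫ x in cell n, f x z) (∫ x in cell n, f' x z) z := by
  have hK : IsCompact (Set.Icc (0 : Fin n → ℝ) 1 ×ˢ Set.Icc (z-1) (z+1)) := isCompact_Icc.prod isCompact_Icc
  obtain ⟨M, hM⟩ := hK.exists_bound_of_continuousOn hf'.continuousOn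
  have c1 : ∀ z, Continuous fun x => f x z := fun z => hf.comp (Continuous.prodMk continuous_id continuous_const)
  have c2 : ∀ z, Continuous fun x => f' x z := fun z => hf'.comp (Continuous.prodMk continuous_id continuous_const)
  refine (hasDerivAt_integral_of_dominated_loc_of_deriv_le (F := fun z x => f x z) (F' := fun z x => f' x z) (bound := fun _ => M)
    (s := Set.Icc (z-1) (z+1)) (Icc_mem_nhds (by linarith) (by linarith)) ?_ ?_ ?_ ?_ ?_ ?_).2
  · exact Filter.Eventually.of_forall fun z => (c1 z).aestronglyMeasurable
  · exact integrableOn_cell (c1 z)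
  · exact (c2 z).aestronglyMeasurable
  · refine (ae_restrict_iff' measurableSet_cell).2 (Filter.Eventually.of_forall fun x hx y hy => ?_)
    exact hM (x, y) ⟨cell_subset hx, hy⟩
  · exact integrable_const _
  · exact Filter.Eventually.of_forall fun x y _ => hd x y

lemma cell_cont {f : (Fin n → ℝ) → ℝ → ℝ} (hf : Continuous fun q : (Fin n → ℝ) × ℝ => f q.1 q.2) :
    Continuous fun z => ∫ x in cell n, f x z := by
  have hc : cell n =ᵐ[volume] Set.Icc (0 : Fin n → ℝ) 1 :=
    Measure.univ_pi_Ico_ae_eq_Icc (f := (0 : Fin n → ℝ)) (g := 1)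
  have : (fun z => ∫ x in cell n, f x z) = fun z => ∫ x in Set.Icc (0 : Fin n → ℝ) 1, f x z := by
    ext z; rw [setIntegral_congr_set hc]
  rw [this]
  exact continuous_parametric_integral_of_continuous (f := fun z x => f x z) (hf.comp continuous_swap) isCompact_Icc

lemma comp_pdX {h : (Fin n → ℝ) → ℝ} (hh : ContDiff ℝ (⊤:ℕ∞) h) {r : (Fin n → ℝ) × ℝ → ℝ} (hr : ContDiff ℝ (⊤:ℕ∞) r)
    (z : ℝ) (x : Fin n → ℝ) (i : Fin n) :
    fderiv ℝ (fun x => r (x, z + h x)) x (Pi.single i 1) = pdE n r (eX n i) (x, z + h x) + pdX n h i x * pdE n r (eY n) (x, z + h x) := by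
  have h1 : HasFDerivAt (fun x : Fin n → ℝ => (x, z + h x)) ((ContinuousLinearMap.id ℝ (Fin n → ℝ)).prod (fderiv ℝ h x)) x :=
    (hasFDerivAt_id x).prodMk (((hh.differentiable (by simp) x).hasFDerivAt).const_add z)
  have h2 := ((hr.differentiable (by simp) (x, z + h x)).hasFDerivAt).comp x h1
  have h3 := h2.fderiv
  have : (fun x => r (x, z + h x)) = r ∘ fun x : Fin n → ℝ => (x, z + h x) := rfl
  rw [this, h3]
  simp only [ContinuousLinearMap.comp_apply, ContinuousLinearMap.prod_apply, ContinuousLinearMap.id_apply, pdE, eX, eY, pdX]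
  have : ((Pi.single i 1 : Fin n → ℝ), (fderiv ℝ h x) (Pi.single i 1)) = (Pi.single i 1, (0:ℝ)) + (fderiv ℝ h x) (Pi.single i 1) • ((0 : Fin n → ℝ), (1:ℝ)) := by simp
  rw [this, map_add, map_smul]; rfl

lemma comp_pdZ {h : (Fin n → ℝ) → ℝ} {r : (Fin n → ℝ) × ℝ → ℝ} (hr : ContDiff ℝ (⊤:ℕ∞) r)
    (z : ℝ) (x : Fin n → ℝ) :
    HasDerivAt (fun z => r (x, z + h x)) (pdE n r (eY n) (x, z + h x)) z := by
  have h1 : HasDerivAt (fun z : ℝ => ((x, z + h x) : (Fin n → ℝ) × ℝ)) (eY n) z :=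
    (hasDerivAt_const z x).prodMk ((hasDerivAt_id z).add_const _)
  exact ((hr.differentiable (by simp) _).hasFDerivAt).comp_hasDerivAt z h1

/-- energy flux -/
def Jf (h : (Fin n → ℝ) → ℝ) (u : (Fin n → ℝ) × ℝ → ℝ) (z : ℝ) : ℝ := ∫ x in cell n, u (x, z + h x) *
  (pdE n u (eY n) (x, z + h x) - ∑ i, pdX n h i x * pdE n u (eX n i) (x, z + h x))

def ef (h : (Fin n → ℝ) → ℝ) (u : (Fin n → ℝ) × ℝ → ℝ) (z : ℝ) : ℝ := ∫ x in cell n, gradSqE n u (x, z + h x)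

lemma gradSq_cont {u : (Fin n → ℝ) × ℝ → ℝ} (hu : ContDiff ℝ (⊤:ℕ∞) u) : Continuous (gradSqE n u) := by
  have : ∀ v, Continuous (pdE n u v) := fun v => (pdE_smooth hu v).continuous
  unfold gradSqE
  exact (continuous_finsetSum _ fun i _ => (this _).pow 2).add ((this _).pow 2)

lemma comp_cont {h : (Fin n → ℝ) → ℝ} (hh : ContDiff ℝ (⊤:ℕ∞) h) {r : (Fin n → ℝ) × ℝ → ℝ} (hr : Continuous r) : Continuous fun q : (Fin n → ℝ) × ℝ => r (q.1, q.2 + h q.1) :=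
  hr.comp (continuous_fst.prodMk (continuous_snd.add (hh.continuous.comp continuous_fst)))

lemma ef_cont {h : (Fin n → ℝ) → ℝ} (hh : ContDiff ℝ (⊤:ℕ∞) h) {u : (Fin n → ℝ) × ℝ → ℝ} (hu : ContDiff ℝ (⊤:ℕ∞) u) : Continuous (ef h u) := cell_cont (f := fun x z => gradSqE n u (x, z + h x)) (comp_cont hh (gradSq_cont hu))

lemma Jf_deriv {h : (Fin n → ℝ) → ℝ} (hh : ContDiff ℝ (⊤:ℕ∞) h) (hp : ZPeriodic n h) {u : (Fin n → ℝ) × ℝ → ℝ} (hu : ContDiff ℝ (⊤:ℕ∞) u) (hup : ZPeriodicE n u)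
    (harm : ∀ p : (Fin n → ℝ) × ℝ, p.2 < h p.1 → lapE n u p = 0) {z : ℝ} (hz : z < 0) :
    HasDerivAt (Jf h u) (ef h u z) z := by
  have cu : ∀ v, Continuous (pdE n u v) := fun v => (pdE_smooth hu v).continuous
  have cuu : ∀ v w, Continuous (pdE n (pdE n u v) w) := fun v w => (pdE_smooth (pdE_smooth hu v) w).continuous
  have ch : ∀ i, Continuous fun q : (Fin n → ℝ) × ℝ => pdX n h i q.1 := fun i => (pdX_smooth hh i).continuous.comp continuous_fst
  have c0 := comp_cont hh hu.continuous
  have c1 := fun v => comp_cont hh (cu v)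
  have c2 := fun v w => comp_cont hh (cuu v w)
  have key := cell_deriv (n := n)
    (f := fun x z => u (x, z + h x) * (pdE n u (eY n) (x, z + h x) - ∑ i, pdX n h i x * pdE n u (eX n i) (x, z + h x)))
    (f' := fun x z => pdE n u (eY n) (x, z + h x) * (pdE n u (eY n) (x, z + h x) - ∑ i, pdX n h i x * pdE n u (eX n i) (x, z + h x))
      + u (x, z + h x) * (pdE n (pdE n u (eY n)) (eY n) (x, z + h x) - ∑ i, pdX n h i x * pdE n (pdE n u (eX n i)) (eY n) (x, z + h x)))
    (c0.mul ((c1 _).sub (continuous_finsetSum _ fun i _ => (ch i).mul (c1 _))))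
    (((c1 _).mul ((c1 _).sub (continuous_finsetSum _ fun i _ => (ch i).mul (c1 _)))).add
      (c0.mul ((c2 _ _).sub (continuous_finsetSum _ fun i _ => (ch i).mul (c2 _ _)))))
    (fun x z => (comp_pdZ hu z x).mul ((comp_pdZ (pdE_smooth hu _) z x).sub
      (HasDerivAt.fun_sum fun i _ => (comp_pdZ (pdE_smooth hu _) z x).const_mul _))) z
  refine HasDerivAt.congr_deriv (f := Jf h u) key ?_
  -- divergence terms
  set dv : Fin n → (Fin n → ℝ) → ℝ := fun i x =>
    (pdE n u (eX n i) (x, z + h x) + pdX n h i x * pdE n u (eY n) (x, z + h x)) * pdE n u (eX n i) (x, z + h x)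
      + u (x, z + h x) * (pdE n (pdE n u (eX n i)) (eX n i) (x, z + h x) + pdX n h i x * pdE n (pdE n u (eX n i)) (eY n) (x, z + h x)) with hdv
  have sl : ∀ {r : (Fin n → ℝ) × ℝ → ℝ}, ContDiff ℝ (⊤:ℕ∞) r → ContDiff ℝ (⊤:ℕ∞) fun x => r (x, z + h x) := fun hr =>
    hr.comp (contDiff_id.prodMk (contDiff_const.add hh))
  have dv0 : ∀ i, ∫ x in cell n, dv i x = 0 := by
    intro i
    have hs : ContDiff ℝ 1 fun x => u (x, z + h x) * pdE n u (eX n i) (x, z + h x) :=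
      ((sl hu).mul (sl (pdE_smooth hu _))).of_le (by exact_mod_cast le_top)
    have := ibp hs (fun x k => by simp only [hp x k, hup x _ k, pdE_per hup _ x _ k]) i
    rw [← this]
    congr 1; ext x
    have e := ((sl hu).differentiable (by simp) x).hasFDerivAt.mul (((sl (pdE_smooth hu (eX n i))).differentiable (by simp) x).hasFDerivAt)
    have e' : fderiv ℝ (fun x => u (x, z + h x) * pdE n u (eX n i) (x, z + h x)) x = _ := e.fderiv
    rw [e']
    simp only [add_apply, smul_apply, smul_eq_mul, comp_pdX hh hu, comp_pdX hh (pdE_smooth hu (eX n i)), hdv]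
    ring
  have slc : ∀ {r : (Fin n → ℝ) × ℝ → ℝ}, Continuous r → Continuous fun x => r (x, z + h x) := fun hr =>
    hr.comp (continuous_id.prodMk (continuous_const.add hh.continuous))
  have dvc : ∀ i, Continuous (dv i) := fun i =>
    (((slc (cu _)).add ((pdX_smooth hh i).continuous.mul (slc (cu _)))).mul (slc (cu _))).add
    ((slc hu.continuous).mul ((slc (cuu _ _)).add ((pdX_smooth hh i).continuous.mul (slc (cuu _ _)))))
  have hsum : ∫ x in cell n, ∑ i, dv i x = 0 := by
    rw [integral_finsetSum _ fun i _ => integrableOn_cell (dvc i)]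
    simp [dv0]
  have : ef h u z = ∫ x in cell n, (gradSqE n u (x, z + h x) - ∑ i, dv i x) := by
    rw [integral_sub (integrableOn_cell (slc (gradSq_cont hu))) (integrableOn_cell (continuous_finsetSum _ fun i _ => dvc i)), hsum, sub_zero]
    rfl
  rw [this]
  congr 1; ext x
  have hl := harm (x, z + h x) (by simp; exact hz)
  unfold lapE at hl
  unfold gradSqE
  have e1 : pdE n (pdE n u (eY n)) (eY n) (x, z + h x) = - ∑ i, pdE n (pdE n u (eX n i)) (eX n i) (x, z + h x) := by linarith
  rw [e1]
  simp only [hdv, mul_sub, mul_neg, Finset.mul_sum, add_mul, mul_add, Finset.sum_add_distrib]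
  have s1 : ∑ i, pdE n u (eY n) (x, z + h x) * (pdX n h i x * pdE n u (eX n i) (x, z + h x)) = ∑ i, pdX n h i x * pdE n u (eY n) (x, z + h x) * pdE n u (eX n i) (x, z + h x) :=
    Finset.sum_congr rfl fun i _ => by ring
  simp only [pow_two, s1]
  ring

end Gal

namespace Gal

variable {n : ℕ}

lemma cell_zero {f : (Fin n → ℝ) → ℝ} (hf : Continuous f) (hp : ZPeriodic n f) (h0 : ∀ x, 0 ≤ f x)
    (hi : ∫ x in cell n, f x ≤ 0) : ∀ x, f x = 0 := by
  have h1 : ∫ x in cell n, f x = 0 := le_antisymm hi (integral_nonneg h0)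
  have h2 := (integral_eq_zero_iff_of_nonneg h0 (integrableOn_cell hf)).1 h1
  have h3 : Set.EqOn f 0 (cell n) := by
    refine Measure.eqOn_of_ae_eq h2 hf.continuousOn continuousOn_const ?_
    unfold cell
    rw [interior_pi_set Set.finite_univ, closure_pi_set]
    refine Set.pi_mono fun i _ => ?_
    exact Ico_subset_closure_interior _ _
  intro x
  obtain ⟨k, hk⟩ := exists_cell x
  rw [← hp x k]; exact h3 hk

lemma cs_int {f : ℝ → ℝ} (hf : Continuous f) {z : ℝ} (hz : z ≤ 0) :
    (∫ s in z..0, f s)^2 ≤ (-z) * ∫ s in z..0, (f s)^2 := by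
  rcases hz.eq_or_lt with rfl | hz
  · simp
  set I := ∫ s in z..0, f s
  set c := I / (-z) with hc
  have hI : c * (-z) = I := by rw [hc]; exact div_mul_cancel₀ _ (neg_ne_zero.2 hz.ne)
  have h0 : 0 ≤ ∫ s in z..0, (f s - c)^2 := intervalIntegral.integral_nonneg hz.le fun s _ => sq_nonneg _
  have e : ∫ s in z..0, (f s - c)^2 = (∫ s in z..0, (f s)^2) - 2 * c * I + c^2 * (-z) := by
    have e1 : (fun s => (f s - c)^2) = fun s => (f s)^2 - 2 * c * f s + c^2 := by ext s; ring
    have i1 : IntervalIntegrable (fun s => (f s)^2) volume z 0 := (hf.pow 2).intervalIntegrable _ _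
    have i2 : IntervalIntegrable (fun s => 2 * c * f s) volume z 0 := (hf.const_mul _).intervalIntegrable _ _
    rw [e1, intervalIntegral.integral_add (i1.sub i2) (by simp), intervalIntegral.integral_sub i1 i2,
      intervalIntegral.integral_const_mul]
    simp; ring
  rw [e] at h0
  have hz' : 0 < -z := by linarith
  nlinarith

lemma log_nonint {e : ℝ → ℝ} {k z1 : ℝ} (hk : 0 < k) (h : ∀ z, z ≤ z1 → k ≤ e z * (-z)) : ¬ IntegrableOn e (Set.Iic 0) := by
  refine not_integrableOn_of_tendsto_norm_atTop_of_deriv_isBigO_filter (f := Real.log) Filter.atBot (Filter.Iic_mem_atBot 0) ?_ ?_ ?_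
  · filter_upwards [Filter.Iio_mem_atBot (0:ℝ)] with x hx
    exact Real.differentiableAt_log (ne_of_lt hx)
  · have h1 := Filter.tendsto_abs_atTop_atTop.comp (Real.tendsto_log_atTop.comp (Filter.tendsto_abs_atBot_atTop (G := ℝ)))
    refine h1.congr fun x => ?_
    simp
  · refine Asymptotics.IsBigO.of_bound k⁻¹ ?_
    filter_upwards [Filter.Iio_mem_atBot (min z1 0)] with x hx
    have hx0 : x < 0 := lt_of_lt_of_le hx (min_le_right _ _)
    have hx1 : x ≤ z1 := le_of_lt (lt_of_lt_of_le hx (min_le_left _ _))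
    have := h x hx1
    have he : 0 < e x := by
      by_contra hcon; push Not at hcon; nlinarith
    rw [Real.deriv_log, norm_inv, Real.norm_of_nonneg he.le, Real.norm_of_nonpos hx0.le]
    have hx' : 0 < -x := by linarith
    rw [inv_le_comm₀ hx' (by positivity), mul_inv, inv_inv]
    rw [← div_eq_mul_inv, div_le_iff₀ he]; linarith

theorem energy_unique {h : (Fin n → ℝ) → ℝ} (hh : ContDiff ℝ (⊤:ℕ∞) h) (hp : ZPeriodic n h) {u : (Fin n → ℝ) × ℝ → ℝ}
    (hu : IsHarmonicExt n h (fun _ => 0) u) : ∀ p : (Fin n → ℝ) × ℝ, p.2 ≤ h p.1 → u p = 0 := by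
  have hus := hu.smooth
  have hup := hu.periodic
  have gc := gradSq_cont hus
  have gn : ∀ p, 0 ≤ gradSqE n u p := fun p => by unfold gradSqE; positivity
  have en : ∀ z, 0 ≤ ef h u z := fun z => integral_nonneg fun x => gn _
  have ec := ef_cont hh hus
  have eint : IntegrableOn (ef h u) (Set.Iio 0) := by
    have h1 : IntegrableOn (fun q : (Fin n → ℝ) × ℝ => gradSqE n u (q.1, q.2 + h q.1)) (cell n ×ˢ Set.Iio 0) := by
      rw [← shear_int hh.continuous]
      simpa [shear] using hu.gradL2
    unfold IntegrableOn at h1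
    rw [Measure.volume_eq_prod, ← Measure.prod_restrict] at h1
    exact h1.integral_prod_right
  set Et := (∫ z in Set.Iio 0, ef h u z) + 1 with hEt
  have hEt0 : 0 < Et := by have := setIntegral_nonneg (μ := volume) measurableSet_Iio fun z (_ : z ∈ Set.Iio (0:ℝ)) => en z; linarith
  have eI : ∀ z, z ≤ 0 → ∫ s in z..0, ef h u s ≤ Et := by
    intro z hz
    rw [intervalIntegral.integral_of_le hz, integral_Ioc_eq_integral_Ioo]
    have := setIntegral_mono_set eint (Filter.Eventually.of_forall en) (HasSubset.Subset.eventuallyLE (Set.Ioo_subset_Iio_self (a := z) (b := 0)))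
    linarith
  have cu : ∀ v, Continuous (pdE n u v) := fun v => (pdE_smooth hus v).continuous
  have cN : Continuous fun q : (Fin n → ℝ) × ℝ => (pdE n u (eY n) (q.1, q.2 + h q.1) - ∑ i, pdX n h i q.1 * pdE n u (eX n i) (q.1, q.2 + h q.1)) :=
    (comp_cont hh (cu _)).sub (continuous_finsetSum _ fun i _ => ((pdX_smooth hh i).continuous.comp continuous_fst).mul (comp_cont hh (cu _)))
  have Jc : Continuous (Jf h u) := cell_cont (f := fun x z => u (x, z + h x) *
    (pdE n u (eY n) (x, z + h x) - ∑ i, pdX n h i x * pdE n u (eX n i) (x, z + h x))) ((comp_cont hh hus.continuous).mul cN)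
  have J0 : Jf h u 0 = 0 := by simp [Jf, hu.boundary]
  have Jeq : ∀ z, z ≤ 0 → Jf h u z = -∫ s in z..0, ef h u s := by
    intro z hz
    have := intervalIntegral.integral_eq_sub_of_hasDerivAt_of_le hz Jc.continuousOn
      (fun s hs => Jf_deriv hh hp hus hup hu.harmonic hs.2) (ec.intervalIntegrable _ _)
    rw [J0] at this; linarith
  have Jmono : ∀ z1 z2, z1 ≤ z2 → z2 ≤ 0 → Jf h u z1 ≤ Jf h u z2 := by
    intro z1 z2 h12 h20
    rw [Jeq z1 (h12.trans h20), Jeq z2 h20, ← intervalIntegral.integral_add_adjacent_intervals (ec.intervalIntegrable z1 z2) (ec.intervalIntegrable z2 0)]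
    have := intervalIntegral.integral_nonneg (μ := volume) h12 fun s _ => en s
    linarith
  have W : ∀ z, z ≤ 0 → ∫ x in cell n, (u (x, z + h x))^2 ≤ (-z) * ∫ s in z..0, ef h u s := by
    intro z hz
    have cg : Continuous fun q : (Fin n → ℝ) × ℝ => gradSqE n u (q.1, q.2 + h q.1) := comp_cont hh gc
    have pt : ∀ x, (u (x, z + h x))^2 ≤ (-z) * ∫ s in z..0, gradSqE n u (x, s + h x) := by
      intro x
      have c1 : Continuous fun s : ℝ => pdE n u (eY n) (x, s + h x) := (cu _).comp (by fun_prop)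
      have c2 : Continuous fun s : ℝ => gradSqE n u (x, s + h x) := gc.comp (by fun_prop)
      have e1 : ∫ s in z..0, pdE n u (eY n) (x, s + h x) = u (x, 0 + h x) - u (x, z + h x) :=
        intervalIntegral.integral_eq_sub_of_hasDerivAt (fun s _ => comp_pdZ hus s x) (c1.intervalIntegrable _ _)
      rw [zero_add, hu.boundary] at e1
      have h2 := cs_int c1 hz
      rw [e1, zero_sub, neg_sq] at h2
      refine h2.trans ?_
      have : 0 ≤ -z := by linarith
      gcongr
      refine intervalIntegral.integral_mono_on hz ((c1.pow 2).intervalIntegrable _ _) (c2.intervalIntegrable _ _) fun s _ => ?_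
      unfold gradSqE
      have : 0 ≤ ∑ i, (pdE n u (eX n i) (x, s + h x))^2 := by positivity
      linarith
    have sw : ∫ s in z..0, ef h u s = ∫ x in cell n, ∫ s in z..0, gradSqE n u (x, s + h x) := by
      refine intervalIntegral_integral_swap (f := fun s x => gradSqE n u (x, s + h x)) ?_
      rw [Set.uIoc_of_le hz]
      have hK : IsCompact (Set.Icc z 0 ×ˢ Set.Icc (0 : Fin n → ℝ) 1) := isCompact_Icc.prod isCompact_Icc
      have := (cg.comp continuous_swap).continuousOn.integrableOn_compact (μ := volume) hK
      have h3 := this.mono_set (Set.prod_mono (Set.Ioc_subset_Icc_self) (cell_subset (n := n)))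
      unfold IntegrableOn at h3
      rw [Measure.volume_eq_prod, ← Measure.prod_restrict] at h3
      exact h3
    rw [sw, ← integral_const_mul]
    refine integral_mono (integrableOn_cell ((hus.continuous.comp (continuous_id.prodMk (continuous_const.add hh.continuous))).pow 2)) ?_ pt
    refine Integrable.const_mul ?_ _
    refine integrableOn_cell ?_
    exact intervalIntegral.continuous_parametric_intervalIntegral_of_continuous' (f := fun x s => gradSqE n u (x, s + h x)) cg z 0
  -- bound for the flux
  obtain ⟨P, hP⟩ : ∃ P, ∀ x, ∑ i, (pdX n h i x)^2 ≤ P := by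
    obtain ⟨P, hP⟩ := per_bdd (n := n) (f := fun x => ∑ i, (pdX n h i x)^2) (continuous_finsetSum _ fun i _ => (pdX_smooth hh i).continuous.pow 2)
      (fun x k => by simp only [pdX_per hp _ x k])
    exact ⟨P, fun x => (le_abs_self _).trans (hP x)⟩
  have hP0 : 0 ≤ P := le_trans (by positivity) (hP 0)
  have Nb : ∀ p x, p = ((x, p.2) : (Fin n → ℝ) × ℝ) → (pdE n u (eY n) p - ∑ i, pdX n h i x * pdE n u (eX n i) p)^2 ≤ 2 * (1 + P) * gradSqE n u p := by
    intro p x _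
    have c := Finset.sum_mul_sq_le_sq_mul_sq Finset.univ (fun i => pdX n h i x) (fun i => pdE n u (eX n i) p)
    unfold gradSqE
    set s := ∑ i, pdX n h i x * pdE n u (eX n i) p
    set Q := ∑ i, (pdE n u (eX n i) p)^2 with hQ
    have hQ0 : 0 ≤ Q := by positivity
    have : s^2 ≤ P * Q := c.trans (by gcongr; exact hP x)
    have h1 : 0 ≤ P * (pdE n u (eY n) p)^2 := by positivity
    nlinarith [sq_nonneg (pdE n u (eY n) p + s)]
  have Jz : ∀ z, z ≤ 0 → Jf h u z = 0 := by
    by_contra hcon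
    push Not at hcon
    obtain ⟨z1, hz1, hJ1⟩ := hcon
    have hJneg : Jf h u z1 < 0 := lt_of_le_of_ne (by have := Jmono z1 0 hz1 le_rfl; rwa [J0] at this) hJ1
    set c := -Jf h u z1 with hc
    have hc0 : 0 < c := by linarith
    have hz1' : z1 < 0 := lt_of_le_of_ne hz1 fun e => hJ1 (by rw [e, J0])
    refine log_nonint (e := ef h u) (k := c^2 / (2 * (1+P) * Et)) (z1 := z1) (by positivity) (fun z hz => ?_) ((integrableOn_Iic_iff_integrableOn_Iio).2 eint)
    have hzn : z < 0 := lt_of_le_of_lt hz hz1'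
    have hzp : 0 < -z := by linarith
    set l := c / ((-z) * Et) with hl
    have hl0 : 0 < l := by positivity
    have hJz : c ≤ -Jf h u z := by have := Jmono z z1 hz hz1; linarith
    have cw : Continuous fun x => u (x, z + h x) := hus.continuous.comp (continuous_id.prodMk (continuous_const.add hh.continuous))
    have cg : Continuous fun x => gradSqE n u (x, z + h x) := gc.comp (continuous_id.prodMk (continuous_const.add hh.continuous))
    have am : -Jf h u z * 2 ≤ l * (∫ x in cell n, (u (x, z + h x))^2) + l⁻¹ * (2 * (1 + P)) * ef h u z := by
      unfold Jf ef
      rw [← integral_neg, ← integral_mul_const, ← integral_const_mul, ← integral_const_mul, ← integral_add]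
      · refine integral_mono ?_ ?_ fun x => ?_
        · refine integrableOn_cell ?_
          have : Continuous fun x => (pdE n u (eY n) (x, z + h x) - ∑ i, pdX n h i x * pdE n u (eX n i) (x, z + h x)) :=
            cN.comp (continuous_id.prodMk continuous_const)
          exact (cw.mul this).neg.mul_const _
        · exact integrableOn_cell (((cw.pow 2).const_mul _).add (cg.const_mul _))
        · have h1 := Nb (x, z + h x) x rfl
          set N := pdE n u (eY n) (x, z + h x) - ∑ i, pdX n h i x * pdE n u (eX n i) (x, z + h x)
          set w := u (x, z + h x)
          have h2 : l⁻¹ * N^2 ≤ l⁻¹ * (2 * (1 + P)) * gradSqE n u (x, z + h x) := by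
            rw [mul_assoc]; gcongr
          have h3 : 0 ≤ l⁻¹ * (l * w + N)^2 := by positivity
          have h4 : l⁻¹ * (l * w + N)^2 = l * w^2 + 2 * (w * N) + l⁻¹ * N^2 := by field_simp; ring
          show -(w * N) * 2 ≤ l * w^2 + l⁻¹ * (2 * (1 + P)) * gradSqE n u (x, z + h x)
          linarith
      · exact integrableOn_cell ((cw.pow 2).const_mul _)
      · exact integrableOn_cell (cg.const_mul _)
    have hW : l * (∫ x in cell n, (u (x, z + h x))^2) ≤ c := by
      calc _ ≤ l * ((-z) * Et) := by
            gcongr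
            exact (W z hzn.le).trans (by gcongr; exact eI z hzn.le)
        _ = c := by rw [hl]; exact div_mul_cancel₀ _ (by positivity)
    have : c ≤ l⁻¹ * (2 * (1 + P)) * ef h u z := by linarith
    rw [hl, inv_div] at this
    rw [div_le_iff₀ (by positivity)]
    have h5 : c * c ≤ c * (((-z) * Et / c) * (2 * (1 + P)) * ef h u z) := by gcongr
    have h6 : c * (((-z) * Et / c) * (2 * (1 + P)) * ef h u z) = ef h u z * (-z) * (2 * (1 + P) * Et) := by field_simp
    rw [h6] at h5; linarith
  intro p hpp
  have h1 := W (p.2 - h p.1) (by linarith)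
  have h2 := Jeq (p.2 - h p.1) (by linarith)
  rw [Jz _ (by linarith)] at h2
  have h3 : ∫ s in (p.2 - h p.1)..0, ef h u s = 0 := by linarith
  rw [h3, mul_zero] at h1
  have := cell_zero (f := fun x => (u (x, p.2 - h p.1 + h x))^2) ((hus.continuous.comp (continuous_id.prodMk (continuous_const.add hh.continuous))).pow 2)
    (fun x k => by simp only [hp x k, hup x _ k]) (fun x => sq_nonneg _) h1 p.1
  simpa using this

end Gal

namespace Gal

variable {n : ℕ}

lemma pdE_fun_add {u w : (Fin n → ℝ) × ℝ → ℝ} (hu : ContDiff ℝ (⊤:ℕ∞) u) (hw : ContDiff ℝ (⊤:ℕ∞) w) (v) :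
    pdE n (fun p => u p + w p) v = fun p => pdE n u v p + pdE n w v p := by
  ext p; unfold pdE
  rw [fderiv_fun_add (hu.differentiable (by simp) p) (hw.differentiable (by simp) p)]; rfl

lemma pdE_fun_sub {u w : (Fin n → ℝ) × ℝ → ℝ} (hu : ContDiff ℝ (⊤:ℕ∞) u) (hw : ContDiff ℝ (⊤:ℕ∞) w) (v) :
    pdE n (fun p => u p - w p) v = fun p => pdE n u v p - pdE n w v p := by
  ext p; unfold pdE
  rw [fderiv_fun_sub (hu.differentiable (by simp) p) (hw.differentiable (by simp) p)]; rfl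

lemma pdE_fun_smul {u : (Fin n → ℝ) × ℝ → ℝ} (hu : ContDiff ℝ (⊤:ℕ∞) u) (c : ℝ) (v) :
    pdE n (fun p => c * u p) v = fun p => c * pdE n u v p := by
  ext p; unfold pdE
  rw [fderiv_const_mul (hu.differentiable (by simp) p)]; rfl

lemma pdE_fun_mul {u w : (Fin n → ℝ) × ℝ → ℝ} (hu : ContDiff ℝ (⊤:ℕ∞) u) (hw : ContDiff ℝ (⊤:ℕ∞) w) (v) :
    pdE n (fun p => u p * w p) v = fun p => u p * pdE n w v p + w p * pdE n u v p := by
  ext p; unfold pdE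
  rw [fderiv_fun_mul (hu.differentiable (by simp) p) (hw.differentiable (by simp) p)]; rfl

lemma pdE_const (c : ℝ) (v) : pdE n (fun _ => c) v = fun _ => 0 := by
  ext p; unfold pdE; simp

lemma lapE_add {u w : (Fin n → ℝ) × ℝ → ℝ} (hu : ContDiff ℝ (⊤:ℕ∞) u) (hw : ContDiff ℝ (⊤:ℕ∞) w) (p) :
    lapE n (fun p => u p + w p) p = lapE n u p + lapE n w p := by
  unfold lapE
  simp only [pdE_fun_add hu hw, pdE_fun_add (pdE_smooth hu _) (pdE_smooth hw _), Finset.sum_add_distrib]; ring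

lemma lapE_sub {u w : (Fin n → ℝ) × ℝ → ℝ} (hu : ContDiff ℝ (⊤:ℕ∞) u) (hw : ContDiff ℝ (⊤:ℕ∞) w) (p) :
    lapE n (fun p => u p - w p) p = lapE n u p - lapE n w p := by
  unfold lapE
  simp only [pdE_fun_sub hu hw, pdE_fun_sub (pdE_smooth hu _) (pdE_smooth hw _), Finset.sum_sub_distrib]; ring

lemma lapE_smul {u : (Fin n → ℝ) × ℝ → ℝ} (hu : ContDiff ℝ (⊤:ℕ∞) u) (c : ℝ) (p) :
    lapE n (fun p => c * u p) p = c * lapE n u p := by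
  unfold lapE
  simp only [pdE_fun_smul hu, pdE_fun_smul (pdE_smooth hu _), ← Finset.mul_sum]; ring

lemma lapE_const (c : ℝ) (p) : lapE n (fun _ => c) p = 0 := by
  unfold lapE; simp only [pdE_const]; simp

lemma pdE_comm {u : (Fin n → ℝ) × ℝ → ℝ} (hu : ContDiff ℝ (⊤:ℕ∞) u) (v w) (p) :
    pdE n (pdE n u v) w p = pdE n (pdE n u w) v p := by
  have hs : IsSymmSndFDerivAt ℝ u p := hu.contDiffAt.isSymmSndFDerivAt (by rw [minSmoothness_of_isRCLikeNormedField]; exact WithTop.coe_le_coe.2 le_top)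
  have hd : DifferentiableAt ℝ (fderiv ℝ u) p := (hu.fderiv_right (m := (⊤:ℕ∞)) (by simp)).differentiable (by simp) p
  have e : ∀ v w, pdE n (pdE n u v) w p = fderiv ℝ (fderiv ℝ u) p w v := by
    intro v w
    unfold pdE
    rw [fderiv_clm_apply hd (differentiableAt_const _)]; simp
  rw [e, e]; exact hs w v

lemma lapE_smooth {u : (Fin n → ℝ) × ℝ → ℝ} (hu : ContDiff ℝ (⊤:ℕ∞) u) : ContDiff ℝ (⊤:ℕ∞) (lapE n u) := by
  unfold lapE
  exact (ContDiff.sum fun i _ => pdE_smooth (pdE_smooth hu _) _).add (pdE_smooth (pdE_smooth hu _) _)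

lemma lapE_pdE {u : (Fin n → ℝ) × ℝ → ℝ} (hu : ContDiff ℝ (⊤:ℕ∞) u) (v) (p) :
    lapE n (pdE n u v) p = pdE n (lapE n u) v p := by
  have e : ∀ w, pdE n (pdE n (pdE n u v) w) w p = pdE n (pdE n (pdE n u w) w) v p := by
    intro w
    have : pdE n (pdE n u v) w = pdE n (pdE n u w) v := funext fun q => pdE_comm hu v w q
    rw [this, pdE_comm (pdE_smooth hu w)]
  have hd : ∀ w, DifferentiableAt ℝ (fun q => pdE n (pdE n u w) w q) p := fun w => (pdE_smooth (pdE_smooth hu w) w).differentiable (by simp) p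
  unfold lapE
  simp only [e]
  have : pdE n (fun p => ∑ i, pdE n (pdE n u (eX n i)) (eX n i) p + pdE n (pdE n u (eY n)) (eY n) p) v p
     = fderiv ℝ (fun p => ∑ i, pdE n (pdE n u (eX n i)) (eX n i) p + pdE n (pdE n u (eY n)) (eY n) p) p v := rfl
  rw [this, fderiv_fun_add (DifferentiableAt.fun_sum fun i _ => hd _) (hd _), fderiv_fun_sum fun i _ => hd _]
  simp only [add_apply, sum_apply]; rfl

/-- functions vanishing on the open fluid domain have vanishing derivatives up to the boundary -/
lemma vanish_closure {h : (Fin n → ℝ) → ℝ} {u : (Fin n → ℝ) × ℝ → ℝ} (hu : Continuous u)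
    (h0 : ∀ p : (Fin n → ℝ) × ℝ, p.2 < h p.1 → u p = 0) : ∀ p : (Fin n → ℝ) × ℝ, p.2 ≤ h p.1 → u p = 0 := by
  intro p hp
  have c : Continuous fun s : ℝ => u (p.1, p.2 - s) := hu.comp (by fun_prop)
  have t1 : Filter.Tendsto (fun s : ℝ => u (p.1, p.2 - s)) (nhdsWithin 0 (Set.Ioi 0)) (nhds (u (p.1, p.2 - 0))) :=
    (c.tendsto 0).mono_left nhdsWithin_le_nhds
  have t2 : Filter.Tendsto (fun s : ℝ => u (p.1, p.2 - s)) (nhdsWithin 0 (Set.Ioi 0)) (nhds 0) := by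
    refine tendsto_const_nhds.congr' ?_
    filter_upwards [self_mem_nhdsWithin] with s hs
    have hs' : (0:ℝ) < s := hs
    exact (h0 (p.1, p.2 - s) (by simp only; linarith)).symm
  have := tendsto_nhds_unique t1 t2
  simpa using this

lemma vanish_pd {h : (Fin n → ℝ) → ℝ} (hh : Continuous h) {u : (Fin n → ℝ) × ℝ → ℝ} (hu : ContDiff ℝ (⊤:ℕ∞) u)
    (h0 : ∀ p : (Fin n → ℝ) × ℝ, p.2 < h p.1 → u p = 0) (v) : ∀ p : (Fin n → ℝ) × ℝ, p.2 ≤ h p.1 → pdE n u v p = 0 := by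
  refine vanish_closure (pdE_smooth hu v).continuous fun p hp => ?_
  have ho : IsOpen {p : (Fin n → ℝ) × ℝ | p.2 < h p.1} := isOpen_lt continuous_snd (hh.comp continuous_fst)
  have : u =ᶠ[nhds p] fun _ => 0 := by
    filter_upwards [ho.mem_nhds hp] with q hq using h0 q hq
  unfold pdE; rw [this.fderiv_eq]; simp

/-- harmonic extension in the low-growth class -/
structure HExt (h ψ : (Fin n → ℝ) → ℝ) (u : (Fin n → ℝ) × ℝ → ℝ) : Prop where
  smooth : ContDiff ℝ (⊤ : ℕ∞) u
  periodic : ZPeriodicE n u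
  harmonic : ∀ p : (Fin n → ℝ) × ℝ, p.2 < h p.1 → lapE n u p = 0
  boundary : ∀ x, u (x, h x) = ψ x
  growth : ∃ C, ∀ p : (Fin n → ℝ) × ℝ, p.2 ≤ h p.1 → |u p| ≤ C * Real.sqrt (1 + |p.2|)

lemma HExt.add {h ψ ψ' : (Fin n → ℝ) → ℝ} {u w : (Fin n → ℝ) × ℝ → ℝ} (hu : HExt h ψ u) (hw : HExt h ψ' w) :
    HExt h (fun x => ψ x + ψ' x) (fun p => u p + w p) where
  smooth := hu.smooth.add hw.smooth
  periodic x y k := by simp only [hu.periodic x y k, hw.periodic x y k]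
  harmonic p hp := by rw [lapE_add hu.smooth hw.smooth, hu.harmonic p hp, hw.harmonic p hp, add_zero]
  boundary x := by rw [hu.boundary, hw.boundary]
  growth := by
    obtain ⟨C, hC⟩ := hu.growth
    obtain ⟨D, hD⟩ := hw.growth
    refine ⟨C + D, fun p hp => (abs_add_le _ _).trans ?_⟩
    rw [add_mul]; exact add_le_add (hC p hp) (hD p hp)

lemma HExt.smul {h ψ : (Fin n → ℝ) → ℝ} {u : (Fin n → ℝ) × ℝ → ℝ} (c : ℝ) (hu : HExt h ψ u) :
    HExt h (fun x => c * ψ x) (fun p => c * u p) where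
  smooth := contDiff_const.mul hu.smooth
  periodic x y k := by simp only [hu.periodic x y k]
  harmonic p hp := by rw [lapE_smul hu.smooth, hu.harmonic p hp, mul_zero]
  boundary x := by rw [hu.boundary]
  growth := by
    obtain ⟨C, hC⟩ := hu.growth
    refine ⟨|c| * C, fun p hp => ?_⟩
    rw [abs_mul, mul_assoc]; exact mul_le_mul_of_nonneg_left (hC p hp) (abs_nonneg _)

lemma HExt.const (h : (Fin n → ℝ) → ℝ) (c : ℝ) : HExt h (fun _ => c) (fun _ => c) where
  smooth := contDiff_const
  periodic x y k := rfl
  harmonic p hp := lapE_const c p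
  boundary x := rfl
  growth := ⟨|c|, fun p _ => le_mul_of_one_le_right (abs_nonneg _) (by rw [Real.one_le_sqrt]; simp)⟩

lemma HExt.sub {h ψ ψ' : (Fin n → ℝ) → ℝ} {u w : (Fin n → ℝ) × ℝ → ℝ} (hu : HExt h ψ u) (hw : HExt h ψ' w) :
    HExt h (fun x => ψ x - ψ' x) (fun p => u p - w p) := by
  have := hu.add (hw.smul (-1))
  simpa [sub_eq_add_neg] using this

lemma HExt.nonneg {h ψ : (Fin n → ℝ) → ℝ} (hh : Continuous h) (hp : ZPeriodic n h) {u : (Fin n → ℝ) × ℝ → ℝ} (hu : HExt h ψ u)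
    (hψ : ∀ x, 0 ≤ ψ x) : ∀ p : (Fin n → ℝ) × ℝ, p.2 ≤ h p.1 → 0 ≤ u p := by
  obtain ⟨C, hC⟩ := hu.growth
  exact max_principle hh hp hu.smooth hu.periodic (fun p hp => (hu.harmonic p hp).le) (fun x => by rw [hu.boundary]; exact hψ x) C
    fun p hp => (abs_le.1 (hC p hp)).1

lemma HExt.unique {h ψ : (Fin n → ℝ) → ℝ} (hh : Continuous h) (hp : ZPeriodic n h) {u w : (Fin n → ℝ) × ℝ → ℝ} (hu : HExt h ψ u)
    (hw : HExt h ψ w) : ∀ p : (Fin n → ℝ) × ℝ, p.2 ≤ h p.1 → u p = w p := by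
  intro p hpp
  have h1 := (hu.sub hw).nonneg hh hp (by simp) p hpp
  have h2 := (hw.sub hu).nonneg hh hp (by simp) p hpp
  linarith

lemma pd_eq {h : (Fin n → ℝ) → ℝ} (hh : Continuous h) {u w : (Fin n → ℝ) × ℝ → ℝ} (hu : ContDiff ℝ (⊤:ℕ∞) u)
    (hw : ContDiff ℝ (⊤:ℕ∞) w) (he : ∀ p : (Fin n → ℝ) × ℝ, p.2 ≤ h p.1 → u p = w p) (v) :
    ∀ p : (Fin n → ℝ) × ℝ, p.2 ≤ h p.1 → pdE n u v p = pdE n w v p := by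
  intro p hp
  have := vanish_pd hh (hu.sub hw) (fun p hp => by rw [he p hp.le, sub_self]) v p hp
  rw [pdE_fun_sub hu hw] at this
  exact sub_eq_zero.1 this

lemma gradSq_sub {u w : (Fin n → ℝ) × ℝ → ℝ} (hu : ContDiff ℝ (⊤:ℕ∞) u) (hw : ContDiff ℝ (⊤:ℕ∞) w) (p) :
    gradSqE n (fun p => u p - w p) p ≤ 2 * gradSqE n u p + 2 * gradSqE n w p := by
  unfold gradSqE
  simp only [pdE_fun_sub hu hw]
  have : ∀ a b : ℝ, (a - b)^2 ≤ 2 * a^2 + 2 * b^2 := fun a b => by nlinarith [sq_nonneg (a + b)]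
  have s := Finset.sum_le_sum fun i (_ : i ∈ Finset.univ) => this (pdE n u (eX n i) p) (pdE n w (eX n i) p)
  rw [Finset.sum_add_distrib, ← Finset.mul_sum, ← Finset.mul_sum] at s
  have := this (pdE n u (eY n) p) (pdE n w (eY n) p)
  linarith

lemma ext_sub {h ψ : (Fin n → ℝ) → ℝ} (hh : ContDiff ℝ (⊤:ℕ∞) h) {u w : (Fin n → ℝ) × ℝ → ℝ} (hu : IsHarmonicExt n h ψ u)
    (hw : IsHarmonicExt n h ψ w) : IsHarmonicExt n h (fun _ => 0) (fun p => u p - w p) where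
  smooth := hu.smooth.sub hw.smooth
  periodic x y k := by simp only [hu.periodic x y k, hw.periodic x y k]
  harmonic p hp := by rw [lapE_sub hu.smooth hw.smooth, hu.harmonic p hp, hw.harmonic p hp, sub_zero]
  boundary x := by rw [hu.boundary, hw.boundary, sub_self]
  gradL2 := by
    have hi := (hu.gradL2.const_mul 2).add (hw.gradL2.const_mul 2)
    refine hi.mono' (gradSq_cont (hu.smooth.sub hw.smooth)).aestronglyMeasurable (Filter.Eventually.of_forall fun p => ?_)
    rw [Real.norm_of_nonneg (by unfold gradSqE; positivity)]
    exact gradSq_sub hu.smooth hw.smooth p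

lemma slice_smooth {h : (Fin n → ℝ) → ℝ} (hh : ContDiff ℝ (⊤:ℕ∞) h) {u : (Fin n → ℝ) × ℝ → ℝ} (hu : ContDiff ℝ (⊤:ℕ∞) u) :
    ContDiff ℝ (⊤:ℕ∞) fun x => u (x, h x) := hu.comp (contDiff_id.prodMk hh)

lemma slice_per {h : (Fin n → ℝ) → ℝ} (hp : ZPeriodic n h) {u : (Fin n → ℝ) × ℝ → ℝ} (hu : ZPeriodicE n u) :
    ZPeriodic n fun x => u (x, h x) := fun x k => by simp only [hp x k, hu x _ k]

lemma ext_good {h ψ : (Fin n → ℝ) → ℝ} (hh : ContDiff ℝ (⊤:ℕ∞) h) (hp : ZPeriodic n h) {u : (Fin n → ℝ) × ℝ → ℝ} (hu : IsHarmonicExt n h ψ u) :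
    HExt h ψ u ∧ ∃ D, ∀ p : (Fin n → ℝ) × ℝ, p.2 ≤ h p.1 → gradSqE n u p ≤ D := by
  have e : (fun x => u (x, h x)) = ψ := funext hu.boundary
  obtain ⟨w, hw, ⟨C, hC⟩, D, hD⟩ := exists_ext hh hp (e ▸ slice_smooth hh hu.smooth) (e ▸ slice_per hp hu.periodic)
  have he : ∀ p : (Fin n → ℝ) × ℝ, p.2 ≤ h p.1 → u p = w p := fun p hpp =>
    sub_eq_zero.1 (energy_unique hh hp (ext_sub hh hu hw) p hpp)
  refine ⟨⟨hu.smooth, hu.periodic, hu.harmonic, hu.boundary, C, fun p hpp => by rw [he p hpp]; exact hC p hpp⟩, D, fun p hpp => ?_⟩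
  refine le_trans (le_of_eq ?_) (hD p hpp)
  unfold gradSqE
  simp only [pd_eq hh.continuous hu.smooth hw.smooth he _ p hpp]

lemma ops_eq {h ψ : (Fin n → ℝ) → ℝ} (hh : ContDiff ℝ (⊤:ℕ∞) h) (hp : ZPeriodic n h) {u : (Fin n → ℝ) × ℝ → ℝ} (hu : HExt h ψ u) (x) :
    DtN n h ψ x = pdE n u (eY n) (x, h x) - ∑ i, pdX n h i x * pdE n u (eX n i) (x, h x) ∧
    Bop n h ψ x = pdE n u (eY n) (x, h x) ∧ ∀ i, Vop n h ψ x i = pdE n u (eX n i) (x, h x) := by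
  have e : (fun x => u (x, h x)) = ψ := funext hu.boundary
  have H : ∃ φ, IsHarmonicExt n h ψ φ := by
    obtain ⟨w, hw, _⟩ := exists_ext hh hp (e ▸ slice_smooth hh hu.smooth) (e ▸ slice_per hp hu.periodic)
    exact ⟨w, hw⟩
  have hc := (ext_good hh hp H.choose_spec).1
  have he := HExt.unique hh.continuous hp hc hu
  have hd := fun v => pd_eq hh.continuous hc.smooth hu.smooth he v (x, h x) le_rfl
  unfold DtN Bop Vop
  simp only [dif_pos H, hd]
  exact ⟨trivial, trivial, fun i => trivial⟩

lemma HExt.pd {h ψ : (Fin n → ℝ) → ℝ} (hh : ContDiff ℝ (⊤:ℕ∞) h) {u : (Fin n → ℝ) × ℝ → ℝ} (hu : HExt h ψ u)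
    (hD : ∃ D, ∀ p : (Fin n → ℝ) × ℝ, p.2 ≤ h p.1 → gradSqE n u p ≤ D) (v) (hv : v = eY n ∨ ∃ i, v = eX n i) :
    HExt h (fun x => pdE n u v (x, h x)) (pdE n u v) where
  smooth := pdE_smooth hu.smooth v
  periodic := pdE_per hu.periodic v
  harmonic p hp := by rw [lapE_pdE hu.smooth]; exact vanish_pd hh.continuous (lapE_smooth hu.smooth) hu.harmonic v p hp.le
  boundary x := rfl
  growth := by
    obtain ⟨D, hD⟩ := hD
    have hb : ∀ p, (pdE n u v p)^2 ≤ gradSqE n u p := by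
      intro p
      unfold gradSqE
      rcases hv with rfl | ⟨i, rfl⟩
      · have : 0 ≤ ∑ i, (pdE n u (eX n i) p)^2 := by positivity
        linarith
      · have := Finset.single_le_sum (f := fun i => (pdE n u (eX n i) p)^2) (fun i _ => sq_nonneg _) (Finset.mem_univ i)
        have h2 := sq_nonneg (pdE n u (eY n) p)
        linarith
    refine ⟨Real.sqrt D, fun p hp => ?_⟩
    have h1 : |pdE n u v p| ≤ Real.sqrt D := Real.abs_le_sqrt ((hb p).trans (hD p hp))
    exact h1.trans (le_mul_of_one_le_right (Real.sqrt_nonneg _) (by rw [Real.one_le_sqrt]; simp))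

lemma exists_hext {h ψ : (Fin n → ℝ) → ℝ} (hh : ContDiff ℝ (⊤:ℕ∞) h) (hp : ZPeriodic n h) (hψ : ContDiff ℝ (⊤:ℕ∞) ψ) (hψp : ZPeriodic n ψ) :
    ∃ u, HExt h ψ u ∧ ∃ D, ∀ p : (Fin n → ℝ) × ℝ, p.2 ≤ h p.1 → gradSqE n u p ≤ D := by
  obtain ⟨w, hw, _⟩ := exists_ext hh hp hψ hψp
  exact ⟨w, ext_good hh hp hw⟩

lemma slice_pd {h : (Fin n → ℝ) → ℝ} (hh : ContDiff ℝ (⊤:ℕ∞) h) {u : (Fin n → ℝ) × ℝ → ℝ} (hu : ContDiff ℝ (⊤:ℕ∞) u) (i x) :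
    pdX n (fun x => u (x, h x)) i x = pdE n u (eX n i) (x, h x) + pdX n h i x * pdE n u (eY n) (x, h x) := by
  have := comp_pdX hh hu 0 x i
  simp only [zero_add] at this
  exact this

lemma left_min {f : ℝ → ℝ} {f' : ℝ} (hf : HasDerivAt f f' 0) (h : ∀ z, z ≤ 0 → f 0 ≤ f z) : f' ≤ 0 := by
  have := (hasDerivAt_iff_tendsto_slope_left_right.1 hf).1
  refine le_of_tendsto this ?_
  filter_upwards [self_mem_nhdsWithin] with z hz
  have hz' : z < 0 := hz
  rw [slope_def_field]
  exact div_nonpos_of_nonneg_of_nonpos (by linarith [h z hz'.le]) (by linarith)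

/-- Sign of the normal derivative at a minimum. -/
lemma HExt.gmin {h ψ : (Fin n → ℝ) → ℝ} (hh : ContDiff ℝ (⊤:ℕ∞) h) (hp : ZPeriodic n h) {u : (Fin n → ℝ) × ℝ → ℝ} (hu : HExt h ψ u)
    (hψ : ∀ x, 0 ≤ ψ x) {x0} (h0 : ψ x0 = 0) : DtN n h ψ x0 ≤ 0 := by
  have hn := hu.nonneg hh.continuous hp hψ
  have e : (fun x => u (x, h x)) = ψ := funext hu.boundary
  have hg : ∀ i, pdX n ψ i x0 = 0 := by
    intro i
    have : IsLocalMin ψ x0 := Filter.Eventually.of_forall fun x => by rw [h0]; exact hψ x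
    unfold pdX; rw [this.fderiv_eq_zero]; simp
  have hy : pdE n u (eY n) (x0, h x0) ≤ 0 := by
    have hd := comp_pdZ (h := h) hu.smooth 0 x0
    rw [zero_add] at hd
    refine left_min hd fun z hz => ?_
    rw [zero_add, hu.boundary, h0]
    exact hn _ (by simp only; linarith)
  have hv : ∀ i, pdE n u (eX n i) (x0, h x0) = - (pdX n h i x0 * pdE n u (eY n) (x0, h x0)) := by
    intro i
    have h1 := slice_pd hh hu.smooth i x0
    rw [e, hg i] at h1; linarith
  rw [(ops_eq hh hp hu x0).1]
  simp only [hv]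
  have : ∑ i, pdX n h i x0 * -(pdX n h i x0 * pdE n u (eY n) (x0, h x0)) = - (∑ i, (pdX n h i x0)^2) * pdE n u (eY n) (x0, h x0) := by
    rw [neg_mul, Finset.sum_mul, ← Finset.sum_neg_distrib]
    exact Finset.sum_congr rfl fun i _ => by ring
  rw [this]
  have : 0 ≤ ∑ i, (pdX n h i x0)^2 := by positivity
  nlinarith

end Gal

namespace Gal

variable {n : ℕ}

lemma HExt.sum {ι : Type*} (s : Finset ι) {h : (Fin n → ℝ) → ℝ} {ψ : ι → (Fin n → ℝ) → ℝ} {u : ι → (Fin n → ℝ) × ℝ → ℝ}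
    (hu : ∀ i, HExt h (ψ i) (u i)) : HExt h (fun x => ∑ i ∈ s, ψ i x) (fun p => ∑ i ∈ s, u i p) := by
  induction s using Finset.induction_on with
  | empty => simpa using HExt.const h 0
  | insert i s hi ih => simp only [Finset.sum_insert hi]; exact (hu i).add ih

lemma pdE_fun_sum {ι : Type*} (s : Finset ι) {u : ι → (Fin n → ℝ) × ℝ → ℝ} (hu : ∀ i, ContDiff ℝ (⊤:ℕ∞) (u i)) (v) :
    pdE n (fun p => ∑ i ∈ s, u i p) v = fun p => ∑ i ∈ s, pdE n (u i) v p := by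
  ext p; unfold pdE
  rw [fderiv_fun_sum fun i _ => (hu i).differentiable (by simp) p]; simp

lemma HExt.congr {h ψ ψ' : (Fin n → ℝ) → ℝ} {u : (Fin n → ℝ) × ℝ → ℝ} (hu : HExt h ψ u) (e : ∀ x, ψ x = ψ' x) : HExt h ψ' u := by
  have : ψ = ψ' := funext e
  exact this ▸ hu

/-- DtN in terms of a chosen extension -/
def Nd (h : (Fin n → ℝ) → ℝ) (u : (Fin n → ℝ) × ℝ → ℝ) (x : Fin n → ℝ) : ℝ :=
  pdE n u (eY n) (x, h x) - ∑ i, pdX n h i x * pdE n u (eX n i) (x, h x)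

lemma Nd_add {h : (Fin n → ℝ) → ℝ} {u w : (Fin n → ℝ) × ℝ → ℝ} (hu : ContDiff ℝ (⊤:ℕ∞) u) (hw : ContDiff ℝ (⊤:ℕ∞) w) (x) :
    Nd h (fun p => u p + w p) x = Nd h u x + Nd h w x := by
  unfold Nd
  simp only [pdE_fun_add hu hw, mul_add, Finset.sum_add_distrib]; ring

lemma Nd_sub {h : (Fin n → ℝ) → ℝ} {u w : (Fin n → ℝ) × ℝ → ℝ} (hu : ContDiff ℝ (⊤:ℕ∞) u) (hw : ContDiff ℝ (⊤:ℕ∞) w) (x) :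
    Nd h (fun p => u p - w p) x = Nd h u x - Nd h w x := by
  unfold Nd
  simp only [pdE_fun_sub hu hw, mul_sub, Finset.sum_sub_distrib]; ring

lemma Nd_smul {h : (Fin n → ℝ) → ℝ} {u : (Fin n → ℝ) × ℝ → ℝ} (hu : ContDiff ℝ (⊤:ℕ∞) u) (c x) :
    Nd h (fun p => c * u p) x = c * Nd h u x := by
  unfold Nd
  simp only [pdE_fun_smul hu, mul_sub, Finset.mul_sum]
  congr 1; exact Finset.sum_congr rfl fun i _ => by ring

lemma Nd_const {h : (Fin n → ℝ) → ℝ} (c x) : Nd (n := n) h (fun _ => c) x = 0 := by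
  unfold Nd; simp [pdE_const]

lemma Nd_sum {ι : Type*} (s : Finset ι) {h : (Fin n → ℝ) → ℝ} {u : ι → (Fin n → ℝ) × ℝ → ℝ} (hu : ∀ i, ContDiff ℝ (⊤:ℕ∞) (u i)) (x) :
    Nd h (fun p => ∑ i ∈ s, u i p) x = ∑ i ∈ s, Nd h (u i) x := by
  induction s using Finset.induction_on with
  | empty => simpa using Nd_const 0 x
  | insert i s hi ih => 
    simp only [Finset.sum_insert hi]
    rw [Nd_add (hu i) (ContDiff.sum fun i _ => hu i), ih]

/-- the static package at one time -/
structure Static (h : (Fin n → ℝ) → ℝ) (φ q l : (Fin n → ℝ) × ℝ → ℝ) : Prop where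
  hh : ContDiff ℝ (⊤:ℕ∞) h
  hp : ZPeriodic n h
  hφ : HExt h h φ
  hD : ∃ D, ∀ p : (Fin n → ℝ) × ℝ, p.2 ≤ h p.1 → gradSqE n φ p ≤ D
  hq : HExt h (fun x => (pdE n φ (eY n) (x, h x))^2 + ∑ i, (pdE n φ (eX n i) (x, h x))^2) q
  pos : ∀ x, 0 < 1 - pdE n φ (eY n) (x, h x)
  hl : HExt h (fun x => Real.log (1 - pdE n φ (eY n) (x, h x))) l

lemma exists_static {h : (Fin n → ℝ) → ℝ} (hh : ContDiff ℝ (⊤:ℕ∞) h) (hp : ZPeriodic n h)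
    (ha : ∀ x, 0 < 1 - Bop n h h x) : ∃ φ q l, Static h φ q l := by
  obtain ⟨φ, hφ, hD⟩ := exists_hext hh hp hh hp
  have hB := fun x => (ops_eq hh hp hφ x).2.1
  have hs : ∀ v, ContDiff ℝ (⊤:ℕ∞) fun x => pdE n φ v (x, h x) := fun v => slice_smooth hh (pdE_smooth hφ.smooth v)
  have hper : ∀ v, ZPeriodic n fun x => pdE n φ v (x, h x) := fun v => slice_per hp (pdE_per hφ.periodic v)
  have pos : ∀ x, 0 < 1 - pdE n φ (eY n) (x, h x) := fun x => by rw [← hB]; exact ha x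
  obtain ⟨q, hq, _⟩ := exists_hext hh hp (ψ := fun x => (pdE n φ (eY n) (x, h x))^2 + ∑ i, (pdE n φ (eX n i) (x, h x))^2)
    (((hs _).pow 2).add (ContDiff.sum fun i _ => (hs _).pow 2)) (fun x k => by simp only [hper _ x k])
  obtain ⟨l, hl, _⟩ := exists_hext hh hp (ψ := fun x => Real.log (1 - pdE n φ (eY n) (x, h x)))
    ((contDiff_const.sub (hs _)).log fun x => (pos x).ne') (fun x k => by simp only [hper _ x k])
  exact ⟨φ, q, l, hh, hp, hφ, hD, hq, pos, hl⟩

namespace Static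
variable {h : (Fin n → ℝ) → ℝ} {φ q l : (Fin n → ℝ) × ℝ → ℝ}

lemma hY (S : Static h φ q l) : HExt h (fun x => pdE n φ (eY n) (x, h x)) (pdE n φ (eY n)) := S.hφ.pd S.hh S.hD _ (Or.inl rfl)
lemma hX (S : Static h φ q l) (i) : HExt h (fun x => pdE n φ (eX n i) (x, h x)) (pdE n φ (eX n i)) := S.hφ.pd S.hh S.hD _ (Or.inr ⟨i, rfl⟩)

lemma dtn (S : Static h φ q l) {ψ u} (hu : HExt h ψ u) (x) : DtN n h ψ x = Nd h u x := (ops_eq S.hh S.hp hu x).1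

lemma V_eq (S : Static h φ q l) (i x) : pdE n φ (eX n i) (x, h x) = (1 - pdE n φ (eY n) (x, h x)) * pdX n h i x := by
  have h1 := slice_pd S.hh S.hφ.smooth i x
  rw [show (fun x => φ (x, h x)) = h from funext S.hφ.boundary] at h1
  linarith

lemma gam_nonpos (S : Static h φ q l) (x) :
    Nd h q x - 2 * pdE n φ (eY n) (x, h x) * Nd h (pdE n φ (eY n)) x - 2 * ∑ i, pdE n φ (eX n i) (x, h x) * Nd h (pdE n φ (eX n i)) x ≤ 0 := by
  set b := pdE n φ (eY n) (x, h x) with hb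
  set w := fun i => pdE n φ (eX n i) (x, h x) with hw
  have E := ((S.hq.sub (S.hY.smul (2*b))).sub ((HExt.sum Finset.univ fun i => (S.hX i).smul (w i)).smul 2)).add (HExt.const h (b^2 + ∑ i, (w i)^2))
  have e : ∀ z, (pdE n φ (eY n) (z, h z))^2 + ∑ i, (pdE n φ (eX n i) (z, h z))^2 - 2*b*pdE n φ (eY n) (z, h z) - 2 * ∑ i, w i * pdE n φ (eX n i) (z, h z) + (b^2 + ∑ i, (w i)^2)
     = (pdE n φ (eY n) (z, h z) - b)^2 + ∑ i, (pdE n φ (eX n i) (z, h z) - w i)^2 := by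
    intro z
    have : ∑ i, (pdE n φ (eX n i) (z, h z) - w i)^2 = ∑ i, (pdE n φ (eX n i) (z, h z))^2 - 2 * ∑ i, w i * pdE n φ (eX n i) (z, h z) + ∑ i, (w i)^2 := by
      rw [Finset.mul_sum, ← Finset.sum_sub_distrib, ← Finset.sum_add_distrib]
      exact Finset.sum_congr rfl fun i _ => by ring
    rw [this]; ring
  have E' := E.congr e
  have g := E'.gmin S.hh S.hp (fun z => by positivity) (x0 := x) (by simp [hb, hw])
  rw [S.dtn E'] at g
  have sX : ∀ i, ContDiff ℝ (⊤:ℕ∞) (pdE n φ (eX n i)) := fun i => (S.hX i).smooth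
  have sS : ∀ i, ContDiff ℝ (⊤:ℕ∞) fun p => w i * pdE n φ (eX n i) p := fun i => contDiff_const.mul (sX i)
  have sSS : ContDiff ℝ (⊤:ℕ∞) fun p => ∑ i, w i * pdE n φ (eX n i) p := ContDiff.sum fun i _ => sS i
  have sB : ContDiff ℝ (⊤:ℕ∞) fun p => 2 * b * pdE n φ (eY n) p := contDiff_const.mul S.hY.smooth
  rw [Nd_add ((S.hq.smooth.sub sB).sub (contDiff_const.mul sSS)) contDiff_const, Nd_sub (S.hq.smooth.sub sB) (contDiff_const.mul sSS),
    Nd_sub S.hq.smooth sB, Nd_smul S.hY.smooth, Nd_smul sSS, Nd_sum _ sS, Nd_const] at g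
  simp only [Nd_smul (sX _)] at g
  linarith

lemma log_ineq (S : Static h φ q l) (x) :
    - Nd h (pdE n φ (eY n)) x ≤ (1 - pdE n φ (eY n) (x, h x)) * Nd h l x := by
  set a := 1 - pdE n φ (eY n) (x, h x) with ha
  have ha0 : 0 < a := S.pos x
  have E := (((HExt.const h 1).sub S.hY).smul (a⁻¹)).sub S.hl |>.add (HExt.const h (Real.log a - 1))
  have g := E.gmin S.hh S.hp (fun z => ?_) (x0 := x) (by rw [← ha, inv_mul_cancel₀ ha0.ne']; ring)
  · rw [S.dtn E] at g
    have s1 : ContDiff ℝ (⊤:ℕ∞) fun p => 1 - pdE n φ (eY n) p := contDiff_const.sub S.hY.smooth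
    rw [Nd_add ((contDiff_const.mul s1).sub S.hl.smooth) contDiff_const, Nd_sub (contDiff_const.mul s1) S.hl.smooth, Nd_smul s1,
      Nd_sub contDiff_const S.hY.smooth, Nd_const, Nd_const] at g
    have h1 : a * (a⁻¹ * (0 - Nd h (pdE n φ (eY n)) x)) = - Nd h (pdE n φ (eY n)) x := by field_simp; ring
    rw [← h1]
    exact mul_le_mul_of_nonneg_left (by linarith) ha0.le
  · have h1 := Real.log_le_sub_one_of_pos (div_pos (S.pos z) ha0)
    rw [Real.log_div (S.pos z).ne' ha0.ne', div_eq_inv_mul] at h1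
    linarith

lemma div_eq (S : Static h φ q l) (x) :
    ∑ i, pdX n (fun z => pdE n φ (eX n i) (z, h z)) i x = - Nd h (pdE n φ (eY n)) x := by
  simp only [fun i => slice_pd S.hh (S.hX i).smooth i x, Finset.sum_add_distrib]
  have hl := vanish_closure (lapE_smooth S.hφ.smooth).continuous S.hφ.harmonic (x, h x) le_rfl
  unfold lapE at hl
  unfold Nd
  simp only [fun i => pdE_comm S.hφ.smooth (eX n i) (eY n) (x, h x)]
  linarith

lemma gam_eq (S : Static h φ q l) (x) :
    Nd h q x - 2 * pdE n φ (eY n) (x, h x) * Nd h (pdE n φ (eY n)) x - 2 * ∑ i, pdE n φ (eX n i) (x, h x) * Nd h (pdE n φ (eX n i)) x =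
    (1 + ∑ i, (pdX n h i x)^2) * (pdE n q (eY n) (x, h x) - 2 * pdE n φ (eY n) (x, h x) * pdE n (pdE n φ (eY n)) (eY n) (x, h x)
      - 2 * ∑ i, pdE n φ (eX n i) (x, h x) * pdE n (pdE n φ (eY n)) (eX n i) (x, h x)) := by
  set W : (Fin n → ℝ) × ℝ → ℝ := fun p => q p - (pdE n φ (eY n) p * pdE n φ (eY n) p + ∑ i, pdE n φ (eX n i) p * pdE n φ (eX n i) p) with hW
  have sY := S.hY.smooth
  have sX := fun i => (S.hX i).smooth
  have sYY := sY.mul sY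
  have sXX := fun i => (sX i).mul (sX i)
  have sS : ContDiff ℝ (⊤:ℕ∞) fun p => ∑ i, pdE n φ (eX n i) p * pdE n φ (eX n i) p := ContDiff.sum fun i _ => sXX i
  have sW : ContDiff ℝ (⊤:ℕ∞) W := S.hq.smooth.sub (sYY.add sS)
  have dW : ∀ v p, pdE n W v p = pdE n q v p - 2 * pdE n φ (eY n) p * pdE n (pdE n φ (eY n)) v p - 2 * ∑ i, pdE n φ (eX n i) p * pdE n (pdE n φ (eX n i)) v p := by
    intro v p
    rw [hW, pdE_fun_sub S.hq.smooth (sYY.add sS), pdE_fun_add sYY sS, pdE_fun_mul sY sY, pdE_fun_sum _ sXX]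
    simp only [pdE_fun_mul (sX _) (sX _), Finset.mul_sum]
    have : ∑ i, (pdE n φ (eX n i) p * pdE n (pdE n φ (eX n i)) v p + pdE n φ (eX n i) p * pdE n (pdE n φ (eX n i)) v p) = ∑ i, 2 * (pdE n φ (eX n i) p * pdE n (pdE n φ (eX n i)) v p) :=
      Finset.sum_congr rfl fun i _ => by ring
    rw [this]; ring
  have W0 : (fun x => W (x, h x)) = fun _ => 0 := by
    ext z; simp only [hW, S.hq.boundary, pow_two, sub_self]
  have hWi : ∀ i, pdE n W (eX n i) (x, h x) = - (pdX n h i x * pdE n W (eY n) (x, h x)) := by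
    intro i
    have := slice_pd S.hh sW i x
    rw [W0] at this
    simp only [pdX, fderiv_fun_const] at this
    have h2 : (0:ℝ) = pdE n W (eX n i) (x, h x) + pdX n h i x * pdE n W (eY n) (x, h x) := this
    linarith
  have N1 : Nd h W x = (1 + ∑ i, (pdX n h i x)^2) * pdE n W (eY n) (x, h x) := by
    unfold Nd
    simp only [hWi, add_mul, Finset.sum_mul, one_mul, mul_neg, Finset.sum_neg_distrib, sub_neg_eq_add]
    congr 1; exact Finset.sum_congr rfl fun i _ => by ring
  have N2 : Nd h W x = Nd h q x - 2 * pdE n φ (eY n) (x, h x) * Nd h (pdE n φ (eY n)) x - 2 * ∑ i, pdE n φ (eX n i) (x, h x) * Nd h (pdE n φ (eX n i)) x := by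
    unfold Nd
    simp only [dW, mul_sub, Finset.mul_sum, Finset.sum_sub_distrib]
    have s1 : ∑ i, pdX n h i x * (2 * pdE n φ (eY n) (x, h x) * pdE n (pdE n φ (eY n)) (eX n i) (x, h x)) = ∑ i, 2 * pdE n φ (eY n) (x, h x) * (pdX n h i x * pdE n (pdE n φ (eY n)) (eX n i) (x, h x)) :=
      Finset.sum_congr rfl fun i _ => by ring
    have s2 : ∑ i, ∑ j, pdX n h i x * (2 * (pdE n φ (eX n j) (x, h x) * pdE n (pdE n φ (eX n j)) (eX n i) (x, h x))) =
      ∑ j, ∑ i, 2 * (pdE n φ (eX n j) (x, h x) * (pdX n h i x * pdE n (pdE n φ (eX n j)) (eX n i) (x, h x))) := by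
      rw [Finset.sum_comm]
      exact Finset.sum_congr rfl fun i _ => Finset.sum_congr rfl fun j _ => by ring
    rw [s1, s2]; ring
  rw [← N2, N1, dW]
  simp only [fun i => pdE_comm S.hφ.smooth (eX n i) (eY n) (x, h x)]

end Static

end Gal

namespace Gal

variable {n : ℕ}

section
variable {E : Type*} [NormedAddCommGroup E] [NormedSpace ℝ E]

lemma tderiv {F : ℝ × E → ℝ} (hF : ContDiff ℝ (⊤:ℕ∞) F) (s : ℝ) (p : E) :
    HasDerivAt (fun s => F (s, p)) (fderiv ℝ F (s, p) (1, 0)) s := by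
  have h1 : HasDerivAt (fun s : ℝ => ((s, p) : ℝ × E)) (1, 0) s := (hasDerivAt_id s).prodMk (hasDerivAt_const s p)
  exact ((hF.differentiable (by simp) _).hasFDerivAt).comp_hasDerivAt s h1

lemma pd_smooth' {F : ℝ × E → ℝ} (hF : ContDiff ℝ (⊤:ℕ∞) F) (w) : ContDiff ℝ (⊤:ℕ∞) fun q => fderiv ℝ F q w :=
  (hF.fderiv_right (m := (⊤:ℕ∞)) (by simp)).clm_apply contDiff_const

lemma pd_comm' {F : ℝ × E → ℝ} (hF : ContDiff ℝ (⊤:ℕ∞) F) (v w q) :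
    fderiv ℝ (fun q => fderiv ℝ F q v) q w = fderiv ℝ (fun q => fderiv ℝ F q w) q v := by
  have hs : IsSymmSndFDerivAt ℝ F q := hF.contDiffAt.isSymmSndFDerivAt (by rw [minSmoothness_of_isRCLikeNormedField]; exact WithTop.coe_le_coe.2 le_top)
  have hd : DifferentiableAt ℝ (fderiv ℝ F) q := (hF.fderiv_right (m := (⊤:ℕ∞)) (by simp)).differentiable (by simp) q
  rw [fderiv_clm_apply hd (differentiableAt_const _), fderiv_clm_apply hd (differentiableAt_const _)]
  simpa using hs w v

lemma lip_t {f f' : ℝ → ℝ} {t s C : ℝ} (hf : ∀ r, HasDerivAt f (f' r) r) (h0 : f t = 0) (hC : ∀ r, |r - t| ≤ |s - t| → |f' r| ≤ C) :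
    |f s| ≤ C * |s - t| := by
  have := Convex.norm_image_sub_le_of_norm_hasDerivWithin_le (f := f) (f' := f') (s := Metric.closedBall t |s - t|) (C := C) (x := t) (y := s)
    (fun r _ => (hf r).hasDerivWithinAt) (fun r hr => hC r (by simpa [Real.dist_eq] using hr)) (convex_closedBall _ _)
    (by simp) (by simp [Real.dist_eq])
  simpa [h0] using this

lemma taylor_t {F : ℝ × E → ℝ} (hF : ContDiff ℝ (⊤:ℕ∞) F) {K : Set E} (hK : IsCompact K) (t : ℝ) (h0 : ∀ p ∈ K, F (t, p) = 0)
    (h1 : ∀ p ∈ K, fderiv ℝ F (t, p) (1, 0) = 0) : ∃ C, 0 ≤ C ∧ ∀ s, |s - t| ≤ 1 → ∀ p ∈ K, |F (s, p)| ≤ C * (s - t)^2 := by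
  have h2 := pd_smooth' (pd_smooth' hF (1, 0)) (1, 0)
  have hc : IsCompact (Set.Icc (t-1) (t+1) ×ˢ K) := isCompact_Icc.prod hK
  obtain ⟨C, hC⟩ := hc.exists_bound_of_continuousOn h2.continuous.continuousOn
  refine ⟨|C|, abs_nonneg _, fun s hs p hp => ?_⟩
  have b1 : ∀ r, |r - t| ≤ 1 → |fderiv ℝ F (r, p) (1, 0)| ≤ |C| * |r - t| := by
    intro r hr
    refine lip_t (f := fun r => fderiv ℝ F (r, p) (1, 0)) (fun r => tderiv (pd_smooth' hF (1,0)) r p) (h1 p hp) fun r' hr' => ?_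
    have hr2 := abs_le.1 (hr'.trans hr)
    exact (hC (r', p) ⟨⟨by linarith, by linarith⟩, hp⟩).trans (le_abs_self _)
  have := lip_t (f := fun r => F (r, p)) (C := |C| * |s - t|) (s := s) (fun r => tderiv hF r p) (h0 p hp) fun r hr =>
    (b1 r (hr.trans hs)).trans (by gcongr)
  refine this.trans (le_of_eq ?_)
  rw [mul_assoc, ← sq, sq_abs]
end

/-- periodic in space -/
def PerT (F : ℝ × (Fin n → ℝ) → ℝ) : Prop := ∀ s, ZPeriodic n fun x => F (s, x)

lemma unif_bdd {F : ℝ × (Fin n → ℝ) → ℝ} (hF : Continuous F) (hp : PerT F) (t : ℝ) : ∃ C, 0 ≤ C ∧ ∀ s, |s - t| ≤ 1 → ∀ x, |F (s, x)| ≤ C := by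
  have hc : IsCompact (Set.Icc (t-1) (t+1) ×ˢ Set.Icc (0 : Fin n → ℝ) 1) := isCompact_Icc.prod isCompact_Icc
  obtain ⟨C, hC⟩ := hc.exists_bound_of_continuousOn hF.continuousOn
  refine ⟨|C|, abs_nonneg _, fun s hs x => ?_⟩
  obtain ⟨k, hk⟩ := exists_cell x
  rw [← (show F (s, x + fun i => (k i : ℝ)) = F (s, x) from hp s x k)]
  have := abs_le.1 hs
  exact (hC (s, _) ⟨⟨by linarith, by linarith⟩, cell_subset hk⟩).trans (le_abs_self _)

lemma PerT.pd {F : ℝ × (Fin n → ℝ) → ℝ} (hp : PerT F) (w) : PerT fun q => fderiv ℝ F q w := by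
  intro s x k
  have : F = fun q => F (q + (0, fun i => (k i : ℝ))) := by
    ext ⟨r, y⟩; simpa using (hp r y k).symm
  simp only
  conv_rhs => rw [this]
  rw [fderiv_comp_add_right]; simp

structure Flat (t : ℝ) (F : ℝ × (Fin n → ℝ) → ℝ) : Prop where
  smooth : ContDiff ℝ (⊤:ℕ∞) F
  per : PerT F
  v0 : ∀ x, F (t, x) = 0
  v1 : ∀ x, fderiv ℝ F (t, x) (1, 0) = 0

lemma Flat.bound {t : ℝ} {F : ℝ × (Fin n → ℝ) → ℝ} (hF : Flat t F) : ∃ C, 0 ≤ C ∧ ∀ s, |s - t| ≤ 1 → ∀ x, |F (s, x)| ≤ C * (s - t)^2 := by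
  obtain ⟨C, hC, h⟩ := taylor_t hF.smooth (isCompact_Icc (a := (0 : Fin n → ℝ)) (b := 1)) t (fun p _ => hF.v0 p) fun p _ => hF.v1 p
  refine ⟨C, hC, fun s hs x => ?_⟩
  obtain ⟨k, hk⟩ := exists_cell x
  rw [← (show F (s, x + fun i => (k i : ℝ)) = F (s, x) from hF.per s x k)]
  exact h s hs _ (cell_subset hk)

lemma xderiv {F : ℝ × (Fin n → ℝ) → ℝ} (hF : ContDiff ℝ (⊤:ℕ∞) F) (s x i) :
    pdX n (fun x => F (s, x)) i x = fderiv ℝ F (s, x) (0, Pi.single i 1) := by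
  have h1 : HasFDerivAt (fun x : Fin n → ℝ => (s, x)) (ContinuousLinearMap.inr ℝ ℝ (Fin n → ℝ)) x := hasFDerivAt_prodMk_right s x
  have h2 := ((hF.differentiable (by simp) (s, x)).hasFDerivAt).comp x h1
  have h3 : fderiv ℝ (fun x => F (s, x)) x = _ := h2.fderiv
  unfold pdX; rw [h3]; simp

lemma Flat.pd {t : ℝ} {F : ℝ × (Fin n → ℝ) → ℝ} (hF : Flat t F) (i : Fin n) : Flat t fun q => fderiv ℝ F q (0, Pi.single i 1) where
  smooth := pd_smooth' hF.smooth _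
  per := hF.per.pd _
  v0 x := by
    rw [← xderiv hF.smooth]; simp [pdX, hF.v0]
  v1 x := by
    rw [pd_comm' hF.smooth, ← xderiv (pd_smooth' hF.smooth _)]; simp [pdX, hF.v1]

lemma Flat.mul {t : ℝ} {F G : ℝ × (Fin n → ℝ) → ℝ} (hF : Flat t F) (hG : ContDiff ℝ (⊤:ℕ∞) G) (hGp : PerT G) : Flat t fun q => F q * G q where
  smooth := hF.smooth.mul hG
  per s x k := by
    have h1 := hF.per s x k
    have h2 := hGp s x k
    simp only at h1 h2 ⊢
    rw [h1, h2]
  v0 x := by simp [hF.v0]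
  v1 x := by
    rw [fderiv_fun_mul (hF.smooth.differentiable (by simp) _) (hG.differentiable (by simp) _)]
    simp [hF.v0, hF.v1]

lemma Flat.add {t : ℝ} {F G : ℝ × (Fin n → ℝ) → ℝ} (hF : Flat t F) (hG : Flat t G) : Flat t fun q => F q + G q where
  smooth := hF.smooth.add hG.smooth
  per s x k := by
    have h1 := hF.per s x k
    have h2 := hG.per s x k
    simp only at h1 h2 ⊢
    rw [h1, h2]
  v0 x := by simp [hF.v0, hG.v0]
  v1 x := by
    rw [fderiv_fun_add (hF.smooth.differentiable (by simp) _) (hG.smooth.differentiable (by simp) _)]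
    simp [hG.v1, hF.v1]

lemma Flat.sum {t : ℝ} {ι : Type*} (S : Finset ι) {F : ι → ℝ × (Fin n → ℝ) → ℝ} (hF : ∀ i, Flat t (F i)) : Flat t fun q => ∑ i ∈ S, F i q := by
  induction S using Finset.induction_on with
  | empty => 
    simp only [Finset.sum_empty]
    exact ⟨contDiff_const, fun s x k => rfl, fun x => rfl, fun x => by simp⟩
  | insert i s hi ih => simp only [Finset.sum_insert hi]; exact (hF i).add ih

/-- boundary layer exponential -/
def bl (K : ℝ) (h : (Fin n → ℝ) → ℝ) (p : (Fin n → ℝ) × ℝ) : ℝ := Real.exp (-K * (h p.1 - p.2))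

lemma bl_smooth (K : ℝ) {h : (Fin n → ℝ) → ℝ} (hh : ContDiff ℝ (⊤:ℕ∞) h) : ContDiff ℝ (⊤:ℕ∞) (bl K h) := by
  unfold bl
  exact (contDiff_const.mul ((hh.comp contDiff_fst).sub contDiff_snd)).exp

lemma fst_smooth {f : (Fin n → ℝ) → ℝ} (hf : ContDiff ℝ (⊤:ℕ∞) f) : ContDiff ℝ (⊤:ℕ∞) fun p : (Fin n → ℝ) × ℝ => f p.1 := hf.comp contDiff_fst

lemma bl_fd (K : ℝ) {h f : (Fin n → ℝ) → ℝ} (hh : ContDiff ℝ (⊤:ℕ∞) h) (hf : ContDiff ℝ (⊤:ℕ∞) f) (v p : (Fin n → ℝ) × ℝ) :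
    pdE n (fun p => f p.1 * bl K h p) v p = (fderiv ℝ f p.1 v.1 - K * f p.1 * (fderiv ℝ h p.1 v.1 - v.2)) * bl K h p := by
  have d1 : HasFDerivAt (fun p : (Fin n → ℝ) × ℝ => h p.1) ((fderiv ℝ h p.1).comp (ContinuousLinearMap.fst ℝ _ _)) p :=
    (hh.differentiable (by simp) p.1).hasFDerivAt.comp p hasFDerivAt_fst
  have d2 : HasFDerivAt (fun p : (Fin n → ℝ) × ℝ => f p.1) ((fderiv ℝ f p.1).comp (ContinuousLinearMap.fst ℝ _ _)) p :=
    (hf.differentiable (by simp) p.1).hasFDerivAt.comp p hasFDerivAt_fst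
  have d3 : HasFDerivAt (fun p : (Fin n → ℝ) × ℝ => p.2) (ContinuousLinearMap.snd ℝ (Fin n → ℝ) ℝ) p := hasFDerivAt_snd
  have d4 : HasFDerivAt (bl K h) _ p := ((d1.fun_sub d3).const_mul (-K)).exp
  have d5 : fderiv ℝ (fun p => f p.1 * bl K h p) p = _ := (d2.fun_mul d4).fderiv
  unfold pdE; rw [d5]
  simp [bl]; ring

def Aop (K : ℝ) (h f : (Fin n → ℝ) → ℝ) (i : Fin n) (x : Fin n → ℝ) : ℝ := pdX n f i x - K * f x * pdX n h i x

lemma Aop_smooth (K : ℝ) {h f : (Fin n → ℝ) → ℝ} (hh : ContDiff ℝ (⊤:ℕ∞) h) (hf : ContDiff ℝ (⊤:ℕ∞) f) (i) : ContDiff ℝ (⊤:ℕ∞) (Aop K h f i) :=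
  (pdX_smooth hf i).sub ((contDiff_const.mul hf).mul (pdX_smooth hh i))

lemma bl_lap (K : ℝ) {h f : (Fin n → ℝ) → ℝ} (hh : ContDiff ℝ (⊤:ℕ∞) h) (hf : ContDiff ℝ (⊤:ℕ∞) f) (p : (Fin n → ℝ) × ℝ) :
    lapE n (fun p => f p.1 * bl K h p) p = (∑ i, Aop K h (Aop K h f i) i p.1 + K^2 * f p.1) * bl K h p := by
  have e1 : ∀ {f : (Fin n → ℝ) → ℝ}, ContDiff ℝ (⊤:ℕ∞) f → ∀ i, pdE n (fun p => f p.1 * bl K h p) (eX n i) = fun p => Aop K h f i p.1 * bl K h p := by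
    intro f hf i; ext p
    rw [bl_fd K hh hf]; simp [eX, Aop, pdX]
  have e2 : ∀ {f : (Fin n → ℝ) → ℝ}, ContDiff ℝ (⊤:ℕ∞) f → pdE n (fun p => f p.1 * bl K h p) (eY n) = fun p => (fun x => K * f x) p.1 * bl K h p := by
    intro f hf; ext p
    rw [bl_fd K hh hf]; simp [eY]
  unfold lapE
  rw [e2 hf, e2 (contDiff_const.mul hf)]
  simp only [fun i => e1 hf i, fun i => e1 (Aop_smooth K hh hf i) i]
  rw [add_mul, Finset.sum_mul]; ring

lemma Aop_one (K : ℝ) {h : (Fin n → ℝ) → ℝ} (hh : ContDiff ℝ (⊤:ℕ∞) h) (i x) :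
    Aop K h (Aop K h (fun _ => 1) i) i x = K^2 * (pdX n h i x)^2 - K * pdX n (pdX n h i) i x := by
  have : Aop K h (fun _ => 1) i = fun x => (-K) * pdX n h i x := by
    ext x; simp [Aop, pdX]
  rw [this]
  unfold Aop
  have e : pdX n (fun x => (-K) * pdX n h i x) i x = (-K) * pdX n (pdX n h i) i x := by
    have h1 := fderiv_const_mul ((pdX_smooth hh i).differentiable (by simp) x) (-K)
    show fderiv ℝ (fun x => (-K) * pdX n h i x) x (Pi.single i 1) = _
    rw [h1]; rfl
  rw [e]; ring

end Gal

namespace Gal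

variable {n : ℕ}

lemma barrier {h : (Fin n → ℝ) → ℝ} (hh : ContDiff ℝ (⊤:ℕ∞) h) (hp : ZPeriodic n h) {φ Ψ : (Fin n → ℝ) × ℝ → ℝ} (hφ : HExt h h φ)
    (hΨ : ContDiff ℝ (⊤:ℕ∞) Ψ) (hΨp : ZPeriodicE n Ψ) (hΨg : ∃ C, ∀ p : (Fin n → ℝ) × ℝ, p.2 ≤ h p.1 → |Ψ p| ≤ C * Real.sqrt (1 + |p.2|))
    {e : (Fin n → ℝ) → ℝ} (he : ∀ x, e x = h x - Ψ (x, h x)) {K m1 m2 : ℝ} (hK : 1 ≤ K)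
    (hKh : ∀ x, 2 * |∑ i, pdX n (pdX n h i) i x| ≤ K) 
    (h1 : ∀ p : (Fin n → ℝ) × ℝ, p.2 < h p.1 → |lapE n Ψ p| ≤ m1 * bl K h p)
    (h2 : ∀ x, |∑ i, Aop K h (Aop K h e i) i x + K^2 * e x| ≤ m2) (x0 : Fin n → ℝ) :
    |pdE n Ψ (eY n) (x0, h x0) - pdE n φ (eY n) (x0, h x0)| ≤ K * (2 * (m1 + m2)) + K * |e x0| := by
  have hes : ContDiff ℝ (⊤:ℕ∞) e := by
    rw [show e = fun x => h x - Ψ (x, h x) from funext he]; exact hh.sub (slice_smooth hh hΨ)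
  have hep : ZPeriodic n e := by
    intro x k; rw [he, he, hp x k, hΨp]
  set m := 2 * (m1 + m2) with hm
  have b_pos : ∀ p, 0 < bl K h p := fun p => Real.exp_pos _
  have b_le : ∀ p : (Fin n → ℝ) × ℝ, p.2 ≤ h p.1 → bl K h p ≤ 1 := fun p hpp => by
    unfold bl; rw [Real.exp_le_one_iff]; nlinarith
  have b_bd : ∀ x, bl K h (x, h x) = 1 := fun x => by simp [bl]
  have hm2 : 0 ≤ m2 := (abs_nonneg _).trans (h2 x0)
  have hm1 : 0 ≤ m1 := by
    have := (abs_nonneg _).trans (h1 (x0, h x0 - 1) (by simp))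
    exact nonneg_of_mul_nonneg_left this (b_pos _)
  have hm0 : 0 ≤ m := by positivity
  set b1 : (Fin n → ℝ) × ℝ → ℝ := fun p => (fun _ => (1:ℝ)) p.1 * bl K h p with hb1
  set eb : (Fin n → ℝ) × ℝ → ℝ := fun p => e p.1 * bl K h p with heb
  have sb1 : ContDiff ℝ (⊤:ℕ∞) b1 := contDiff_const.mul (bl_smooth K hh)
  have seb : ContDiff ℝ (⊤:ℕ∞) eb := (fst_smooth hes).mul (bl_smooth K hh)
  have lb : ∀ p, bl K h p / 2 ≤ lapE n b1 p := by
    intro p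
    rw [hb1, bl_lap K hh contDiff_const]
    simp only [Aop_one K hh, Finset.sum_sub_distrib, ← Finset.mul_sum]
    have q1 : 0 ≤ ∑ i, (pdX n h i p.1)^2 := by positivity
    have q2 := hKh p.1
    have q3 := le_abs_self (∑ i, pdX n (pdX n h i) i p.1)
    have : 1/2 ≤ K^2 * ∑ i, (pdX n h i p.1)^2 - K * ∑ i, pdX n (pdX n h i) i p.1 + K^2 * 1 := by
      have : 0 ≤ K^2 * ∑ i, (pdX n h i p.1)^2 := by positivity
      nlinarith
    nlinarith [b_pos p]
  set w : (Fin n → ℝ) × ℝ → ℝ := fun p => (Ψ p + eb p) - φ p with hw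
  have sw : ContDiff ℝ (⊤:ℕ∞) w := (hΨ.add seb).sub hφ.smooth
  have lw : ∀ p : (Fin n → ℝ) × ℝ, p.2 < h p.1 → |lapE n w p| ≤ (m1 + m2) * bl K h p := by
    intro p hpp
    rw [hw, lapE_sub (hΨ.add seb) hφ.smooth, lapE_add hΨ seb, hφ.harmonic p hpp, sub_zero, heb, bl_lap K hh hes]
    refine (abs_add_le _ _).trans ?_
    rw [add_mul m1 m2, abs_mul, abs_of_pos (b_pos p)]
    exact add_le_add (h1 p hpp) (mul_le_mul_of_nonneg_right (h2 _) (b_pos p).le)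
  have w0 : ∀ x, w (x, h x) = 0 := fun x => by simp [hw, heb, b_bd, he, hφ.boundary]
  have b1y : ∀ x, pdE n b1 (eY n) (x, h x) = K := fun x => by
    rw [hb1, bl_fd K hh contDiff_const]; simp [eY, b_bd]
  have wy : pdE n w (eY n) (x0, h x0) = pdE n Ψ (eY n) (x0, h x0) + K * e x0 - pdE n φ (eY n) (x0, h x0) := by
    rw [hw, pdE_fun_sub (hΨ.add seb) hφ.smooth, pdE_fun_add hΨ seb]
    simp only
    rw [heb, bl_fd K hh hes]; simp [eY, b_bd]
  obtain ⟨C1, hC1⟩ := hΨg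
  obtain ⟨C2, hC2⟩ := hφ.growth
  obtain ⟨C3, hC3⟩ := per_bdd hes.continuous hep
  have key : ∀ σ : ℝ, |σ| = 1 → σ * pdE n w (eY n) (x0, h x0) ≤ K * m := by
    intro σ hσ
    set r : (Fin n → ℝ) × ℝ → ℝ := fun p => (m - m * b1 p) + σ * w p with hr
    have s1 : ContDiff ℝ (⊤:ℕ∞) fun p => m - m * b1 p := contDiff_const.sub (contDiff_const.mul sb1)
    have sr : ContDiff ℝ (⊤:ℕ∞) r := s1.add (contDiff_const.mul sw)
    have pr : ZPeriodicE n r := by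
      intro x y k
      simp only [hr, hw, hb1, heb, bl, hp x k, hep x k, hΨp x y k, hφ.periodic x y k]
    have nn := max_principle hh.continuous hp sr pr (fun p hpp => ?_) (fun x => ?_) (m + C1 + |C3| + C2) (fun p hpp => ?_)
    · have hd := comp_pdZ (h := h) sr 0 x0
      rw [zero_add] at hd
      have hr0 : r (x0, h x0) = 0 := by simp [hr, hb1, b_bd, w0]
      have := left_min hd fun z hz => by
        rw [zero_add, hr0]; exact nn _ (by simp only; linarith)
      rw [hr, pdE_fun_add s1 (contDiff_const.mul sw), pdE_fun_sub contDiff_const (contDiff_const.mul sb1), pdE_fun_smul sb1, pdE_fun_smul sw, pdE_const] at this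
      simp only [b1y] at this
      linarith
    · rw [hr, lapE_add s1 (contDiff_const.mul sw), lapE_sub contDiff_const (contDiff_const.mul sb1), lapE_smul sb1, lapE_smul sw, lapE_const]
      have q1 : σ * lapE n w p ≤ (m1 + m2) * bl K h p := by
        refine (le_abs_self _).trans ?_
        rw [abs_mul, hσ, one_mul]; exact lw p hpp
      have q2 := mul_le_mul_of_nonneg_left (lb p) hm0
      have q3 : m * (bl K h p / 2) = (m1 + m2) * bl K h p := by rw [hm]; ring
      linarith
    · simp [hr, hb1, b_bd, w0]
    · have hS : 1 ≤ Real.sqrt (1 + |p.2|) := by rw [Real.one_le_sqrt]; simp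
      set S := Real.sqrt (1 + |p.2|)
      have q0 : 0 ≤ m - m * b1 p := by
        have := b_le p hpp
        simp only [hb1, one_mul]
        nlinarith
      have q1 : |w p| ≤ C1 * S + |C3| * S + C2 * S := by
        have a1 : |eb p| ≤ |C3| * S := by
          rw [heb]; simp only; rw [abs_mul, abs_of_pos (b_pos p)]
          calc |e p.1| * bl K h p ≤ |C3| * 1 := mul_le_mul ((hC3 _).trans (le_abs_self _)) (b_le p hpp) (b_pos p).le (abs_nonneg _)
            _ ≤ |C3| * S := by gcongr
        have a2 : |w p| ≤ |Ψ p| + |eb p| + |φ p| := (abs_sub _ _).trans (by gcongr; exact abs_add_le _ _)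
        linarith [hC1 p hpp, hC2 p hpp]
      have q2 : |σ * w p| = |w p| := by rw [abs_mul, hσ, one_mul]
      have q3 := neg_abs_le (σ * w p)
      have q4 : 0 ≤ m * S := by positivity
      show _ ≤ (m - m * b1 p) + σ * w p
      nlinarith
  have k1 := key 1 (by simp)
  have k2 := key (-1) (by simp)
  rw [wy] at k1 k2
  have z1 := mul_le_mul_of_nonneg_left (le_abs_self (e x0)) (by linarith : (0:ℝ) ≤ K)
  have z2 := mul_le_mul_of_nonneg_left (neg_abs_le (e x0)) (by linarith : (0:ℝ) ≤ K)
  rw [abs_le]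
  constructor <;> linarith

end Gal

namespace Gal

variable {n : ℕ}

lemma lapE_per {u : (Fin n → ℝ) × ℝ → ℝ} (hu : ZPeriodicE n u) : ZPeriodicE n (lapE n u) := by
  intro x y k
  unfold lapE
  simp only [pdE_per (pdE_per hu _) _ x y k]

lemma growth_any {h g ψ : (Fin n → ℝ) → ℝ} (hh : Continuous h) (hp : ZPeriodic n h) (hg : Continuous g) (hgp : ZPeriodic n g)
    {u : (Fin n → ℝ) × ℝ → ℝ} (hu : HExt h ψ u) : ∃ C, ∀ p : (Fin n → ℝ) × ℝ, p.2 ≤ g p.1 → |u p| ≤ C * Real.sqrt (1 + |p.2|) := by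
  obtain ⟨C, hC⟩ := hu.growth
  obtain ⟨M1, hM1⟩ := per_bdd hh hp
  obtain ⟨M2, hM2⟩ := per_bdd hg hgp
  have hK : IsCompact (Set.Icc (0 : Fin n → ℝ) 1 ×ˢ Set.Icc (-M1) M2) := isCompact_Icc.prod isCompact_Icc
  obtain ⟨D, hD⟩ := hK.exists_bound_of_continuousOn hu.smooth.continuous.continuousOn
  refine ⟨max C |D|, fun p hpg => ?_⟩
  have hS : 1 ≤ Real.sqrt (1 + |p.2|) := by rw [Real.one_le_sqrt]; simp
  by_cases hc : p.2 ≤ h p.1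
  · exact (hC p hc).trans (by gcongr; exact le_max_left _ _)
  · push Not at hc
    obtain ⟨k, hk⟩ := exists_cell p.1
    have e : u p = u (p.1 + fun i => (k i : ℝ), p.2) := (hu.periodic p.1 p.2 k).symm
    have b1 := abs_le.1 (hM1 p.1)
    have b2 := abs_le.1 (hM2 p.1)
    have := hD (p.1 + fun i => (k i : ℝ), p.2) ⟨cell_subset hk, by simp only; linarith, by simp only; linarith⟩
    rw [← e, Real.norm_eq_abs] at this
    calc |u p| ≤ |D| := this.trans (le_abs_self _)
      _ ≤ max C |D| := le_max_right _ _
      _ ≤ _ := le_mul_of_one_le_right ((abs_nonneg D).trans (le_max_right _ _)) hS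

lemma curve_deriv {u : (Fin n → ℝ) × ℝ → ℝ} (hu : ContDiff ℝ (⊤:ℕ∞) u) {f : ℝ → ℝ} {f' t : ℝ} (hf : HasDerivAt f f' t) (x : Fin n → ℝ) :
    HasDerivAt (fun s => u (x, f s)) (pdE n u (eY n) (x, f t) * f') t := by
  have h1 : HasDerivAt (fun s : ℝ => ((x, f s) : (Fin n → ℝ) × ℝ)) (0, f') t := (hasDerivAt_const t x).prodMk hf
  have h2 := ((hu.differentiable (by simp) (x, f t)).hasFDerivAt).comp_hasDerivAt t h1
  refine HasDerivAt.congr_deriv (f := fun s => u (x, f s)) h2 ?_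
  have : ((0, f') : (Fin n → ℝ) × ℝ) = f' • eY n := by simp [eY]
  rw [this, map_smul, smul_eq_mul, mul_comm]; rfl

theorem time_deriv {h : ℝ → (Fin n → ℝ) → ℝ} (hs : ContDiff ℝ (⊤:ℕ∞) (Function.uncurry h)) (hp : ∀ s, ZPeriodic n (h s)) (t : ℝ)
    {φ χ : (Fin n → ℝ) × ℝ → ℝ} (hφ : HExt (h t) (h t) φ)
    (hχ : HExt (h t) (fun x => (1 - pdE n φ (eY n) (x, h t x)) * deriv (fun s => h s x) t) χ) (x0 : Fin n → ℝ) :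
    HasDerivAt (fun s => Bop n (h s) (h s) x0)
      (pdE n χ (eY n) (x0, h t x0) + pdE n (pdE n φ (eY n)) (eY n) (x0, h t x0) * deriv (fun s => h s x0) t) t := by
  set H : ℝ × (Fin n → ℝ) → ℝ := Function.uncurry h with hH
  have hHp : PerT H := fun s => hp s
  have hst : ∀ s, ContDiff ℝ (⊤:ℕ∞) (h s) := fun s => hs.comp (contDiff_const.prodMk contDiff_id)
  have hd : ∀ x, HasDerivAt (fun s => h s x) (deriv (fun s => h s x) t) t := fun x =>
    (tderiv hs t x).differentiableAt.hasDerivAt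
  set Ψ : ℝ → (Fin n → ℝ) × ℝ → ℝ := fun s p => φ p + (s - t) * χ p with hΨ
  have sΨ : ∀ s, ContDiff ℝ (⊤:ℕ∞) (Ψ s) := fun s => hφ.smooth.add (contDiff_const.mul hχ.smooth)
  have pΨ : ∀ s, ZPeriodicE n (Ψ s) := fun s x y k => by simp only [hΨ, hφ.periodic x y k, hχ.periodic x y k]
  -- the boundary error
  set e : ℝ × (Fin n → ℝ) → ℝ := fun q => H q - (φ (q.2, H q) + (q.1 - t) * χ (q.2, H q)) with he
  have fe : Flat t e := by
    have se : ContDiff ℝ (⊤:ℕ∞) e := by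
      have c : ContDiff ℝ (⊤:ℕ∞) fun q : ℝ × (Fin n → ℝ) => (q.2, H q) := contDiff_snd.prodMk hs
      exact hs.sub ((hφ.smooth.comp c).add ((contDiff_fst.sub contDiff_const).mul (hχ.smooth.comp c)))
    refine ⟨se, fun s x k => ?_, fun x => ?_, fun x => ?_⟩
    · have : H (s, x + fun i => (k i : ℝ)) = H (s, x) := hHp s x k
      simp only [he, this, hφ.periodic x _ k, hχ.periodic x _ k]
    · simp only [he, hH, Function.uncurry]
      rw [hφ.boundary]; ring
    · have h1 := tderiv se t x
      have h2 : HasDerivAt (fun s => e (s, x)) (deriv (fun s => h s x) t - (pdE n φ (eY n) (x, h t x) * deriv (fun s => h s x) t +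
          (1 * χ (x, h t x) + (t - t) * (pdE n χ (eY n) (x, h t x) * deriv (fun s => h s x) t)))) t :=
        (hd x).fun_sub ((curve_deriv hφ.smooth (hd x) x).fun_add (((hasDerivAt_id t).sub_const t).fun_mul (curve_deriv hχ.smooth (hd x) x)))
      rw [h1.unique h2, hχ.boundary]; ring
  have e_eq : ∀ s x, e (s, x) = h s x - Ψ s (x, h s x) := fun s x => rfl
  -- choice of K
  set Hi : Fin n → ℝ × (Fin n → ℝ) → ℝ := fun i q => fderiv ℝ H q (0, Pi.single i 1) with hHi
  have sHi : ∀ i, ContDiff ℝ (⊤:ℕ∞) (Hi i) := fun i => pd_smooth' hs _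
  have pHi : ∀ i, PerT (Hi i) := fun i => hHp.pd _
  have hx1 : ∀ s i, pdX n (h s) i = fun x => Hi i (s, x) := fun s i => funext fun x => xderiv hs s x i
  have hx2 : ∀ s i x, pdX n (pdX n (h s) i) i x = fderiv ℝ (Hi i) (s, x) (0, Pi.single i 1) := fun s i x => by
    rw [hx1]; exact xderiv (sHi i) s x i
  obtain ⟨K0, hK0, hK0b⟩ := unif_bdd (F := fun q => ∑ i, fderiv ℝ (Hi i) q (0, Pi.single i 1))
    (continuous_finsetSum _ fun i _ => (pd_smooth' (sHi i) _).continuous)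
    (fun s x k => Finset.sum_congr rfl fun i _ => (pHi i).pd _ s x k) t
  set K : ℝ := 1 + 2 * K0 with hK
  have hK1 : 1 ≤ K := by linarith
  -- the operator A
  set A : Fin n → (ℝ × (Fin n → ℝ) → ℝ) → ℝ × (Fin n → ℝ) → ℝ := fun i F q => fderiv ℝ F q (0, Pi.single i 1) + F q * (-K * Hi i q) with hA
  have fA : ∀ i F, Flat t F → Flat t (A i F) := fun i F hF => (hF.pd i).add
    (hF.mul (contDiff_const.mul (sHi i)) (fun s x k => by
      have : Hi i (s, x + fun i => (k i : ℝ)) = Hi i (s, x) := pHi i s x k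
      simp only [this]))
  have eA : ∀ i F, Flat t F → ∀ s, Aop K (h s) (fun x => F (s, x)) i = fun x => A i F (s, x) := fun i F hF s => by
    ext x; unfold Aop; rw [xderiv hF.smooth, hx1]; simp only [hA]; ring
  have fP : Flat t fun q => ∑ i, A i (A i e) q + e q * K^2 := (Flat.sum _ fun i => fA i _ (fA i _ fe)).add (fe.mul contDiff_const fun s x k => rfl)
  obtain ⟨C2, hC2, hP⟩ := fP.bound
  obtain ⟨C3, hC3, hE⟩ := fe.bound
  -- the strip
  obtain ⟨M, hM, hMb⟩ := unif_bdd (F := fun q => H q - H (t, q.2)) (hs.continuous.sub (hs.continuous.comp (continuous_const.prodMk continuous_snd)))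
    (fun s x k => by
      have h1 : H (s, x + fun i => (k i : ℝ)) = H (s, x) := hHp s x k
      have h2 : H (t, x + fun i => (k i : ℝ)) = H (t, x) := hHp t x k
      simp only [h1, h2]) t
  set cv : ℝ × ((Fin n → ℝ) × ℝ) → (Fin n → ℝ) × ℝ := fun q => (q.2.1, q.2.2 + H (q.1, q.2.1)) with hcv
  have scv : ContDiff ℝ (⊤:ℕ∞) cv := by
    have a1 : ContDiff ℝ (⊤:ℕ∞) fun q : ℝ × ((Fin n → ℝ) × ℝ) => q.2.1 := contDiff_fst.comp contDiff_snd
    have a2 : ContDiff ℝ (⊤:ℕ∞) fun q : ℝ × ((Fin n → ℝ) × ℝ) => q.2.2 := contDiff_snd.comp contDiff_snd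
    exact a1.prodMk (a2.add (hs.comp (contDiff_fst.prodMk a1)))
  have lφ := lapE_smooth hφ.smooth
  have lχ := lapE_smooth hχ.smooth
  set R : ℝ × ((Fin n → ℝ) × ℝ) → ℝ := fun q => lapE n φ (cv q) + (q.1 - t) * lapE n χ (cv q) with hR
  have sR : ContDiff ℝ (⊤:ℕ∞) R := (lφ.comp scv).add ((contDiff_fst.sub contDiff_const).mul (lχ.comp scv))
  have vφ := vanish_closure lφ.continuous hφ.harmonic
  have vχ := vanish_closure lχ.continuous hχ.harmonic
  have vφ' := vanish_pd (hst t).continuous lφ hφ.harmonic (eY n)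
  have cvt : ∀ x z, z ≤ 0 → (cv (t, (x, z))).2 ≤ h t (cv (t, (x, z))).1 := fun x z hz => by
    simp only [hcv, hH, Function.uncurry]; linarith
  obtain ⟨C1, hC1, hRb⟩ := taylor_t sR (K := Set.Icc (0 : Fin n → ℝ) 1 ×ˢ Set.Icc (-M) 0) (isCompact_Icc.prod isCompact_Icc) t
    (fun p hpK => by
      have := cvt p.1 p.2 hpK.2.2
      simp only [hR, vφ _ this]; ring)
    (fun p hpK => by
      obtain ⟨x, z⟩ := p
      have hc := cvt x z hpK.2.2
      have h1 := tderiv sR t (x, z)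
      have hdz : HasDerivAt (fun s => z + h s x) (deriv (fun s => h s x) t) t := (hd x).const_add z
      have h2 : HasDerivAt (fun s => R (s, (x, z))) (pdE n (lapE n φ) (eY n) (x, z + h t x) * deriv (fun s => h s x) t +
          (1 * lapE n χ (x, z + h t x) + (t - t) * (pdE n (lapE n χ) (eY n) (x, z + h t x) * deriv (fun s => h s x) t))) t :=
        (curve_deriv lφ hdz x).fun_add (((hasDerivAt_id t).sub_const t).fun_mul (curve_deriv lχ hdz x))
      rw [h1.unique h2, vφ' (x, z + h t x) hc, vχ (x, z + h t x) hc]; ring)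
  -- application of the barrier
  have main : ∀ s, |s - t| ≤ 1 → |pdE n (Ψ s) (eY n) (x0, h s x0) - Bop n (h s) (h s) x0| ≤
      (K * (2 * (C1 * Real.exp (K * M) + C2)) + K * C3) * (s - t)^2 := by
    intro s hst1
    obtain ⟨φs, hφs, _⟩ := exists_hext (hst s) (hp s) (hst s) (hp s)
    rw [(ops_eq (hst s) (hp s) hφs x0).2.1]
    have gΨ : ∃ C, ∀ p : (Fin n → ℝ) × ℝ, p.2 ≤ h s p.1 → |Ψ s p| ≤ C * Real.sqrt (1 + |p.2|) := by
      obtain ⟨D1, hD1⟩ := growth_any (hst t).continuous (hp t) (hst s).continuous (hp s) hφ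
      obtain ⟨D2, hD2⟩ := growth_any (hst t).continuous (hp t) (hst s).continuous (hp s) (hχ.smul (s - t))
      refine ⟨D1 + D2, fun p hpp => (abs_add_le _ _).trans ?_⟩
      rw [add_mul]; exact add_le_add (hD1 p hpp) (hD2 p hpp)
    have b := barrier (hst s) (hp s) hφs (sΨ s) (pΨ s) gΨ (e := fun x => e (s, x)) (fun x => e_eq s x) hK1
      (fun x => by
        have := hK0b s hst1 x
        simp only [hx2]; linarith)
      (m1 := C1 * Real.exp (K * M) * (s - t)^2) (m2 := C2 * (s-t)^2) ?_ ?_ x0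
    · refine b.trans ?_
      have := mul_le_mul_of_nonneg_left (hE s hst1 x0) (by linarith : (0:ℝ) ≤ K)
      calc _ ≤ K * (2 * (C1 * Real.exp (K * M) * (s - t) ^ 2 + C2 * (s - t) ^ 2)) + K * (C3 * (s-t)^2) := by gcongr
        _ = _ := by ring
    · intro p hpp
      have lΨ : lapE n (Ψ s) p = lapE n φ p + (s - t) * lapE n χ p := by
        rw [hΨ]; simp only; rw [lapE_add hφ.smooth (contDiff_const.mul hχ.smooth), lapE_smul hχ.smooth]
      have bpos : 0 < bl K (h s) p := Real.exp_pos _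
      by_cases hc : p.2 ≤ h t p.1
      · rw [lΨ, vφ p hc, vχ p hc]; simp only [mul_zero, add_zero, abs_zero]; positivity
      · push Not at hc
        have hb := abs_le.1 (hMb s hst1 p.1)
        have hb2 : h s p.1 - h t p.1 ≤ M := hb.2
        obtain ⟨k, hk⟩ := exists_cell p.1
        have hper : h s (p.1 + fun i => (k i : ℝ)) = h s p.1 := hp s p.1 k
        have e1 : lapE n (Ψ s) p = R (s, (p.1 + (fun i => (k i : ℝ)), p.2 - h s p.1)) := by
          rw [lΨ]; simp only [hR, hcv, hH, Function.uncurry, hper, sub_add_cancel, lapE_per hφ.periodic p.1 _ k, lapE_per hχ.periodic p.1 _ k]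
        have e2 := hRb s hst1 (p.1 + (fun i => (k i : ℝ)), p.2 - h s p.1) ⟨cell_subset hk, by simp only; linarith, by simp only; linarith⟩
        rw [e1]
        refine e2.trans ?_
        have e3 : 1 ≤ Real.exp (K * M) * bl K (h s) p := by
          unfold bl; rw [← Real.exp_add, Real.one_le_exp_iff]; nlinarith
        have e4 : 0 ≤ C1 * (s - t)^2 := by positivity
        calc C1 * (s-t)^2 ≤ C1 * (s-t)^2 * (Real.exp (K * M) * bl K (h s) p) := le_mul_of_one_le_right e4 e3
          _ = _ := by ring
    · intro x
      have := hP s hst1 x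
      simp only [eA _ _ fe, eA _ _ (fA _ _ fe)]
      rw [mul_comm (K^2)]; exact this
  have d1 : HasDerivAt (fun s => pdE n (Ψ s) (eY n) (x0, h s x0) - Bop n (h s) (h s) x0) 0 t := by
    have hO : (fun s => pdE n (Ψ s) (eY n) (x0, h s x0) - Bop n (h s) (h s) x0) =O[nhds t] fun s => ‖s - t‖^2 := by
      refine Asymptotics.IsBigO.of_bound (K * (2 * (C1 * Real.exp (K * M) + C2)) + K * C3) ?_
      filter_upwards [Metric.closedBall_mem_nhds t one_pos] with s hst1
      have := main s (by simpa [Real.dist_eq] using hst1)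
      simpa using this
    have := hO.hasFDerivAt (𝕜 := ℝ) (by norm_num)
    simpa using this.hasDerivAt
  have d2 : HasDerivAt (fun s => pdE n (Ψ s) (eY n) (x0, h s x0))
      (pdE n (pdE n φ (eY n)) (eY n) (x0, h t x0) * deriv (fun s => h s x0) t + (1 * pdE n χ (eY n) (x0, h t x0) + (t - t) * (pdE n (pdE n χ (eY n)) (eY n) (x0, h t x0) * deriv (fun s => h s x0) t))) t := by
    have : (fun s => pdE n (Ψ s) (eY n) (x0, h s x0)) = fun s => pdE n φ (eY n) (x0, h s x0) + (s - t) * pdE n χ (eY n) (x0, h s x0) := by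
      ext s
      rw [hΨ]; simp only
      rw [pdE_fun_add hφ.smooth (contDiff_const.mul hχ.smooth), pdE_fun_smul hχ.smooth]
    rw [this]
    exact (curve_deriv (pdE_smooth hφ.smooth _) (hd x0) x0).fun_add (((hasDerivAt_id t).sub_const t).fun_mul (curve_deriv (pdE_smooth hχ.smooth _) (hd x0) x0))
  have d3 := d2.fun_sub d1
  simp only [sub_sub_cancel] at d3
  exact d3.congr_deriv (by ring)

end Gal

namespace Gal
variable {n : ℕ}

/-- the entropy profile -/
def Fent (a : ℝ) : ℝ := (1 / Real.sqrt a) * Real.log (1 / Real.sqrt a)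

lemma Fent_deriv {a : ℝ} (ha : 0 < a) :
    HasDerivAt Fent ((Real.log (Real.sqrt a) - 1) / (2 * (Real.sqrt a)^3)) a := by
  have hr : 0 < Real.sqrt a := Real.sqrt_pos.2 ha
  have h1 := (Real.hasDerivAt_sqrt ha.ne').fun_inv hr.ne'
  have h2 := h1.fun_mul (h1.log (inv_pos.2 hr).ne')
  have e : Fent = fun a => (Real.sqrt a)⁻¹ * Real.log (Real.sqrt a)⁻¹ := by
    ext a; simp only [Fent, one_div]
  rw [e]
  refine HasDerivAt.congr_deriv h2 ?_
  rw [Real.log_inv]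
  have := hr.ne'
  field_simp
  ring

lemma final_alg {r N Nl g v D w lam : ℝ} (hr : 0 < r) (hg : g ≤ 0) (hN : -N ≤ r^2 * Nl)
    (hv : v = - lam / r) (hD : D = (lam - 1) / (2 * r^3)) (hw : w = g - r^2 * N) :
    -D * w + 1/2 * N * v + r * (-(1/2) * Nl) + (-g / (2 * r^2)) * v ≤ 0 := by
  have e : -D * w + 1/2 * N * v + r * (-(1/2) * Nl) + (-g / (2 * r^2)) * v = g / (2*r^3) + (1/(2*r)) * (-N - r^2 * Nl) := by
    subst hv hD hw
    have := hr.ne'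
    field_simp
    ring
  rw [e]
  have h1 : g / (2*r^3) ≤ 0 := div_nonpos_of_nonpos_of_nonneg hg (by positivity)
  have h2 : (1/(2*r)) * (-N - r^2 * Nl) ≤ 0 := mul_nonpos_of_nonneg_of_nonpos (by positivity) (by linarith)
  linarith

theorem entropy_main (T : ℝ)
    (h : ℝ → (Fin n → ℝ) → ℝ) (hsol : IsHeleShawSol n T h)
    (ha : ∀ t ∈ Set.Icc 0 T, ∀ x, 0 < HSa n h t x) (t : ℝ) (ht : t ∈ Set.Icc 0 T) (x : Fin n → ℝ) :
      (0 ≤ -HSgamma n h t x / (2 * HSa n h t x)) ∧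
      (deriv (fun s => entV n h s x) t + Lop n h t (entV n h t) x
          + (-HSgamma n h t x / (2 * HSa n h t x)) * entV n h t x ≤ 0) := by
  have hh : ContDiff ℝ (⊤:ℕ∞) (h t) := hsol.smooth.comp (contDiff_const.prodMk contDiff_id)
  have hp := hsol.periodic t
  obtain ⟨φ, q, l, S⟩ := exists_static hh hp (fun x => ha t ht x)
  have eB : HSB n h t = fun z => pdE n φ (eY n) (z, h t z) := funext fun z => (ops_eq hh hp S.hφ z).2.1
  have eV : HSV n h t = fun z i => pdE n φ (eX n i) (z, h t z) := funext fun z => funext fun i => (ops_eq hh hp S.hφ z).2.2 i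
  have ea : HSa n h t = fun z => 1 - pdE n φ (eY n) (z, h t z) := by
    funext z; unfold HSa; rw [eB]
  have eht : ∀ z, deriv (fun s => h s z) t = -(pdE n φ (eY n) (z, h t z)) + (1 - pdE n φ (eY n) (z, h t z)) * ∑ i, (pdX n (h t) i z)^2 := by
    intro z
    have h1 := hsol.equation t ht z
    rw [S.dtn S.hφ] at h1
    unfold Nd at h1
    simp only [S.V_eq _ z] at h1
    have : ∑ i, pdX n (h t) i z * ((1 - pdE n φ (eY n) (z, h t z)) * pdX n (h t) i z) = (1 - pdE n φ (eY n) (z, h t z)) * ∑ i, (pdX n (h t) i z)^2 := by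
      rw [Finset.mul_sum]; exact Finset.sum_congr rfl fun i _ => by ring
    rw [this] at h1
    linarith
  have eV2 : ∀ z, ∑ i, (pdE n φ (eX n i) (z, h t z))^2 = (1 - pdE n φ (eY n) (z, h t z))^2 * ∑ i, (pdX n (h t) i z)^2 := by
    intro z
    rw [Finset.mul_sum]; exact Finset.sum_congr rfl fun i _ => by rw [S.V_eq]; ring
  have hχ : HExt (h t) (fun x => (1 - pdE n φ (eY n) (x, h t x)) * deriv (fun s => h s x) t) (fun p => q p - pdE n φ (eY n) p) :=
    (S.hq.sub S.hY).congr fun z => by rw [eht, eV2]; ring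
  have hBt := time_deriv hsol.smooth hsol.periodic t S.hφ hχ x
  rw [pdE_fun_sub S.hq.smooth S.hY.smooth] at hBt
  set b := pdE n φ (eY n) (x, h t x) with hb
  set byy := pdE n (pdE n φ (eY n)) (eY n) (x, h t x) with hbyy
  set N := Nd (h t) (pdE n φ (eY n)) x with hN
  set g := pdE n q (eY n) (x, h t x) - 2 * b * byy
      - 2 * ∑ i, pdE n φ (eX n i) (x, h t x) * pdE n (pdE n φ (eY n)) (eX n i) (x, h t x) with hg
  have s2 : (0:ℝ) < 1 + ∑ i, (pdX n (h t) i x)^2 := by positivity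
  have eg : HSgamma n h t x = g := by
    unfold HSgamma
    simp only [eB, eV]
    rw [S.dtn S.hq, S.dtn S.hY]
    simp only [fun i => S.dtn (S.hX i) x]
    rw [S.gam_eq x, inv_mul_cancel_left₀ s2.ne']
  have g0 : g ≤ 0 := by
    have h1 := S.gam_nonpos x
    rw [S.gam_eq x] at h1
    exact nonpos_of_mul_nonpos_right h1 s2
  have a0 : 0 < 1 - b := S.pos x
  have eax : HSa n h t x = 1 - b := by rw [ea]
  refine ⟨by rw [eg, eax]; exact div_nonneg (by linarith) (by linarith), ?_⟩
  set r := Real.sqrt (1 - b) with hr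
  have r0 : 0 < r := Real.sqrt_pos.2 a0
  have r2 : r^2 = 1 - b := Real.sq_sqrt a0.le
  have ev : ∀ s z, entV n h s z = Fent (HSa n h s z) := fun s z => rfl
  set D := (Real.log r - 1) / (2 * r^3) with hD
  have hF : HasDerivAt Fent D (1 - b) := Fent_deriv a0
  -- time derivative
  set Bt := pdE n q (eY n) (x, h t x) - byy + byy * deriv (fun s => h s x) t with hBtd
  have dt : deriv (fun s => entV n h s x) t = D * (-Bt) := by
    have h1 : HasDerivAt (fun s => HSa n h s x) (-Bt) t := hBt.const_sub 1
    have hF' : HasDerivAt Fent D (HSa n h t x) := by rw [eax]; exact hF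
    exact (HasDerivAt.comp t hF' h1).deriv
  -- space derivative
  have sB : ContDiff ℝ (⊤:ℕ∞) fun z => pdE n φ (eY n) (z, h t z) := slice_smooth hh S.hY.smooth
  have dx : ∀ i, pdX n (entV n h t) i x = D * (-(pdE n (pdE n φ (eY n)) (eX n i) (x, h t x) + pdX n (h t) i x * byy)) := by
    intro i
    have e1 : entV n h t = fun z => Fent (1 - pdE n φ (eY n) (z, h t z)) := by
      funext z; rw [ev, ea]
    have d1 := (sB.differentiable (by simp) x).hasFDerivAt
    have d2 := HasDerivAt.comp_hasFDerivAt x (f := fun z => 1 - pdE n φ (eY n) (z, h t z)) hF (d1.const_sub 1)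
    have e2 := slice_pd hh S.hY.smooth i x
    rw [e1]
    unfold pdX at e2 ⊢
    have e3 := d2.fderiv
    simp only [Function.comp_def] at e3
    rw [e3, ← e2]
    simp
  have edtn : DtN n (h t) (fun z => Real.sqrt (HSa n h t z) * entV n h t z) x = -(1/2) * Nd (h t) l x := by
    have E : HExt (h t) (fun z => Real.sqrt (HSa n h t z) * entV n h t z) (fun p => (-(1/2)) * l p) := by
      refine (S.hl.smul (-(1/2))).congr fun z => ?_
      have hz := S.pos z
      have hz' := (Real.sqrt_pos.2 hz).ne'
      rw [ev, ea]; simp only [Fent]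
      rw [one_div (Real.sqrt _), Real.log_inv, Real.log_sqrt hz.le, ← mul_assoc, mul_inv_cancel₀ hz']
      ring
    rw [S.dtn E, Nd_smul S.hl.smooth]
  have ediv : divX n (HSV n h t) x = -N := by
    unfold divX; rw [eV]; exact S.div_eq x
  have evx : entV n h t x = - Real.log r / r := by
    rw [ev, eax, Fent, ← hr, one_div, Real.log_inv]
    field_simp
  unfold Lop
  rw [dt, edtn, ediv, eg, eax, ← hr, eV]
  simp only [dx]
  have hlog := S.log_ineq x
  rw [← hb, ← r2] at hlog
  have key : Bt - ∑ i, pdE n φ (eX n i) (x, h t x) * (pdE n (pdE n φ (eY n)) (eX n i) (x, h t x) + pdX n (h t) i x * byy) = g - r^2 * N := by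
    have k1 : N = byy - ∑ i, pdX n (h t) i x * pdE n (pdE n φ (eY n)) (eX n i) (x, h t x) := rfl
    have k2 : ∑ i, pdE n φ (eX n i) (x, h t x) * (pdE n (pdE n φ (eY n)) (eX n i) (x, h t x) + pdX n (h t) i x * byy)
       = (1 - b) * ∑ i, pdX n (h t) i x * pdE n (pdE n φ (eY n)) (eX n i) (x, h t x) + (1 - b) * byy * ∑ i, (pdX n (h t) i x)^2 := by
      rw [Finset.mul_sum, Finset.mul_sum, ← Finset.sum_add_distrib]
      exact Finset.sum_congr rfl fun i _ => by rw [S.V_eq]; ring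
    have k3 : ∑ i, pdE n φ (eX n i) (x, h t x) * pdE n (pdE n φ (eY n)) (eX n i) (x, h t x)
       = (1 - b) * ∑ i, pdX n (h t) i x * pdE n (pdE n φ (eY n)) (eX n i) (x, h t x) := by
      rw [Finset.mul_sum]
      exact Finset.sum_congr rfl fun i _ => by rw [S.V_eq]; ring
    rw [k2, hg, k3, k1, hBtd, eht x, r2, ← hb]
    ring
  have fin := final_alg r0 g0 hlog evx hD key
  rw [r2] at fin
  refine le_of_eq_of_le ?_ fin
  have k4 : ∑ i, pdE n φ (eX n i) (x, h t x) * (D * (-(pdE n (pdE n φ (eY n)) (eX n i) (x, h t x) + pdX n (h t) i x * byy)))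
     = -D * ∑ i, pdE n φ (eX n i) (x, h t x) * (pdE n (pdE n φ (eY n)) (eX n i) (x, h t x) + pdX n (h t) i x * byy) := by
    rw [Finset.mul_sum]
    exact Finset.sum_congr rfl fun i _ => by ring
  rw [k4]
  ring

end Gal

/-- v = (1/√a)log(1/√a) satisfies ∂ₜv + L(h)v + c v = f with
c = −γ/(2a) ≥ 0 and f = ∂ₜv + L(h)v + c v ≤ 0; i.e. v is a sub-solution:
∂ₜv + L(h)v − (γ/(2a)) v ≤ 0 pointwise. -/
theorem heleShaw_entropy_v (n : ℕ) (hn : 1 ≤ n) (T : ℝ) (hT : 0 ≤ T)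
    (h : ℝ → (Fin n → ℝ) → ℝ) (hsol : IsHeleShawSol n T h)
    (ha : ∀ t ∈ Set.Icc 0 T, ∀ x, 0 < HSa n h t x) :
    ∀ t ∈ Set.Icc 0 T, ∀ x,
      (0 ≤ -HSgamma n h t x / (2 * HSa n h t x)) ∧
      (deriv (fun s => entV n h s x) t + Lop n h t (entV n h t) x
          + (-HSgamma n h t x / (2 * HSa n h t x)) * entV n h t x ≤ 0) := by
  intro t ht x
  exact Gal.entropy_main T h hsol ha t ht x

end
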